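/- Let q be a power of a prime p and let ν : 𝔽_q[x] → ℂ be a 1-bounded multiplicative function. Suppose that for every Dirichlet character χ, every short interval character ξ, and every θ ∈ [0,1), the pretentious distance D(ν, χ·ξ·e_θ; N) tends to infinity as N → ∞. Then for every positive integer m with m < p, every polynomial map P : 𝔽_q[x] → 𝔽_q of degree at most m, and every additive character α of 𝔽_q, one has (1/q^n)·∑_{g ∈ G_n} ν(g)·α(P(g)) → 0 as n → ∞. -/

import Mathlib

open Polynomial Filter

/-- The polynomial with coefficient vector `c`, an element of `G_n` (degree < n). -/
noncomputable def polyOf {F : Type*} [Semiring F] {n : ℕ} (c : Fin n → F) : Polynomial F :=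
  ∑ i, Polynomial.C (c i) * Polynomial.X ^ (i : ℕ)

/-- Multiplicative function on `𝔽_q[x]`. -/
def IsMultFn {F : Type*} [CommSemiring F] (f : Polynomial F → ℂ) : Prop :=
  ∀ g h : Polynomial F, IsCoprime g h → f (g * h) = f g * f h

/-- Difference operator `Δ_h P (g) = P (g + h) - P g`. -/
def Δop {A M : Type*} [Add A] [Sub M] (h : A) (P : A → M) : A → M := fun g => P (g + h) - P g

/-- `P` is a polynomial map of degree at most `m`. -/
def DegLE {A M : Type*} [Add A] [AddGroup M] (P : A → M) (m : ℕ) : Prop :=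
  ∀ h : Fin (m + 1) → A, ∀ g : A, (List.ofFn h).foldr Δop P g = 0

/-- Dirichlet character on `𝔽_q[x]`: completely multiplicative, periodic modulo
some nonzero `s`, nonvanishing exactly on polynomials coprime to `s`. -/
def IsDirichletChar {F : Type*} [Field F] (χ : Polynomial F → ℂ) : Prop :=
  (∀ g h : Polynomial F, χ (g * h) = χ g * χ h) ∧
  ∃ s : Polynomial F, s ≠ 0 ∧ (∀ g h : Polynomial F, s ∣ g - h → χ g = χ h) ∧
    (∀ g : Polynomial F, χ g ≠ 0 ↔ IsCoprime g s)

/-- The `i`-th coefficient of `g` from the top (coefficients below the bottom count as 0). -/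
noncomputable def topCoeff {F : Type*} [Semiring F] (g : Polynomial F) (i : ℕ) : F :=
  if i ≤ g.natDegree then g.coeff (g.natDegree - i) else 0

/-- Short interval character on `𝔽_q[x]`: multiplicative, not identically zero,
depending only on the top `s+1` coefficients for some `s`. -/
def IsShortIntervalChar {F : Type*} [Field F] (ξ : Polynomial F → ℂ) : Prop :=
  (∀ g h : Polynomial F, IsCoprime g h → ξ (g * h) = ξ g * ξ h) ∧
  (∃ g, ξ g ≠ 0) ∧
  ∃ s : ℕ, ∀ g h : Polynomial F, g ≠ 0 → h ≠ 0 →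
    (∀ i ≤ s, topCoeff g i = topCoeff h i) → ξ g = ξ h

/-- The archimedean character `e_θ(g) = exp(2πiθ·deg g)`. -/
noncomputable def eTheta {F : Type*} [Semiring F] (θ : ℝ) (g : Polynomial F) : ℂ :=
  Complex.exp (2 * Real.pi * Complex.I * (θ : ℂ) * (g.natDegree : ℂ))

/-- The pretentious distance `D(f,g;N)` over monic irreducibles of degree at most `N`. -/
noncomputable def pretDist {F : Type*} [Field F] [Fintype F]
    (f g : Polynomial F → ℂ) (N : ℕ) : ℝ :=
  Real.sqrt (∑' P : {P : Polynomial F // P.Monic ∧ Irreducible P ∧ P.natDegree ≤ N},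
    (Fintype.card F : ℝ) ^ (-(P.1.natDegree : ℤ)) *
      (1 - (f P.1 * (starRingEnd ℂ) (g P.1)).re))

set_option linter.unusedSectionVars false

section Halasz
open Topology

lemma norm_le_one_of_recursion {a c : ℕ → ℂ} (ha0 : a 0 = 1) (hc : ∀ k, ‖c k‖ ≤ 1)
    (hrec : ∀ n, ((n + 1 : ℕ) : ℂ) * a (n + 1) = ∑ k ∈ Finset.range (n + 1), c (k + 1) * a (n - k))
    (n : ℕ) : ‖a n‖ ≤ 1 := by
  induction n using Nat.strong_induction_on with
  | _ n ih =>
    cases n with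
    | zero => simp [ha0]
    | succ n =>
      have h1 : ‖((n + 1 : ℕ) : ℂ) * a (n + 1)‖ ≤ (n + 1 : ℕ) := by
        rw [hrec]
        refine (norm_sum_le _ _).trans ?_
        refine (Finset.sum_le_card_nsmul _ _ 1 fun k hk => ?_).trans (by simp)
        rw [norm_mul]
        exact mul_le_one₀ (hc _) (norm_nonneg _) (ih _ (by omega))
      rw [norm_mul, Complex.norm_natCast] at h1
      have : (0 : ℝ) < ((n + 1 : ℕ) : ℝ) := by positivity
      nlinarith

lemma mul_norm_le_sum_of_recursion {a c : ℕ → ℂ} (hc : ∀ k, ‖c k‖ ≤ 1)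
    (hrec : ∀ n, ((n + 1 : ℕ) : ℂ) * a (n + 1) = ∑ k ∈ Finset.range (n + 1), c (k + 1) * a (n - k))
    (n : ℕ) : (n : ℝ) * ‖a n‖ ≤ ∑ j ∈ Finset.range n, ‖a j‖ := by
  cases n with
  | zero => simp
  | succ n =>
    rw [← Complex.norm_natCast, ← norm_mul, hrec, ← Finset.sum_range_reflect]
    refine (norm_sum_le _ _).trans (Finset.sum_le_sum fun k hk => ?_)
    rw [norm_mul]
    have hk' : n - (n + 1 - 1 - k) = k := by have := Finset.mem_range.1 hk; omega
    rw [hk']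
    exact mul_le_of_le_one_left (norm_nonneg (a k)) (hc _)

lemma summable_bounded_mul_pow {b : ℕ → ℂ} {C : ℝ} (hb : ∀ n, ‖b n‖ ≤ C) {z : ℂ} (hz : ‖z‖ < 1) :
    Summable fun n => ‖b n * z ^ n‖ := by
  refine Summable.of_nonneg_of_le (fun _ => norm_nonneg _) (fun n => ?_)
    ((summable_geometric_of_lt_one (norm_nonneg z) hz).mul_left C)
  rw [norm_mul, norm_pow]
  exact mul_le_mul_of_nonneg_right (hb n) (by positivity)

lemma hasDerivAt_tsum_bounded_mul_pow {b : ℕ → ℂ} {C : ℝ} (hb : ∀ n, ‖b n‖ ≤ C) {z : ℂ}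
    (hz : ‖z‖ < 1) :
    HasDerivAt (fun z : ℂ => ∑' n, b n * z ^ n) (∑' n, ((n + 1 : ℕ) : ℂ) * b (n + 1) * z ^ n) z := by
  obtain ⟨R, hzR, hR1⟩ := exists_between hz
  have hR0 : 0 ≤ R := (norm_nonneg z).trans hzR.le
  have hu : Summable fun n : ℕ => C * ((n : ℝ) * R ^ (n - 1)) := by
    refine Summable.mul_left _ ?_
    rw [← summable_nat_add_iff 1]
    have h1 := summable_pow_mul_geometric_of_norm_lt_one 1 (r := R)
      (by rwa [Real.norm_of_nonneg hR0])
    have h0 := summable_geometric_of_lt_one hR0 hR1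
    refine (h1.add h0).congr fun n => ?_
    push_cast
    simp
    ring
  have hC : 0 ≤ C := (norm_nonneg _).trans (hb 0)
  have key := hasDerivAt_tsum_of_isPreconnected (𝕜 := ℂ) (F := ℂ) (t := Metric.ball 0 R)
    (g := fun n z => b n * z ^ n) (g' := fun n z => b n * ((n : ℂ) * z ^ (n - 1)))
    (y₀ := 0) (y := z) hu Metric.isOpen_ball (convex_ball _ _).isPreconnected
    (fun n y _ => (hasDerivAt_pow n y).const_mul _)
    (fun n y hy => ?_) (by simpa using (norm_nonneg z).trans_lt hzR) ?_ (by simpa using hzR)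
  · refine key.congr_deriv ?_
    rw [Summable.tsum_eq_zero_add]
    · simp
      congr 1
      ext n
      ring
    · refine Summable.of_norm_bounded hu (fun n => ?_)
      rw [norm_mul, norm_mul, norm_pow, Complex.norm_natCast]
      gcongr
      exact hb n
  · rw [norm_mul, norm_mul, norm_pow, Complex.norm_natCast]
    have : ‖y‖ ≤ R := by simpa using (Metric.mem_ball.1 hy).le
    gcongr
    exact hb n
  · exact (summable_bounded_mul_pow hb (by simp)).of_norm

lemma tsum_eq_exp_of_recursion {a c : ℕ → ℂ} (ha0 : a 0 = 1) (hc : ∀ k, ‖c k‖ ≤ 1)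
    (hrec : ∀ n, ((n + 1 : ℕ) : ℂ) * a (n + 1) = ∑ k ∈ Finset.range (n + 1), c (k + 1) * a (n - k))
    {z : ℂ} (hz : ‖z‖ < 1) :
    ∑' n, a n * z ^ n = Complex.exp (∑' n, c n / n * z ^ n) := by
  have ha := norm_le_one_of_recursion ha0 hc hrec
  have hcn : ∀ n : ℕ, ‖c n / n‖ ≤ 1 := by
    intro n
    rcases Nat.eq_zero_or_pos n with rfl | hn
    · simp
    rw [norm_div, Complex.norm_natCast, div_le_one (by positivity)]
    exact (hc n).trans (by exact_mod_cast hn)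
  set A : ℂ → ℂ := fun z => ∑' n, a n * z ^ n with hA
  set L : ℂ → ℂ := fun z => ∑' n, c n / n * z ^ n with hL
  have hd : ∀ z : ℂ, ‖z‖ < 1 → HasDerivAt (fun z => A z * Complex.exp (-L z)) 0 z := by
    intro z hz
    have h1 := hasDerivAt_tsum_bounded_mul_pow ha hz
    have h2 := hasDerivAt_tsum_bounded_mul_pow hcn hz
    have h3 := h1.mul (h2.neg.cexp)
    refine h3.congr_deriv ?_
    have e2 : (∑' n, ((n + 1 : ℕ) : ℂ) * (c (n + 1) / (n + 1 : ℕ)) * z ^ n) =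
        ∑' n, c (n + 1) * z ^ n := by
      congr 1
      ext n
      have : ((n + 1 : ℕ) : ℂ) ≠ 0 := by exact_mod_cast Nat.succ_ne_zero n
      field_simp
    have e1 : (∑' n, ((n + 1 : ℕ) : ℂ) * a (n + 1) * z ^ n) =
        (∑' n, c (n + 1) * z ^ n) * ∑' n, a n * z ^ n := by
      rw [tsum_mul_tsum_eq_tsum_sum_range_of_summable_norm
        (summable_bounded_mul_pow (fun n => hc (n + 1)) hz) (summable_bounded_mul_pow ha hz)]
      congr 1
      ext n
      rw [hrec, Finset.sum_mul]
      refine Finset.sum_congr rfl fun k hk => ?_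
      have : z ^ n = z ^ k * z ^ (n - k) := by
        rw [← pow_add]; congr 1; have := Finset.mem_range.1 hk; omega
      rw [this]; ring
    rw [e2, e1]
    simp only [Pi.neg_apply]
    ring
  have hconst := (Metric.isOpen_ball (x := (0 : ℂ)) (ε := 1)).is_const_of_deriv_eq_zero
    (convex_ball _ _).isPreconnected
    (f := fun z => A z * Complex.exp (-L z))
    (fun z hz => (hd z (by simpa using hz)).differentiableAt.differentiableWithinAt)
    (fun z hz => (hd z (by simpa using hz)).deriv)
    (x := z) (y := 0) (by simpa using hz) (by simp)
  have hA0 : A 0 = 1 := by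
    simp only [hA]
    rw [tsum_eq_single 0 (fun n hn => by simp [hn])]
    simp [ha0]
  have hL0 : L 0 = 0 := by
    simp only [hL]
    rw [tsum_eq_single 0 (fun n hn => by simp [hn])]
    simp
  simp only [hA0, hL0, neg_zero, Complex.exp_zero, mul_one, Complex.exp_neg] at hconst
  have hne := Complex.exp_ne_zero (L z)
  field_simp at hconst
  exact hconst

lemma norm_tsum_mul_eq_exp {a c : ℕ → ℂ} (ha0 : a 0 = 1) (hc : ∀ k, ‖c k‖ ≤ 1)
    (hrec : ∀ n, ((n + 1 : ℕ) : ℂ) * a (n + 1) = ∑ k ∈ Finset.range (n + 1), c (k + 1) * a (n - k))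
    {ω : ℂ} (hω : ‖ω‖ = 1) {r : ℝ} (hr0 : 0 ≤ r) (hr1 : r < 1) :
    Summable (fun k : ℕ => (1 - (c (k + 1) * ω ^ (k + 1)).re) / (k + 1) * r ^ (k + 1)) ∧
    ‖∑' n, a n * (r * ω) ^ n‖ * (1 - r) =
      Real.exp (-∑' k : ℕ, (1 - (c (k + 1) * ω ^ (k + 1)).re) / (k + 1) * r ^ (k + 1)) := by
  have hz : ‖(r : ℂ) * ω‖ < 1 := by
    rw [norm_mul, hω, mul_one, Complex.norm_real, Real.norm_of_nonneg hr0]; exact hr1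
  have hlog := Real.hasSum_pow_div_log_of_abs_lt_one (x := r) (by rwa [abs_of_nonneg hr0])
  have hcn : ∀ n : ℕ, ‖c n / n‖ ≤ 1 := by
    intro n
    rcases Nat.eq_zero_or_pos n with rfl | hn
    · simp
    rw [norm_div, Complex.norm_natCast, div_le_one (by positivity)]
    exact (hc n).trans (by exact_mod_cast hn)
  have hs := (summable_bounded_mul_pow hcn hz).of_norm
  have hs1 : Summable fun k : ℕ => (c (k + 1) / (k + 1 : ℕ) * (r * ω) ^ (k + 1)) :=
    (summable_nat_add_iff 1).2 hs
  have e1 : ∑' n, c n / n * (r * ω) ^ n = ∑' k : ℕ, (c (k + 1) / (k + 1 : ℕ) * (r * ω) ^ (k + 1)) := by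
    rw [hs.tsum_eq_zero_add]; simp
  have hre := (Complex.hasSum_re hs1.hasSum)
  have hsub := hlog.sub hre
  have hfun : (fun k : ℕ => r ^ (k + 1) / ((k : ℝ) + 1) -
      (c (k + 1) / (k + 1 : ℕ) * (r * ω) ^ (k + 1)).re) =
      fun k : ℕ => (1 - (c (k + 1) * ω ^ (k + 1)).re) / (k + 1) * r ^ (k + 1) := by
    ext k
    have : c (k + 1) / (k + 1 : ℕ) * (r * ω) ^ (k + 1) =
        ((r ^ (k + 1) / (k + 1) : ℝ) : ℂ) * (c (k + 1) * ω ^ (k + 1)) := by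
      push_cast
      rw [mul_pow]; ring
    rw [this, Complex.re_ofReal_mul]
    ring
  rw [hfun] at hsub
  refine ⟨hsub.summable, ?_⟩
  rw [hsub.tsum_eq, tsum_eq_exp_of_recursion ha0 hc hrec hz, Complex.norm_exp, e1]
  rw [neg_sub, sub_neg_eq_add, Real.exp_add, Real.exp_log (by linarith)]

lemma eventually_norm_tsum_small {a c : ℕ → ℂ} (ha0 : a 0 = 1) (hc : ∀ k, ‖c k‖ ≤ 1)
    (hrec : ∀ n, ((n + 1 : ℕ) : ℂ) * a (n + 1) = ∑ k ∈ Finset.range (n + 1), c (k + 1) * a (n - k))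
    (hdiv : ∀ ω : ℂ, ‖ω‖ = 1 → ∀ B : ℝ, ∃ N : ℕ,
      B < ∑ k ∈ Finset.range N, (1 - (c (k + 1) * ω ^ (k + 1)).re) / (k + 1))
    {ε : ℝ} (hε : 0 < ε) :
    ∃ r0 < (1 : ℝ), ∀ r, r0 ≤ r → 0 ≤ r → r < 1 → ∀ ω : ℂ, ‖ω‖ = 1 →
      ‖∑' n, a n * (r * ω) ^ n‖ * (1 - r) ≤ ε := by
  have hnn : ∀ ω : ℂ, ‖ω‖ = 1 → ∀ k : ℕ, 0 ≤ (1 - (c (k + 1) * ω ^ (k + 1)).re) / (k + 1) := by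
    intro ω hω k
    have : (c (k + 1) * ω ^ (k + 1)).re ≤ 1 := by
      refine (Complex.re_le_norm _).trans ?_
      rw [norm_mul, norm_pow, hω, one_pow, mul_one]
      exact hc _
    have h2 : (0 : ℝ) < k + 1 := by positivity
    exact div_nonneg (by linarith) h2.le
  set B : ℝ := 2 * max 0 (-Real.log ε) with hB
  obtain ⟨N, hN⟩ : ∃ N : ℕ, ∀ ω : ℂ, ‖ω‖ = 1 →
      B < ∑ k ∈ Finset.range N, (1 - (c (k + 1) * ω ^ (k + 1)).re) / (k + 1) := by
    obtain ⟨N, hN⟩ := (isCompact_sphere (0 : ℂ) 1).elim_directed_cover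
      (fun N : ℕ => {ω : ℂ | B < ∑ k ∈ Finset.range N,
        max 0 ((1 - (c (k + 1) * ω ^ (k + 1)).re) / (k + 1))})
      (fun N => by
        refine isOpen_lt continuous_const ?_
        fun_prop)
      (fun ω hω => by
        have hω' : ‖ω‖ = 1 := by simpa using hω
        obtain ⟨N, hN⟩ := hdiv ω hω' B
        refine Set.mem_iUnion.2 ⟨N, hN.trans_le (Finset.sum_le_sum fun k _ => le_max_right _ _)⟩)
      (directed_of_isDirected_le (fun i j hij ω hω => by
        refine lt_of_lt_of_le (show B < _ from hω) ?_
        exact Finset.sum_le_sum_of_subset_of_nonneg (Finset.range_subset_range.2 hij)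
          (fun _ _ _ => le_max_left _ _)))
    refine ⟨N, fun ω hω => ?_⟩
    have h1 : B < _ := hN (show ω ∈ Metric.sphere (0 : ℂ) 1 by simpa using hω)
    refine h1.trans_le (Finset.sum_le_sum fun k _ => ?_)
    rw [max_eq_right (hnn ω hω k)]
  obtain ⟨r0, hr01, hr0⟩ : ∃ r0 < (1 : ℝ), ∀ r, r0 ≤ r → 0 ≤ r → r < 1 → 1 / 2 ≤ r ^ N := by
    have : ∀ᶠ r : ℝ in 𝓝 1, 1 / 2 < r ^ N := by
      have hcont : Continuous fun r : ℝ => r ^ N := continuous_pow N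
      exact (hcont.tendsto 1).eventually (lt_mem_nhds (by norm_num))
    obtain ⟨δ, hδ, h⟩ := Metric.eventually_nhds_iff.1 this
    refine ⟨1 - δ / 2, by linarith, fun r h1 h2 h3 => (h ?_).le⟩
    rw [Real.dist_eq, abs_lt]
    constructor <;> linarith
  refine ⟨r0, hr01, fun r h1 h2 h3 ω hω => ?_⟩
  obtain ⟨hsum, heq⟩ := norm_tsum_mul_eq_exp ha0 hc hrec hω h2 h3
  rw [heq]
  have hlow : B / 2 ≤ ∑' k : ℕ, (1 - (c (k + 1) * ω ^ (k + 1)).re) / (k + 1) * r ^ (k + 1) := by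
    refine le_trans ?_ (hsum.sum_le_tsum (Finset.range N)
      (fun k _ => mul_nonneg (hnn ω hω k) (by positivity)))
    calc B / 2 ≤ (∑ k ∈ Finset.range N, (1 - (c (k + 1) * ω ^ (k + 1)).re) / (k + 1)) * (1 / 2) := by
          have := hN ω hω; linarith
      _ ≤ _ := by
          rw [Finset.sum_mul]
          refine Finset.sum_le_sum fun k hk => mul_le_mul_of_nonneg_left ?_ (hnn ω hω k)
          refine (hr0 r h1 h2 h3).trans (pow_le_pow_of_le_one h2 h3.le ?_)
          have := Finset.mem_range.1 hk; omega
  calc Real.exp _ ≤ Real.exp (Real.log ε) := by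
        refine Real.exp_le_exp.2 ?_
        have := le_max_right 0 (-Real.log ε)
        linarith
    _ = ε := Real.exp_log hε

lemma sum_norm_sq_eval_rootsOfUnity (p : ℂ[X]) {K : ℕ} (hK : p.natDegree < K) {ζ : ℂ}
    (hζ : IsPrimitiveRoot ζ K) :
    ∑ t ∈ Finset.range K, ‖p.eval (ζ ^ t)‖ ^ 2 = K * ∑ j ∈ Finset.range K, ‖p.coeff j‖ ^ 2 := by
  have hK0 : K ≠ 0 := by omega
  have hnorm : ‖ζ‖ = 1 := hζ.norm'_eq_one hK0
  have hζ0 : ζ ≠ 0 := fun h => by simp [h] at hnorm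
  have hconj : (starRingEnd ℂ) ζ = ζ⁻¹ := (Complex.inv_eq_conj hnorm).symm
  have horth : ∀ i ∈ Finset.range K, ∀ j ∈ Finset.range K,
      ∑ t ∈ Finset.range K, (ζ ^ t) ^ i * (starRingEnd ℂ) ((ζ ^ t) ^ j) = if i = j then (K : ℂ) else 0 := by
    intro i hi j hj
    have h1 : ∀ t, (ζ ^ t) ^ i * (starRingEnd ℂ) ((ζ ^ t) ^ j) = (ζ ^ i * (ζ⁻¹) ^ j) ^ t := by
      intro t
      rw [map_pow, map_pow, hconj, mul_pow, ← pow_mul, ← pow_mul, ← pow_mul, ← pow_mul]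
      ring
    simp_rw [h1]
    split_ifs with hij
    · subst hij
      rw [← mul_pow, mul_inv_cancel₀ hζ0]
      simp
    · have hx1 : ζ ^ i * (ζ⁻¹) ^ j ≠ 1 := by
        intro h
        rw [inv_pow, ← div_eq_mul_inv, div_eq_one_iff_eq (pow_ne_zero _ hζ0)] at h
        exact hij (hζ.pow_inj (Finset.mem_range.1 hi) (Finset.mem_range.1 hj) h)
      rw [geom_sum_eq hx1, mul_pow, inv_pow, inv_pow]
      have : (ζ ^ i) ^ K = 1 := by rw [← pow_mul, mul_comm, pow_mul, hζ.pow_eq_one, one_pow]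
      have h' : (ζ ^ j) ^ K = 1 := by rw [← pow_mul, mul_comm, pow_mul, hζ.pow_eq_one, one_pow]
      simp [this, h']
  have hC : ∀ z : ℂ, ((‖z‖ ^ 2 : ℝ) : ℂ) = z * (starRingEnd ℂ) z := fun z => by
    rw [Complex.mul_conj, Complex.normSq_eq_norm_sq]
  apply Complex.ofReal_injective
  push_cast
  simp_rw [← Complex.ofReal_pow, hC, Polynomial.eval_eq_sum_range' hK, map_sum, Finset.sum_mul_sum]
  rw [Finset.sum_comm, Finset.mul_sum]
  refine Finset.sum_congr rfl fun i hi => ?_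
  rw [Finset.sum_comm]
  have : ∀ j ∈ Finset.range K, ∑ t ∈ Finset.range K, p.coeff i * (ζ ^ t) ^ i *
      (starRingEnd ℂ) (p.coeff j * (ζ ^ t) ^ j) =
      if i = j then p.coeff i * (starRingEnd ℂ) (p.coeff j) * K else 0 := by
    intro j hj
    have h2 : ∀ t ∈ Finset.range K, p.coeff i * (ζ ^ t) ^ i * (starRingEnd ℂ) (p.coeff j * (ζ ^ t) ^ j) =
        p.coeff i * (starRingEnd ℂ) (p.coeff j) * ((ζ ^ t) ^ i * (starRingEnd ℂ) ((ζ ^ t) ^ j)) := by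
      intro t _
      rw [map_mul]; ring
    rw [Finset.sum_congr rfl h2, ← Finset.mul_sum, horth i hi j hj]
    simp
  rw [Finset.sum_congr rfl this, Finset.sum_ite_eq, if_pos hi]
  ring

lemma sum_sq_mul_norm_sq_le {a c : ℕ → ℂ} (ha : ∀ n, ‖a n‖ ≤ 1) (hc : ∀ k, ‖c k‖ ≤ 1)
    (hrec : ∀ n, ((n + 1 : ℕ) : ℂ) * a (n + 1) = ∑ k ∈ Finset.range (n + 1), c (k + 1) * a (n - k))
    {r : ℝ} (hr0 : 0 ≤ r) (hr1 : r < 1) {S : ℝ}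
    (hS : ∀ ω : ℂ, ‖ω‖ = 1 → ‖∑' n, a n * (r * ω) ^ n‖ ≤ S) (n : ℕ) :
    ∑ j ∈ Finset.range (n + 1), ((j : ℝ) * ‖a j‖ * r ^ j) ^ 2 ≤ (S + 1) ^ 2 * (1 - r)⁻¹ := by
  have hgeo := summable_geometric_of_lt_one hr0 hr1
  obtain ⟨M, hMn, hM⟩ : ∃ M, n < M ∧ r ^ M * (1 - r)⁻¹ ≤ 1 := by
    have h1 : Tendsto (fun M : ℕ => r ^ M * (1 - r)⁻¹) atTop (𝓝 (0 * (1 - r)⁻¹)) :=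
      (tendsto_pow_atTop_nhds_zero_of_lt_one hr0 hr1).mul_const _
    rw [zero_mul] at h1
    obtain ⟨M, h2, h3⟩ := ((eventually_gt_atTop n).and (h1.eventually (gt_mem_nhds one_pos))).exists
    exact ⟨M, h2, h3.le⟩
  set pa : ℂ[X] := ∑ j ∈ Finset.range M, monomial j (a j * (r : ℂ) ^ j) with hpa
  set pc : ℂ[X] := ∑ j ∈ Finset.range M, monomial j (c (j + 1) * (r : ℂ) ^ (j + 1)) with hpc
  have hcoa : ∀ i < M, pa.coeff i = a i * (r : ℂ) ^ i := by
    intro i hi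
    simp [hpa, coeff_monomial, hi]
  have hcoc : ∀ i, pc.coeff i = if i < M then c (i + 1) * (r : ℂ) ^ (i + 1) else 0 := by
    intro i
    simp [hpc, coeff_monomial]
  have hda : pa.natDegree ≤ M := natDegree_sum_le_of_forall_le _ _ fun j hj =>
    (natDegree_monomial_le _).trans (Finset.mem_range.1 hj).le
  have hdc : pc.natDegree ≤ M := natDegree_sum_le_of_forall_le _ _ fun j hj =>
    (natDegree_monomial_le _).trans (Finset.mem_range.1 hj).le
  set K := 2 * M + 1 with hK
  have hK0 : (0 : ℝ) < K := by positivity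
  have hζ := Complex.isPrimitiveRoot_exp K (by omega)
  set ζ := Complex.exp (2 * Real.pi * Complex.I / K)
  have hnorm : ‖ζ‖ = 1 := hζ.norm'_eq_one (by omega)
  have hprod := sum_norm_sq_eval_rootsOfUnity (pc * pa) (K := K)
    (by have := natDegree_mul_le (p := pc) (q := pa); omega) hζ
  have hpcs := sum_norm_sq_eval_rootsOfUnity pc (K := K) (by omega) hζ
  have hevala : ∀ ω : ℂ, ‖ω‖ = 1 → ‖pa.eval ω‖ ≤ S + 1 := by
    intro ω hω
    have hz : ‖(r : ℂ) * ω‖ < 1 := by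
      rw [norm_mul, hω, mul_one, Complex.norm_real, Real.norm_of_nonneg hr0]; exact hr1
    have hs := summable_bounded_mul_pow ha hz
    have h1 : pa.eval ω = ∑ j ∈ Finset.range M, a j * (r * ω) ^ j := by
      rw [hpa, eval_finsetSum]
      refine Finset.sum_congr rfl fun j _ => ?_
      rw [eval_monomial, mul_pow]; ring
    have h2 := hs.of_norm.sum_add_tsum_nat_add M
    rw [h1, ← add_sub_cancel_right (∑ j ∈ Finset.range M, a j * (r * ω) ^ j)
      (∑' i, a (i + M) * (r * ω) ^ (i + M)), h2]
    refine (norm_sub_le _ _).trans (add_le_add (hS ω hω) ?_)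
    refine le_trans ?_ hM
    rw [mul_comm (r ^ M), ← tsum_geometric_of_lt_one hr0 hr1, ← tsum_mul_right]
    refine tsum_of_norm_bounded (hgeo.mul_right _).hasSum fun i => ?_
    rw [norm_mul, norm_pow, norm_mul, hω, mul_one, Complex.norm_real, Real.norm_of_nonneg hr0,
      ← pow_add]
    exact mul_le_of_le_one_left (by positivity) (ha _)
  have hcoeff : ∀ i < M, ‖(pc * pa).coeff i‖ = ((i + 1 : ℕ) : ℝ) * ‖a (i + 1)‖ * r ^ (i + 1) := by
    intro i hi
    have : (pc * pa).coeff i = ((i + 1 : ℕ) : ℂ) * a (i + 1) * (r : ℂ) ^ (i + 1) := by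
      rw [coeff_mul, Finset.Nat.sum_antidiagonal_eq_sum_range_succ_mk, hrec, Finset.sum_mul]
      refine Finset.sum_congr rfl fun k hk => ?_
      have hk := Finset.mem_range.1 hk
      rw [hcoc, hcoa _ (by omega), if_pos (by omega)]
      have : (r : ℂ) ^ (i + 1) = (r : ℂ) ^ (k + 1) * (r : ℂ) ^ (i - k) := by
        rw [← pow_add]; congr 1; omega
      rw [this]; ring
    rw [this, norm_mul, norm_mul, Complex.norm_natCast, norm_pow, Complex.norm_real,
      Real.norm_of_nonneg hr0]
  have hcs : ∑ j ∈ Finset.range K, ‖pc.coeff j‖ ^ 2 ≤ (1 - r)⁻¹ := by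
    rw [← tsum_geometric_of_lt_one hr0 hr1]
    refine le_trans (Finset.sum_le_sum fun j _ => ?_) (hgeo.sum_le_tsum _ fun _ _ => by positivity)
    rw [hcoc]
    split_ifs
    · rw [norm_mul, norm_pow, Complex.norm_real, Real.norm_of_nonneg hr0]
      calc (‖c (j + 1)‖ * r ^ (j + 1)) ^ 2 ≤ (1 * r ^ (j + 1)) ^ 2 := by
            gcongr; exact hc _
        _ = r ^ j * r ^ (j + 2) := by ring
        _ ≤ r ^ j * 1 := by
            gcongr; exact pow_le_one₀ hr0 hr1.le
        _ = _ := mul_one _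
    · simp; positivity
  have hS0 : 0 ≤ S := (norm_nonneg _).trans (hS 1 (by simp))
  have hmain : ∑ j ∈ Finset.range K, ‖(pc * pa).coeff j‖ ^ 2 ≤ (S + 1) ^ 2 * (1 - r)⁻¹ := by
    have h1 : (K : ℝ) * ∑ j ∈ Finset.range K, ‖(pc * pa).coeff j‖ ^ 2 ≤
        (S + 1) ^ 2 * (K * ∑ j ∈ Finset.range K, ‖pc.coeff j‖ ^ 2) := by
      rw [← hprod, ← hpcs, Finset.mul_sum (Finset.range K)]
      refine Finset.sum_le_sum fun t _ => ?_
      rw [eval_mul, norm_mul, mul_pow, mul_comm]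
      gcongr
      exact hevala _ (by rw [norm_pow, hnorm, one_pow])
    have h2 : (K : ℝ) * ∑ j ∈ Finset.range K, ‖(pc * pa).coeff j‖ ^ 2 ≤
        K * ((S + 1) ^ 2 * (1 - r)⁻¹) := by
      refine h1.trans ?_
      rw [mul_left_comm]
      gcongr
    exact le_of_mul_le_mul_left h2 hK0
  refine le_trans ?_ hmain
  rw [Finset.sum_range_succ']
  simp only [Nat.cast_zero, zero_mul, ne_eq, OfNat.ofNat_ne_zero, not_false_eq_true, zero_pow, add_zero]
  refine le_trans (Finset.sum_le_sum fun j hj => ?_) (Finset.sum_le_sum_of_subset_of_nonneg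
    (Finset.range_subset_range.2 (show n ≤ K by omega)) (fun _ _ _ => by positivity))
  rw [hcoeff j (by have := Finset.mem_range.1 hj; omega)]

/-- A Halász-type mean value theorem for power series `exp (∑ c_k z^k / k)`: if no twist of `c`
pretends to be `1`, the coefficients tend to zero. -/
theorem tendsto_zero_of_recursion {a c : ℕ → ℂ} (ha0 : a 0 = 1) (hc : ∀ k, ‖c k‖ ≤ 1)
    (hrec : ∀ n, ((n + 1 : ℕ) : ℂ) * a (n + 1) = ∑ k ∈ Finset.range (n + 1), c (k + 1) * a (n - k))
    (hdiv : ∀ ω : ℂ, ‖ω‖ = 1 → ∀ B : ℝ, ∃ N : ℕ,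
      B < ∑ k ∈ Finset.range N, (1 - (c (k + 1) * ω ^ (k + 1)).re) / (k + 1)) :
    Tendsto a atTop (𝓝 0) := by
  have ha := norm_le_one_of_recursion ha0 hc hrec
  rw [tendsto_zero_iff_norm_tendsto_zero]
  rw [Metric.tendsto_atTop]
  intro ε hε
  set δ : ℝ := min 1 (ε / 100) with hδ
  have hδ0 : 0 < δ := by positivity
  have hδ1 : δ ≤ 1 := min_le_left _ _
  have hδε : 100 * δ ≤ ε := by have := min_le_right 1 (ε / 100); linarith
  obtain ⟨r0, hr01, hr0⟩ := eventually_norm_tsum_small ha0 hc hrec hdiv (pow_pos hδ0 2)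
  obtain ⟨N, hN⟩ := exists_nat_gt (max (max 2 (1 / (1 - r0))) (1 / δ ^ 2))
  refine ⟨N, fun n hn => ?_⟩
  have hn' : (N : ℝ) ≤ n := by exact_mod_cast hn
  have hn2 : (2 : ℝ) < n := lt_of_lt_of_le (lt_of_le_of_lt ((le_max_left _ _).trans (le_max_left _ _)) hN) hn'
  have hnr : 1 / (1 - r0) < (n : ℝ) :=
    lt_of_lt_of_le (lt_of_le_of_lt ((le_max_right _ _).trans (le_max_left _ _)) hN) hn'
  have hnδ : 1 / δ ^ 2 < (n : ℝ) := lt_of_lt_of_le (lt_of_le_of_lt (le_max_right _ _) hN) hn'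
  have hnpos : (0 : ℝ) < n := by linarith
  have hδn : 1 < δ ^ 2 * n := by
    rwa [div_lt_iff₀ (by positivity), mul_comm] at hnδ
  set x : ℝ := 1 / (2 * n) with hx
  have hx0 : 0 < x := by positivity
  have hx4 : x < 1 / 4 := by
    rw [hx, div_lt_div_iff₀ (by positivity) (by norm_num)]; linarith
  have hxn : x * n = 1 / 2 := by rw [hx]; field_simp
  set r : ℝ := 1 - x with hr
  have hr0r : r0 ≤ r := by
    rw [div_lt_iff₀ (by linarith)] at hnr
    have : x ≤ 1 - r0 := by
      rw [hx, div_le_iff₀ (by positivity)]; nlinarith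
    linarith
  have h1r : 1 - r = 1 / (2 * n) := by rw [hr]; ring
  have hsup : ∀ ω : ℂ, ‖ω‖ = 1 → ‖∑' k, a k * (r * ω) ^ k‖ ≤ δ ^ 2 * (2 * n) := by
    intro ω hω
    have := hr0 r hr0r (by linarith) (by linarith) ω hω
    rw [h1r, mul_one_div, div_le_iff₀ (by positivity)] at this
    exact this
  have hkey := sum_sq_mul_norm_sq_le ha hc hrec (by linarith) (by linarith) hsup n
  rw [h1r, one_div, inv_inv] at hkey
  have hrpow : ∀ j ≤ n, (1 / 2 : ℝ) ≤ r ^ j := by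
    intro j hj
    refine le_trans ?_ (pow_le_pow_of_le_one (by linarith) (by linarith) hj)
    have hb := one_add_mul_le_pow (a := -x) (by linarith) n
    have : r = 1 + -x := by rw [hr]; ring
    rw [this]
    linarith
  have hsq : ∑ j ∈ Finset.range n, ((j : ℝ) * ‖a j‖) ^ 2 ≤ 72 * δ ^ 4 * n ^ 3 := by
    have h1 : ∑ j ∈ Finset.range n, ((j : ℝ) * ‖a j‖) ^ 2 ≤
        4 * ∑ j ∈ Finset.range (n + 1), ((j : ℝ) * ‖a j‖ * r ^ j) ^ 2 := by
      rw [Finset.mul_sum]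
      refine le_trans (Finset.sum_le_sum fun j hj => ?_) (Finset.sum_le_sum_of_subset_of_nonneg
        (Finset.range_subset_range.2 (Nat.le_succ n)) (fun _ _ _ => by positivity))
      rw [mul_pow _ (r ^ j)]
      have := hrpow j (Finset.mem_range.1 hj).le
      have h4 : 1 ≤ 4 * (r ^ j) ^ 2 := by nlinarith
      nlinarith [sq_nonneg ((j : ℝ) * ‖a j‖)]
    refine h1.trans ?_
    have h2 : (δ ^ 2 * (2 * n) + 1) ^ 2 ≤ (3 * (δ ^ 2 * n)) ^ 2 := by
      gcongr; linarith
    calc _ ≤ 4 * ((δ ^ 2 * (2 * n) + 1) ^ 2 * (2 * n)) := by gcongr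
      _ ≤ 4 * ((3 * (δ ^ 2 * n)) ^ 2 * (2 * n)) := by gcongr
      _ = _ := by ring
  have hpt : ∀ j : ℕ, ‖a j‖ ≤ δ + ((j : ℝ) * ‖a j‖) ^ 2 / (δ ^ 3 * n ^ 2) +
      if (j : ℝ) ≤ δ * n then 1 else 0 := by
    intro j
    have hp : 0 ≤ ((j : ℝ) * ‖a j‖) ^ 2 / (δ ^ 3 * n ^ 2) := by positivity
    split_ifs with h
    · have := ha j; linarith
    · push Not at h
      have h1 : (δ * n * ‖a j‖) ^ 2 ≤ ((j : ℝ) * ‖a j‖) ^ 2 := by gcongr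
      have h2 : ‖a j‖ ^ 2 / δ ≤ ((j : ℝ) * ‖a j‖) ^ 2 / (δ ^ 3 * n ^ 2) := by
        rw [div_le_div_iff₀ hδ0 (by positivity)]
        calc ‖a j‖ ^ 2 * (δ ^ 3 * n ^ 2) = (δ * n * ‖a j‖) ^ 2 * δ := by ring
          _ ≤ _ := by gcongr
      have h3 : ‖a j‖ ≤ δ + ‖a j‖ ^ 2 / δ := by
        rw [← sub_le_iff_le_add', le_div_iff₀ hδ0]
        nlinarith [sq_nonneg (‖a j‖ - δ), norm_nonneg (a j)]
      linarith
  have hcount : ∑ j ∈ Finset.range n, (if (j : ℝ) ≤ δ * n then (1 : ℝ) else 0) ≤ δ * n + 1 := by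
    rw [Finset.sum_boole]
    have hsub : (Finset.range n).filter (fun j : ℕ => (j : ℝ) ≤ δ * n) ⊆
        Finset.range (⌊δ * n⌋₊ + 1) := by
      intro j hj
      rw [Finset.mem_range, Nat.lt_succ_iff]
      exact Nat.le_floor (Finset.mem_filter.1 hj).2
    have := Finset.card_le_card hsub
    rw [Finset.card_range] at this
    calc (((Finset.range n).filter (fun j : ℕ => (j : ℝ) ≤ δ * n)).card : ℝ)
        ≤ ((⌊δ * n⌋₊ + 1 : ℕ) : ℝ) := by exact_mod_cast this
      _ ≤ δ * n + 1 := by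
        push_cast
        gcongr
        exact Nat.floor_le (by positivity)
  have htot : (n : ℝ) * ‖a n‖ ≤ n * δ + 72 * δ ^ 4 * n ^ 3 / (δ ^ 3 * n ^ 2) + (δ * n + 1) := by
    refine (mul_norm_le_sum_of_recursion hc hrec n).trans ?_
    refine (Finset.sum_le_sum fun j _ => hpt j).trans ?_
    rw [Finset.sum_add_distrib, Finset.sum_add_distrib, ← Finset.sum_div]
    simp only [Finset.sum_const, Finset.card_range, nsmul_eq_mul]
    gcongr
  have h72 : 72 * δ ^ 4 * n ^ 3 / (δ ^ 3 * n ^ 2) = 72 * δ * n := by field_simp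
  rw [h72] at htot
  have hd2 : δ ^ 2 ≤ δ := by nlinarith
  have : ‖a n‖ ≤ 75 * δ := by
    refine le_of_mul_le_mul_left ?_ hnpos
    nlinarith
  rw [Real.dist_eq, sub_zero, abs_of_nonneg (norm_nonneg _)]
  linarith

end Halasz

section Counting
open scoped Classical

variable {F : Type*} [Field F] [Fintype F]

lemma coeff_polyOf {n : ℕ} (c : Fin n → F) (i : ℕ) :
    (polyOf c).coeff i = if h : i < n then c ⟨i, h⟩ else 0 := by
  rw [polyOf, finsetSum_coeff]
  simp only [coeff_C_mul, coeff_X_pow]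
  split_ifs with h
  · rw [Finset.sum_eq_single ⟨i, h⟩]
    · simp
    · intro b _ hb
      have : i ≠ (b : ℕ) := fun hh => hb (Fin.ext hh.symm)
      simp [this]
    · simp
  · refine Finset.sum_eq_zero fun b _ => ?_
    have : i ≠ (b : ℕ) := by have := b.2; omega
    simp [this]

lemma polyOf_injective {n : ℕ} : Function.Injective (polyOf : (Fin n → F) → F[X]) := by
  intro c c' h
  ext i
  have := congrArg (fun g : F[X] => g.coeff i) h
  simpa [coeff_polyOf] using this

variable (F) in
/-- The finite set of polynomials of degree less than `n`. -/
noncomputable def polysLT (n : ℕ) : Finset F[X] := Finset.univ.image (polyOf : (Fin n → F) → F[X])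

variable (F) in
/-- The finite set of monic polynomials of degree `n`. -/
noncomputable def monics (n : ℕ) : Finset F[X] := (polysLT F n).image (X ^ n + ·)

variable (F) in
/-- The finite set of monic irreducible polynomials of degree `d`. -/
noncomputable def irreds (d : ℕ) : Finset F[X] := (monics F d).filter Irreducible

lemma mem_polysLT {n : ℕ} {g : F[X]} : g ∈ polysLT F n ↔ g.degree < n := by
  rw [polysLT, Finset.mem_image]
  constructor
  · rintro ⟨c, -, rfl⟩
    rw [degree_lt_iff_coeff_zero]
    intro i hi
    rw [coeff_polyOf, dif_neg (by omega)]
  · intro h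
    refine ⟨fun i => g.coeff i, Finset.mem_univ _, ?_⟩
    ext i
    rw [coeff_polyOf]
    split_ifs with hi
    · rfl
    · exact ((degree_lt_iff_coeff_zero _ _).1 h i (by omega)).symm

lemma card_polysLT (n : ℕ) : (polysLT F n).card = Fintype.card F ^ n := by
  rw [polysLT, Finset.card_image_of_injective _ polyOf_injective, Finset.card_univ]
  simp

lemma sum_polyOf {M : Type*} [AddCommMonoid M] (n : ℕ) (f : F[X] → M) :
    ∑ c : Fin n → F, f (polyOf c) = ∑ g ∈ polysLT F n, f g := by
  rw [polysLT, Finset.sum_image polyOf_injective.injOn]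

lemma mem_monics {n : ℕ} {g : F[X]} : g ∈ monics F n ↔ g.Monic ∧ g.natDegree = n := by
  rw [monics, Finset.mem_image]
  constructor
  · rintro ⟨r, hr, rfl⟩
    rw [mem_polysLT] at hr
    refine ⟨monic_X_pow_add hr, natDegree_eq_of_degree_eq_some ?_⟩
    rw [degree_add_eq_left_of_degree_lt (by rwa [degree_X_pow]), degree_X_pow]
  · rintro ⟨hm, hd⟩
    refine ⟨g - X ^ n, ?_, by ring⟩
    rw [mem_polysLT]
    have : g.degree = n := by rw [degree_eq_natDegree hm.ne_zero, hd]
    rw [← this]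
    refine degree_sub_lt_left (by rw [this, degree_X_pow]) hm.ne_zero ?_
    rw [hm.leadingCoeff, (monic_X_pow n).leadingCoeff]

lemma card_monics (n : ℕ) : (monics F n).card = Fintype.card F ^ n := by
  rw [monics, Finset.card_image_of_injective _ (add_right_injective _), card_polysLT]

lemma mem_irreds {d : ℕ} {P : F[X]} :
    P ∈ irreds F d ↔ P.Monic ∧ Irreducible P ∧ P.natDegree = d := by
  rw [irreds, Finset.mem_filter, mem_monics]; tauto

lemma irreds_zero : irreds F 0 = ∅ := by
  ext P
  simp only [mem_irreds, Finset.notMem_empty, iff_false, not_and]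
  intro _ h h0
  exact h.natDegree_pos.ne' h0

lemma sum_polysLT_dvd {M : Type*} [AddCommMonoid M] {P : F[X]} (hP : P ≠ 0) {n : ℕ}
    (hn : P.natDegree ≤ n) (f : F[X] → M) :
    ∑ g ∈ (polysLT F n).filter (P ∣ ·), f g = ∑ h ∈ polysLT F (n - P.natDegree), f (P * h) := by
  symm
  have hdeg : ∀ h : F[X], (P * h).degree < n ↔ h.degree < (n - P.natDegree : ℕ) := by
    intro h
    rcases eq_or_ne h 0 with rfl | hh
    · simp only [mul_zero, degree_zero]
      exact ⟨fun _ => WithBot.bot_lt_coe _, fun _ => WithBot.bot_lt_coe _⟩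
    rw [degree_eq_natDegree (mul_ne_zero hP hh), degree_eq_natDegree hh, natDegree_mul hP hh,
      Nat.cast_lt, Nat.cast_lt]
    omega
  refine Finset.sum_bij (fun h _ => P * h) ?_ ?_ ?_ ?_
  · intro h hh
    rw [Finset.mem_filter, mem_polysLT, hdeg]
    exact ⟨mem_polysLT.1 hh, dvd_mul_right _ _⟩
  · intro h _ h' _ heq
    exact mul_left_cancel₀ hP heq
  · intro g hg
    rw [Finset.mem_filter, mem_polysLT] at hg
    obtain ⟨hg, h, rfl⟩ := hg
    exact ⟨h, mem_polysLT.2 ((hdeg h).1 hg), rfl⟩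
  · intro _ _; rfl

lemma sum_monics_dvd {M : Type*} [AddCommMonoid M] {P : F[X]} (hP : P.Monic) {n : ℕ}
    (hn : P.natDegree ≤ n) (f : F[X] → M) :
    ∑ g ∈ (monics F n).filter (P ∣ ·), f g = ∑ h ∈ monics F (n - P.natDegree), f (P * h) := by
  symm
  refine Finset.sum_bij (fun h _ => P * h) ?_ ?_ ?_ ?_
  · intro h hh
    rw [mem_monics] at hh
    rw [Finset.mem_filter, mem_monics]
    refine ⟨⟨hP.mul hh.1, ?_⟩, dvd_mul_right _ _⟩
    rw [hP.natDegree_mul hh.1, hh.2]; omega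
  · intro h _ h' _ heq
    exact mul_left_cancel₀ hP.ne_zero heq
  · intro g hg
    rw [Finset.mem_filter, mem_monics] at hg
    obtain ⟨⟨hg, hd⟩, h, rfl⟩ := hg
    have hh := hP.of_mul_monic_left hg
    refine ⟨h, mem_monics.2 ⟨hh, ?_⟩, rfl⟩
    rw [hP.natDegree_mul hh] at hd; omega
  · intro _ _; rfl

lemma filter_monics_dvd_of_lt {P : F[X]} {n : ℕ} (hn : n < P.natDegree) :
    (monics F n).filter (P ∣ ·) = ∅ := by
  refine Finset.filter_eq_empty_iff.2 fun g hg hdvd => ?_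
  have := mem_monics.1 hg
  have h2 := natDegree_le_of_dvd hdvd this.1.ne_zero
  omega

lemma sum_polysLT_succ {M : Type*} [AddCommMonoid M] (n : ℕ) (f : F[X] → M) :
    ∑ g ∈ polysLT F (n + 1), f g =
      ∑ g ∈ polysLT F n, f g + ∑ u : Fˣ, ∑ h ∈ monics F n, f (C (u : F) * h) := by
  have hsub : polysLT F n ⊆ polysLT F (n + 1) := fun g hg => by
    rw [mem_polysLT] at hg ⊢
    exact hg.trans (by exact_mod_cast Nat.lt_succ_self n)
  rw [← Finset.sum_sdiff hsub, add_comm]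
  congr 1
  rw [← Finset.sum_product']
  symm
  refine Finset.sum_bij (fun x _ => C (x.1 : F) * x.2) ?_ ?_ ?_ ?_
  · rintro ⟨u, h⟩ hx
    simp only [Finset.mem_product, Finset.mem_univ, true_and] at hx
    obtain ⟨h1, h2⟩ := mem_monics.1 hx
    have hd : (C (u : F) * h).degree = n := by
      rw [degree_C_mul u.ne_zero, degree_eq_natDegree h1.ne_zero, h2]
    rw [Finset.mem_sdiff, mem_polysLT, mem_polysLT, hd]
    exact ⟨by exact_mod_cast Nat.lt_succ_self n, lt_irrefl _⟩
  · rintro ⟨u, h⟩ hx ⟨u', h'⟩ hx' heq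
    simp only [Finset.mem_product, Finset.mem_univ, true_and] at hx hx'
    have h1 := (mem_monics.1 hx).1
    have h1' := (mem_monics.1 hx').1
    have hl := congrArg leadingCoeff heq
    simp only [leadingCoeff_mul, leadingCoeff_C, h1.leadingCoeff, h1'.leadingCoeff, mul_one] at hl
    have hu : u = u' := Units.ext hl
    subst hu
    have := mul_left_cancel₀ (C_ne_zero.2 u.ne_zero) heq
    exact Prod.ext rfl this
  · intro g hg
    rw [Finset.mem_sdiff, mem_polysLT, mem_polysLT] at hg
    have hg0 : g ≠ 0 := by
      rintro rfl
      exact hg.2 (by simp)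
    have hd : g.natDegree = n := by
      rw [degree_eq_natDegree hg0, Nat.cast_lt, Nat.cast_lt] at hg
      omega
    refine ⟨(Units.mk0 _ (leadingCoeff_ne_zero.2 hg0), C (g.leadingCoeff)⁻¹ * g), ?_, ?_⟩
    · simp only [Finset.mem_product, Finset.mem_univ, true_and, mem_monics]
      refine ⟨?_, ?_⟩
      · rw [Monic, leadingCoeff_mul, leadingCoeff_C, inv_mul_cancel₀ (leadingCoeff_ne_zero.2 hg0)]
      · rw [natDegree_C_mul (inv_ne_zero (leadingCoeff_ne_zero.2 hg0)), hd]
    · simp only [Units.val_mk0]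
      rw [← mul_assoc, ← C_mul, mul_inv_cancel₀ (leadingCoeff_ne_zero.2 hg0), C_1, one_mul]
  · intro _ _; rfl

lemma polysLT_zero : polysLT F 0 = {0} := by
  ext g
  rw [mem_polysLT, Finset.mem_singleton]
  constructor
  · intro h
    rw [← degree_eq_bot]
    by_contra hb
    rw [degree_eq_natDegree (fun h0 => hb (by rw [h0, degree_zero]))] at h
    simp at h
  · rintro rfl
    simp

lemma sum_divisors_mul_card_irreds_le (k : ℕ) (hk : 0 < k) :
    ∑ d ∈ k.divisors, d * (irreds F d).card ≤ Fintype.card F ^ k := by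
  have hq := Fintype.one_lt_card (α := F)
  set s : Finset F[X] := k.divisors.biUnion (irreds F) with hs
  have hdisj : ∀ d ∈ k.divisors, ∀ d' ∈ k.divisors, d ≠ d' → Disjoint (irreds F d) (irreds F d') := by
    intro d _ d' _ hne
    rw [Finset.disjoint_left]
    intro P hP hP'
    exact hne ((mem_irreds.1 hP).2.2.symm.trans (mem_irreds.1 hP').2.2)
  have hdvd : ∏ P ∈ s, P ∣ (X ^ (Fintype.card F ^ k) - X : F[X]) := by
    refine Finset.prod_dvd_of_coprime ?_ ?_
    · intro P hP P' hP' hne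
      simp only [hs, Finset.coe_biUnion, Set.mem_iUnion, Finset.mem_coe] at hP hP'
      obtain ⟨d, -, hP⟩ := hP
      obtain ⟨d', -, hP'⟩ := hP'
      rw [mem_irreds] at hP hP'
      rw [Function.onFun, (hP.2.1).coprime_iff_not_dvd]
      intro hdv
      refine hne (eq_of_monic_of_associated hP.1 hP'.1 ?_)
      exact (hP.2.1).associated_of_dvd hP'.2.1 hdv
    · intro P hP
      rw [hs, Finset.mem_biUnion] at hP
      obtain ⟨d, hd, hP⟩ := hP
      rw [mem_irreds] at hP
      have hdk : P.natDegree ∣ k := by rw [hP.2.2]; exact Nat.dvd_of_mem_divisors hd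
      have : Fact (Irreducible P) := ⟨hP.2.1⟩
      have : Module.Finite F (AdjoinRoot P) := (AdjoinRoot.powerBasis hP.1.ne_zero).finite
      have : Finite (AdjoinRoot P) := Module.finite_of_finite F
      have := Fintype.ofFinite (AdjoinRoot P)
      have hcard : Fintype.card (AdjoinRoot P) = Fintype.card F ^ P.natDegree := by
        rw [Module.card_eq_pow_finrank (K := F), (AdjoinRoot.powerBasis hP.1.ne_zero).finrank]
        simp
      obtain ⟨e, he⟩ := hdk
      have hfix : (AdjoinRoot.root P) ^ (Fintype.card F ^ k) = AdjoinRoot.root P := by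
        rw [he, pow_mul, ← hcard]
        exact FiniteField.pow_card_pow e _
      rw [← AdjoinRoot.mk_eq_zero, map_sub, map_pow, AdjoinRoot.mk_X, hfix, sub_self]
  have hne : (X ^ (Fintype.card F ^ k) - X : F[X]) ≠ 0 :=
    FiniteField.X_pow_card_sub_X_ne_zero F (Nat.one_lt_pow hk.ne' hq)
  have hle := natDegree_le_of_dvd hdvd hne
  rw [FiniteField.X_pow_card_sub_X_natDegree_eq F (Nat.one_lt_pow hk.ne' hq),
    natDegree_prod_of_monic, hs, Finset.sum_biUnion hdisj] at hle
  · refine le_trans (le_of_eq (Finset.sum_congr rfl fun d _ => ?_)) hle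
    rw [Finset.sum_congr rfl (fun P hP => (mem_irreds.1 hP).2.2), Finset.sum_const, smul_eq_mul,
      mul_comm]
  · intro P hP
    rw [hs, Finset.mem_biUnion] at hP
    obtain ⟨d, hd, hP⟩ := hP
    exact (mem_irreds.1 hP).1

lemma card_irreds_le (d : ℕ) : (irreds F d).card ≤ Fintype.card F ^ d := by
  rw [irreds, ← card_monics]
  exact Finset.card_filter_le _ _

end Counting

section Squarefree
open scoped Classical
open Topology

variable {F : Type*} [Field F] [Fintype F]

lemma natDegree_eq_sum_irreds_dvd {g : F[X]} (hg : g.Monic) (hsq : Squarefree g) {n : ℕ}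
    (hn : g.natDegree = n) :
    ∑ d ∈ Finset.range (n + 1), ∑ P ∈ irreds F d, (if P ∣ g then d else 0) = n := by
  have hg0 := hg.ne_zero
  set s := UniqueFactorizationMonoid.normalizedFactors g with hs
  have hnd : s.Nodup := (UniqueFactorizationMonoid.squarefree_iff_nodup_normalizedFactors hg0).1 hsq
  have hmonic : ∀ P ∈ s, P.Monic := by
    intro P hP
    have h1 := UniqueFactorizationMonoid.normalize_normalized_factor P hP
    have h0 := (UniqueFactorizationMonoid.irreducible_of_normalized_factor P hP).ne_zero
    rw [← h1]; exact monic_normalize h0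
  have hprod : s.prod = g := by
    have hm := monic_multiset_prod_of_monic s id hmonic
    rw [Multiset.map_id] at hm
    exact eq_of_monic_of_associated hm hg (UniqueFactorizationMonoid.prod_normalizedFactors hg0)
  have hdeg : n = ∑ P ∈ s.toFinset, P.natDegree := by
    rw [← hn, ← hprod, natDegree_multiset_prod_of_monic _ hmonic, Finset.sum,
      Multiset.toFinset_val, hnd.dedup]
  have hset : s.toFinset = (Finset.range (n + 1)).biUnion
      (fun d => (irreds F d).filter (· ∣ g)) := by
    ext P
    simp only [Multiset.mem_toFinset, Finset.mem_biUnion, Finset.mem_filter, Finset.mem_range]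
    constructor
    · intro hP
      have hdvd := UniqueFactorizationMonoid.dvd_of_mem_normalizedFactors hP
      refine ⟨P.natDegree, ?_, mem_irreds.2 ⟨hmonic P hP,
        UniqueFactorizationMonoid.irreducible_of_normalized_factor P hP, rfl⟩, hdvd⟩
      have := natDegree_le_of_dvd hdvd hg0
      omega
    · rintro ⟨d, -, hP, hdvd⟩
      rw [mem_irreds] at hP
      obtain ⟨Q, hQ, hass⟩ :=
        UniqueFactorizationMonoid.exists_mem_normalizedFactors_of_dvd hg0 hP.2.1 hdvd
      rwa [eq_of_monic_of_associated hP.1 (hmonic Q hQ) hass]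
  conv_rhs => rw [hdeg, hset]
  rw [Finset.sum_biUnion]
  · refine Finset.sum_congr rfl fun d _ => ?_
    rw [← Finset.sum_filter]
    refine Finset.sum_congr rfl fun P hP => ?_
    rw [(mem_irreds.1 (Finset.mem_filter.1 hP).1).2.2]
  · intro d _ d' _ hne
    rw [Function.onFun, Finset.disjoint_left]
    intro P hP hP'
    exact hne ((mem_irreds.1 (Finset.mem_filter.1 hP).1).2.2.symm.trans
      (mem_irreds.1 (Finset.mem_filter.1 hP').1).2.2)

/-- Coefficients of the power series `w z^d / (1 + w z^d)`. -/
noncomputable def logDerivCoeff (w : ℂ) (d k : ℕ) : ℂ :=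
  if k = 0 then 0 else if d ∣ k then -(-w) ^ (k / d) else 0

lemma logDerivCoeff_self (w : ℂ) {d : ℕ} (hd : 0 < d) : logDerivCoeff w d d = w := by
  simp [logDerivCoeff, hd.ne', Nat.div_self hd]

lemma norm_logDerivCoeff_le {w : ℂ} (hw : ‖w‖ ≤ 1) (d k : ℕ) : ‖logDerivCoeff w d k‖ ≤ 1 := by
  unfold logDerivCoeff
  split_ifs
  · simp
  · rw [norm_neg, norm_pow, norm_neg]; exact pow_le_one₀ (norm_nonneg _) hw
  · simp

lemma logDerivCoeff_of_lt (w : ℂ) {d k : ℕ} (hk : k < d) : logDerivCoeff w d k = 0 := by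
  unfold logDerivCoeff
  split_ifs with h h'
  · rfl
  · exact absurd (Nat.le_of_dvd (Nat.pos_of_ne_zero h) h') (by omega)
  · rfl

lemma logDerivCoeff_add (w : ℂ) {d : ℕ} (hd : 0 < d) (i : ℕ) :
    logDerivCoeff w d (d + i) = -w * logDerivCoeff w d i + if i = 0 then w else 0 := by
  rcases Nat.eq_zero_or_pos i with rfl | hi
  · rw [add_zero, logDerivCoeff_self w hd]; simp [logDerivCoeff]
  · unfold logDerivCoeff
    rw [if_neg (by omega), if_neg hi.ne', if_neg hi.ne', Nat.add_div_left _ hd]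
    by_cases h : d ∣ i
    · rw [if_pos ((Nat.dvd_add_right dvd_rfl).2 h), if_pos h, pow_succ]; ring
    · rw [if_neg (fun h' => h ((Nat.dvd_add_right dvd_rfl).1 h')), if_neg h]; ring

variable {f w : F[X] → ℂ}

lemma sum_monics_dvd_eq (hf : ∀ P h : F[X], P.Monic → Irreducible P → h.Monic →
      f (P * h) = if P ∣ h then 0 else w P * f h)
    {P : F[X]} (hP : P.Monic) (hPi : Irreducible P) (n : ℕ) :
    ∑ g ∈ (monics F n).filter (P ∣ ·), f g =
      ∑ k ∈ Finset.range (n + 1), logDerivCoeff (w P) P.natDegree k * ∑ g ∈ monics F (n - k), f g := by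
  have hd := hPi.natDegree_pos
  induction n using Nat.strong_induction_on with
  | _ n ih =>
    rcases lt_or_ge n P.natDegree with hlt | hge
    · rw [filter_monics_dvd_of_lt hlt, Finset.sum_empty]
      refine (Finset.sum_eq_zero fun k hk => ?_).symm
      rw [logDerivCoeff_of_lt _ (by have := Finset.mem_range.1 hk; omega), zero_mul]
    · obtain ⟨l, rfl⟩ := Nat.exists_eq_add_of_le hge
      rw [sum_monics_dvd hP hge, Nat.add_sub_cancel_left]
      have h1 : ∑ h ∈ monics F l, f (P * h) =
          w P * (∑ h ∈ monics F l, f h - ∑ h ∈ (monics F l).filter (P ∣ ·), f h) := by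
        rw [Finset.sum_filter, ← Finset.sum_sub_distrib, Finset.mul_sum]
        refine Finset.sum_congr rfl fun h hh => ?_
        rw [hf P h hP hPi (mem_monics.1 hh).1]
        split_ifs <;> ring
      rw [h1, ih l (by omega), add_assoc P.natDegree l 1,
        Finset.sum_range_add _ P.natDegree]
      rw [Finset.sum_eq_zero (s := Finset.range P.natDegree) (fun k hk => by
        rw [logDerivCoeff_of_lt _ (Finset.mem_range.1 hk), zero_mul]), zero_add]
      simp_rw [logDerivCoeff_add _ hd, Nat.add_sub_add_left, add_mul]
      rw [Finset.sum_add_distrib]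
      simp only [ite_mul, zero_mul]
      rw [Finset.sum_ite_eq' , if_pos (by simp), mul_sub, Nat.sub_zero]
      simp_rw [mul_assoc, neg_mul]
      rw [Finset.sum_neg_distrib, ← Finset.mul_sum]
      ring

lemma eq_zero_of_not_squarefree (hf : ∀ P h : F[X], P.Monic → Irreducible P → h.Monic →
      f (P * h) = if P ∣ h then 0 else w P * f h) {g : F[X]} (hg : g.Monic)
    (hsq : ¬ Squarefree g) : f g = 0 := by
  have : ∃ P : F[X], Irreducible P ∧ P * P ∣ g := by
    by_contra hcon
    push Not at hcon
    exact hsq ((squarefree_iff_irreducible_sq_not_dvd_of_ne_zero hg.ne_zero).2 hcon)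
  obtain ⟨P, hP, hdvd⟩ := this
  have hass := normalize_associated P
  have hPm : (normalize P).Monic := monic_normalize hP.ne_zero
  have hPi : Irreducible (normalize P) := hass.symm.irreducible hP
  obtain ⟨k, hk⟩ := ((hass.mul_mul hass).dvd).trans hdvd
  rw [mul_assoc] at hk
  rw [hk, hf _ _ hPm hPi (hPm.of_mul_monic_left (hk ▸ hg)), if_pos (dvd_mul_right _ _)]

lemma natCast_mul_sum_monics (hf : ∀ P h : F[X], P.Monic → Irreducible P → h.Monic →
      f (P * h) = if P ∣ h then 0 else w P * f h) (n : ℕ) :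
    (n : ℂ) * ∑ g ∈ monics F n, f g =
      ∑ k ∈ Finset.range n, (∑ d ∈ (k + 1).divisors, ∑ P ∈ irreds F d,
        (d : ℂ) * logDerivCoeff (w P) d (k + 1)) * ∑ g ∈ monics F (n - (k + 1)), f g := by
  have h1 : (n : ℂ) * ∑ g ∈ monics F n, f g = ∑ d ∈ Finset.range (n + 1), ∑ P ∈ irreds F d,
      (d : ℂ) * ∑ g ∈ (monics F n).filter (P ∣ ·), f g := by
    rw [Finset.mul_sum]
    have : ∀ g ∈ monics F n, (n : ℂ) * f g = ∑ d ∈ Finset.range (n + 1), ∑ P ∈ irreds F d,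
        (d : ℂ) * if P ∣ g then f g else 0 := by
      intro g hg
      rw [mem_monics] at hg
      by_cases hsq : Squarefree g
      · have h := congrArg (fun x : ℕ => (x : ℂ) * f g) (natDegree_eq_sum_irreds_dvd hg.1 hsq hg.2)
        rw [← h]
        push_cast
        rw [Finset.sum_mul]
        refine Finset.sum_congr rfl fun d _ => ?_
        rw [Finset.sum_mul]
        refine Finset.sum_congr rfl fun P _ => ?_
        split_ifs <;> ring
      · simp [eq_zero_of_not_squarefree hf hg.1 hsq]
    rw [Finset.sum_congr rfl this, Finset.sum_comm]
    refine Finset.sum_congr rfl fun d _ => ?_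
    rw [Finset.sum_comm]
    refine Finset.sum_congr rfl fun P _ => ?_
    rw [← Finset.mul_sum, Finset.sum_filter]
  rw [h1]
  have h2 : ∀ d ∈ Finset.range (n + 1), ∀ P ∈ irreds F d,
      (d : ℂ) * ∑ g ∈ (monics F n).filter (P ∣ ·), f g =
      ∑ k ∈ Finset.range n, (d : ℂ) * logDerivCoeff (w P) d (k + 1) *
        ∑ g ∈ monics F (n - (k + 1)), f g := by
    intro d _ P hP
    rw [mem_irreds] at hP
    rw [sum_monics_dvd_eq hf hP.1 hP.2.1, Finset.sum_range_succ', hP.2.2]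
    have h0 : logDerivCoeff (w P) d 0 = 0 := if_pos rfl
    rw [h0, zero_mul, add_zero, Finset.mul_sum]
    simp_rw [mul_assoc]
  rw [Finset.sum_congr rfl fun d hd => Finset.sum_congr rfl (h2 d hd)]
  simp_rw [Finset.sum_mul]
  rw [Finset.sum_congr rfl fun d hd => Finset.sum_comm, Finset.sum_comm]
  refine Finset.sum_congr rfl fun k hk => ?_
  symm
  refine Finset.sum_subset ?_ ?_
  · intro d hd
    have := Nat.divisor_le hd
    have := Finset.mem_range.1 hk
    rw [Finset.mem_range]; omega
  · intro d _ hd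
    refine Finset.sum_eq_zero fun P hP => ?_
    have : ¬ d ∣ k + 1 := fun h => hd (Nat.mem_divisors.2 ⟨h, by omega⟩)
    simp [logDerivCoeff, this]

/-- Mean values over monic polynomials of multiplicative functions supported on squarefree
polynomials vanish when the function does not pretend to be any `g ↦ ω ^ deg g`. -/
theorem tendsto_sum_monics_of_squarefree (hf : ∀ P h : F[X], P.Monic → Irreducible P → h.Monic →
      f (P * h) = if P ∣ h then 0 else w P * f h)
    (hf1 : f 1 = 1) (hw : ∀ P, ‖w P‖ ≤ 1)
    (hdiv : ∀ ω : ℂ, ‖ω‖ = 1 → ∀ B : ℝ, ∃ N : ℕ, B < ∑ k ∈ Finset.range N,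
      ((Fintype.card F : ℝ) ^ (k + 1))⁻¹ * ∑ P ∈ irreds F (k + 1), (1 - (w P * ω ^ (k + 1)).re)) :
    Tendsto (fun n : ℕ => (∑ g ∈ monics F n, f g) / (Fintype.card F : ℂ) ^ n) atTop (𝓝 0) := by
  set q : ℝ := (Fintype.card F : ℝ) with hq
  have hqc : (Fintype.card F : ℂ) = (q : ℂ) := by simp [hq]
  have hq0 : 0 < q := by simp [hq, Fintype.card_pos]
  have hq0' : (q : ℂ) ≠ 0 := by exact_mod_cast hq0.ne'
  rw [hqc]
  set Cc : ℕ → ℂ := fun k => ∑ d ∈ k.divisors, ∑ P ∈ irreds F d, (d : ℂ) * logDerivCoeff (w P) d k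
    with hCc
  have hcount : ∀ k, 0 < k → ∑ d ∈ k.divisors, ∑ P ∈ irreds F d, (d : ℝ) ≤ q ^ k := by
    intro k hk
    have h := sum_divisors_mul_card_irreds_le (F := F) k hk
    have h' : ((∑ d ∈ k.divisors, d * (irreds F d).card : ℕ) : ℝ) ≤ ((Fintype.card F ^ k : ℕ) : ℝ) :=
      by exact_mod_cast h
    push_cast at h'
    refine le_trans (le_of_eq (Finset.sum_congr rfl fun d _ => ?_)) h'
    rw [Finset.sum_const, nsmul_eq_mul, mul_comm]
  refine tendsto_zero_of_recursion (c := fun k => Cc k / (q : ℂ) ^ k) ?_ ?_ ?_ ?_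
  · have : monics F 0 = {1} := by
      ext g
      rw [mem_monics, Finset.mem_singleton]
      exact ⟨fun h => h.1.natDegree_eq_zero.1 h.2, fun h => by simp [h]⟩
    simp [this, hf1]
  · intro k
    rcases Nat.eq_zero_or_pos k with rfl | hk
    · simp [hCc]
    rw [norm_div, norm_pow, Complex.norm_real, Real.norm_of_nonneg hq0.le, div_le_one (by positivity)]
    refine le_trans ?_ (hcount k hk)
    refine (norm_sum_le _ _).trans (Finset.sum_le_sum fun d _ => ?_)
    refine (norm_sum_le _ _).trans (Finset.sum_le_sum fun P _ => ?_)
    rw [norm_mul, Complex.norm_natCast]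
    exact mul_le_of_le_one_right (by positivity) (norm_logDerivCoeff_le (hw P) _ _)
  · intro n
    rw [mul_div_assoc', natCast_mul_sum_monics hf, Finset.sum_div]
    refine Finset.sum_congr rfl fun k hk => ?_
    have hk := Finset.mem_range.1 hk
    rw [Nat.add_sub_add_right, div_mul_div_comm, ← pow_add]
    have : k + 1 + (n - k) = n + 1 := by omega
    rw [this]
  · intro ω hω B
    obtain ⟨N, hN⟩ := hdiv ω hω B
    refine ⟨N, hN.trans_le (Finset.sum_le_sum fun k _ => ?_)⟩
    have hre : ∀ (z : ℂ), ‖z‖ ≤ 1 → 0 ≤ 1 - (z * ω ^ (k + 1)).re := by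
      intro z hz
      have := Complex.re_le_norm (z * ω ^ (k + 1))
      rw [norm_mul, norm_pow, hω, one_pow, mul_one] at this
      linarith
    have hpos : (0 : ℝ) < k + 1 := by positivity
    rw [le_div_iff₀ hpos]
    have e1 : (Cc (k + 1) / (q : ℂ) ^ (k + 1) * ω ^ (k + 1)).re =
        (q ^ (k + 1))⁻¹ * ∑ d ∈ (k + 1).divisors, ∑ P ∈ irreds F d,
          (d : ℝ) * (logDerivCoeff (w P) d (k + 1) * ω ^ (k + 1)).re := by
      have : Cc (k + 1) / (q : ℂ) ^ (k + 1) * ω ^ (k + 1) = (((q ^ (k + 1))⁻¹ : ℝ) : ℂ) *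
          ∑ d ∈ (k + 1).divisors, ∑ P ∈ irreds F d,
          ((d : ℝ) : ℂ) * (logDerivCoeff (w P) d (k + 1) * ω ^ (k + 1)) := by
        simp only [hCc]
        push_cast
        rw [div_mul_eq_mul_div, div_eq_inv_mul, Finset.sum_mul]
        congr 1
        refine Finset.sum_congr rfl fun d _ => ?_
        rw [Finset.sum_mul]
        refine Finset.sum_congr rfl fun P _ => ?_
        ring
      rw [this, Complex.re_ofReal_mul, Complex.re_sum]
      congr 1
      refine Finset.sum_congr rfl fun d _ => ?_
      rw [Complex.re_sum]
      refine Finset.sum_congr rfl fun P _ => ?_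
      rw [Complex.re_ofReal_mul]
    have e2 : ∑ P ∈ irreds F (k + 1), ((k : ℝ) + 1) * (1 - (w P * ω ^ (k + 1)).re) ≤
        ∑ d ∈ (k + 1).divisors, ∑ P ∈ irreds F d,
          (d : ℝ) * (1 - (logDerivCoeff (w P) d (k + 1) * ω ^ (k + 1)).re) := by
      have hmem : k + 1 ∈ (k + 1).divisors := Nat.mem_divisors_self _ (by omega)
      refine le_trans (le_of_eq ?_) (Finset.single_le_sum (f := fun d => ∑ P ∈ irreds F d,
          (d : ℝ) * (1 - (logDerivCoeff (w P) d (k + 1) * ω ^ (k + 1)).re))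
          (fun d _ => Finset.sum_nonneg fun P _ => mul_nonneg (by positivity)
            (hre _ (norm_logDerivCoeff_le (hw P) _ _))) hmem)
      refine Finset.sum_congr rfl fun P _ => ?_
      rw [logDerivCoeff_self _ (by omega)]
      push_cast
      ring
    have e3 : ∑ d ∈ (k + 1).divisors, ∑ P ∈ irreds F d,
          (d : ℝ) * (1 - (logDerivCoeff (w P) d (k + 1) * ω ^ (k + 1)).re) ≤
        q ^ (k + 1) - ∑ d ∈ (k + 1).divisors, ∑ P ∈ irreds F d,
          (d : ℝ) * (logDerivCoeff (w P) d (k + 1) * ω ^ (k + 1)).re := by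
      simp_rw [mul_sub, Finset.sum_sub_distrib, mul_one]
      linarith [hcount (k + 1) (by omega)]
    simp only [e1]
    have hqk : 0 < q ^ (k + 1) := by positivity
    calc (q ^ (k + 1))⁻¹ * (∑ P ∈ irreds F (k + 1), (1 - (w P * ω ^ (k + 1)).re)) * (k + 1)
        = (q ^ (k + 1))⁻¹ * ∑ P ∈ irreds F (k + 1), ((k : ℝ) + 1) * (1 - (w P * ω ^ (k + 1)).re) := by
          rw [← Finset.mul_sum]; ring
      _ ≤ (q ^ (k + 1))⁻¹ * (q ^ (k + 1) - ∑ d ∈ (k + 1).divisors, ∑ P ∈ irreds F d,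
          (d : ℝ) * (logDerivCoeff (w P) d (k + 1) * ω ^ (k + 1)).re) := by
          gcongr
          exact e2.trans e3
      _ = _ := by rw [mul_sub, inv_mul_cancel₀ hqk.ne']

end Squarefree

section Periodic
open scoped Classical
open Topology

lemma tendsto_sum_geometric_shift {d : ℕ} {r : ℝ} (hr0 : 0 ≤ r) (hr1 : r < 1) {C : ℝ}
    {a : ℕ → ℕ → ℂ} (hC : ∀ j n, ‖a j n‖ ≤ C) (ha : ∀ j, Tendsto (a j) atTop (𝓝 0)) :
    Tendsto (fun N : ℕ => ∑ j ∈ Finset.range (N + 1),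
      if j * d ≤ N then (r : ℂ) ^ j * a j (N - j * d) else 0) atTop (𝓝 0) := by
  have hC0 : 0 ≤ C := (norm_nonneg _).trans (hC 0 0)
  have key := tendsto_tsum_of_dominated_convergence (𝓕 := atTop)
    (f := fun N j => if j ∈ Finset.range (N + 1) then
      (if j * d ≤ N then (r : ℂ) ^ j * a j (N - j * d) else 0) else 0)
    (g := fun _ : ℕ => (0 : ℂ)) (bound := fun j => r ^ j * C)
    ((summable_geometric_of_lt_one hr0 hr1).mul_right C) ?_ ?_
  · simp only [tsum_zero] at key
    refine key.congr fun N => ?_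
    rw [tsum_eq_sum (s := Finset.range (N + 1)) (fun j hj => if_neg hj)]
    exact Finset.sum_congr rfl fun j hj => if_pos hj
  · intro j
    have h1 : Tendsto (fun N => (r : ℂ) ^ j * a j (N - j * d)) atTop (𝓝 ((r : ℂ) ^ j * 0)) :=
      ((ha j).comp (tendsto_sub_atTop_nat _)).const_mul _
    rw [mul_zero] at h1
    refine h1.congr' ?_
    filter_upwards [eventually_ge_atTop (j * d), eventually_ge_atTop j] with N h1 h2
    rw [if_pos (Finset.mem_range.2 (by omega)), if_pos h1]
  · refine Eventually.of_forall fun N j => ?_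
    have : 0 ≤ r ^ j * C := by positivity
    split_ifs
    · rw [norm_mul, norm_pow, Complex.norm_real, Real.norm_of_nonneg hr0]
      gcongr
      exact hC _ _
    · simpa using this
    · simpa using this

variable {F : Type*} [Field F] [Fintype F]

lemma sum_monics_eq_sum_pow {P : F[X]} (hP : P.Monic) (hd : 0 < P.natDegree) (N : ℕ)
    (G : F[X] → ℂ) :
    ∑ g ∈ monics F N, G g = ∑ j ∈ Finset.range (N + 1), if j * P.natDegree ≤ N then
      ∑ h ∈ (monics F (N - j * P.natDegree)).filter (¬ P ∣ ·), G (P ^ j * h) else 0 := by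
  induction N using Nat.strong_induction_on generalizing G with
  | _ N ih =>
    rw [← Finset.sum_filter_add_sum_filter_not (monics F N) (P ∣ ·), Finset.sum_range_succ']
    simp only [zero_mul, Nat.zero_le, if_true, Nat.sub_zero, pow_zero, one_mul]
    congr 1
    rcases lt_or_ge N P.natDegree with hlt | hge
    · rw [filter_monics_dvd_of_lt hlt, Finset.sum_empty]
      refine (Finset.sum_eq_zero fun k _ => if_neg ?_).symm
      rw [add_mul]; omega
    · rw [sum_monics_dvd hP hge, ih _ (by omega) (fun h => G (P * h))]
      refine Finset.sum_subset_zero_on_sdiff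
        (Finset.range_subset_range.2 (by omega)) ?_ ?_ 
      · intro k hk
        rw [Finset.mem_sdiff, Finset.mem_range, Finset.mem_range] at hk
        refine if_neg ?_
        have : k ≤ k * P.natDegree := Nat.le_mul_of_pos_right _ hd
        rw [add_mul]; omega
      · intro k _
        have e : N - P.natDegree - k * P.natDegree = N - (k + 1) * P.natDegree := by
          rw [add_mul]; omega
        have e2 : k * P.natDegree ≤ N - P.natDegree ↔ (k + 1) * P.natDegree ≤ N := by
          rw [add_mul]; omega
        simp only [e, e2, pow_succ', mul_assoc]

/-- The irreducible factors of `g` outside `S` are simple and have degree greater than `K`. -/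
def RoughOutside (K : ℕ) (S : Finset F[X]) (g : F[X]) : Prop :=
  ∀ P : F[X], P.Monic → Irreducible P → P ∣ g → P ∈ S ∨ (K < P.natDegree ∧ ¬ P ^ 2 ∣ g)

lemma isCoprime_of_irreducible_ne {P Q : F[X]} (hP : P.Monic) (hPi : Irreducible P) (hQ : Q.Monic)
    (hQi : Irreducible Q) (hne : P ≠ Q) : IsCoprime P Q := by
  rw [hPi.coprime_iff_not_dvd]
  exact fun h => hne (eq_of_monic_of_associated hP hQ (hPi.associated_of_dvd hQi h))

lemma RoughOutside.not_dvd {K : ℕ} {S : Finset F[X]} {Q h : F[X]} (hQ : Q.Monic)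
    (hQi : Irreducible Q) (hK : Q.natDegree ≤ K) (hS : Q ∉ S) (hh : RoughOutside K S h) :
    ¬ Q ∣ h := by
  intro hdvd
  rcases hh Q hQ hQi hdvd with h1 | h1
  · exact hS h1
  · omega

lemma roughOutside_insert {K : ℕ} {S : Finset F[X]} {Q h : F[X]} (hQ : Q.Monic)
    (hQi : Irreducible Q) (hQh : ¬ Q ∣ h) (j : ℕ) :
    RoughOutside K (insert Q S) (Q ^ j * h) ↔ RoughOutside K S h := by
  constructor
  · intro H P hP hPi hdvd
    rcases H P hP hPi (hdvd.mul_left _) with h1 | h1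
    · rcases Finset.mem_insert.1 h1 with h2 | h2
      · exact absurd (h2 ▸ hdvd) hQh
      · exact Or.inl h2
    · exact Or.inr ⟨h1.1, fun h2 => h1.2 (h2.mul_left _)⟩
  · intro H P hP hPi hdvd
    by_cases hPQ : P = Q
    · exact Or.inl (by simp [hPQ])
    have hco := isCoprime_of_irreducible_ne hP hPi hQ hQi hPQ
    rcases H P hP hPi ((hco.pow_right).dvd_of_dvd_mul_left hdvd) with h1 | h1
    · exact Or.inl (Finset.mem_insert_of_mem h1)
    · exact Or.inr ⟨h1.1, fun h2 => h1.2 ((hco.pow).dvd_of_dvd_mul_left h2)⟩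

lemma roughOutside_empty_mul {K : ℕ} {Q h : F[X]} (hQ : Q.Monic) (hQi : Irreducible Q) :
    RoughOutside K ∅ (Q * h) ↔ ¬ Q ∣ h ∧ K < Q.natDegree ∧ RoughOutside K ∅ h := by
  constructor
  · intro H
    have h1 := (H Q hQ hQi (dvd_mul_right _ _)).resolve_left (by simp)
    refine ⟨fun hd => h1.2 ?_, h1.1, fun P hP hPi hdvd => ?_⟩
    · rw [pow_two]; exact mul_dvd_mul_left _ hd
    · have h2 := (H P hP hPi (hdvd.mul_left _)).resolve_left (by simp)
      exact Or.inr ⟨h2.1, fun h3 => h2.2 (h3.mul_left _)⟩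
  · rintro ⟨hQh, hK, H⟩ P hP hPi hdvd
    by_cases hPQ : P = Q
    · subst hPQ
      refine Or.inr ⟨hK, fun h2 => hQh ?_⟩
      rw [pow_two] at h2
      exact (mul_dvd_mul_iff_left hP.ne_zero).1 h2
    have hco := isCoprime_of_irreducible_ne hP hPi hQ hQi hPQ
    have h1 := (H P hP hPi (hco.dvd_of_dvd_mul_left hdvd)).resolve_left (by simp)
    exact Or.inr ⟨h1.1, fun h2 => h1.2 (hco.pow_left.dvd_of_dvd_mul_left h2)⟩

lemma RoughOutside.isCoprime {K : ℕ} {s g : F[X]} (hs : s ≠ 0) (hK : s.natDegree ≤ K)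
    (hg : RoughOutside K ∅ g) : IsCoprime g s := by
  rcases eq_or_ne g 0 with rfl | hg0
  · exfalso
    have hX := hg X monic_X irreducible_X (dvd_zero _)
    simp at hX
  by_contra hco
  have hgcd : ¬ IsUnit (EuclideanDomain.gcd g s) := by
    rwa [EuclideanDomain.gcd_isUnit_iff]
  obtain ⟨P, hP, hdvd⟩ := WfDvdMonoid.exists_irreducible_factor hgcd
    (fun h => hs (EuclideanDomain.gcd_eq_zero_iff.1 h).2)
  have hass := normalize_associated P
  have hPm : (normalize P).Monic := monic_normalize hP.ne_zero
  have hPi : Irreducible (normalize P) := hass.symm.irreducible hP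
  have hdvd' := hass.dvd.trans hdvd
  have h1 := (hg _ hPm hPi (hdvd'.trans (EuclideanDomain.gcd_dvd_left _ _))).resolve_left (by simp)
  have h2 := natDegree_le_of_dvd (hdvd'.trans (EuclideanDomain.gcd_dvd_right _ _)) hs
  omega

end Periodic

section Pretentious
open scoped Classical
open Topology

variable {F : Type*} [Field F] [Fintype F]

lemma pretDist_eq_sqrt (f g : F[X] → ℂ) (N : ℕ) :
    pretDist f g N = Real.sqrt (∑ k ∈ Finset.range N, ((Fintype.card F : ℝ) ^ (k + 1))⁻¹ *
      ∑ P ∈ irreds F (k + 1), (1 - (f P * (starRingEnd ℂ) (g P)).re)) := by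
  rw [pretDist]
  congr 1
  have hset : {P : F[X] | P.Monic ∧ Irreducible P ∧ P.natDegree ≤ N} =
      ((Finset.range N).biUnion (fun k => irreds F (k + 1)) : Finset F[X]) := by
    ext P
    simp only [Set.mem_ofPred_eq, Finset.coe_biUnion, Set.mem_iUnion, Finset.mem_coe, mem_irreds,
      Finset.mem_range]
    constructor
    · rintro ⟨h1, h2, h3⟩
      have := h2.natDegree_pos
      exact ⟨P.natDegree - 1, by omega, h1, h2, by omega⟩
    · rintro ⟨k, hk, h1, h2, h3⟩
      exact ⟨h1, h2, by omega⟩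
  change ∑' P : {P : F[X] | P.Monic ∧ Irreducible P ∧ P.natDegree ≤ N},
    (Fintype.card F : ℝ) ^ (-(P.1.natDegree : ℤ)) * (1 - (f P.1 * (starRingEnd ℂ) (g P.1)).re) = _
  rw [hset, Finset.tsum_subtype' _ (fun P : F[X] => (Fintype.card F : ℝ) ^ (-(P.natDegree : ℤ)) *
    (1 - (f P * (starRingEnd ℂ) (g P)).re)), Finset.sum_biUnion]
  · refine Finset.sum_congr rfl fun k _ => ?_
    rw [Finset.mul_sum]
    refine Finset.sum_congr rfl fun P hP => ?_
    rw [(mem_irreds.1 hP).2.2, zpow_neg, zpow_natCast]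
  · intro k _ k' _ hne
    rw [Function.onFun, Finset.disjoint_left]
    intro P hP hP'
    have := (mem_irreds.1 hP).2.2.symm.trans (mem_irreds.1 hP').2.2
    omega

lemma isShortIntervalChar_one : IsShortIntervalChar (fun _ : F[X] => (1 : ℂ)) :=
  ⟨fun _ _ _ => by simp, ⟨1, by simp⟩, 0, fun _ _ _ _ _ => rfl⟩

lemma IsDirichletChar.conj {χ : F[X] → ℂ} (h : IsDirichletChar χ) :
    IsDirichletChar (fun g => (starRingEnd ℂ) (χ g)) := by
  obtain ⟨h1, s, hs, h2, h3⟩ := h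
  refine ⟨fun g h => by simp only [h1, map_mul], s, hs,
    fun g h hd => by simp only [h2 g h hd], fun g => ?_⟩
  rw [← h3 g, ne_eq, map_eq_zero]

lemma exists_theta {ω : ℂ} (hω : ‖ω‖ = 1) : ∃ θ ∈ Set.Ico (0 : ℝ) 1, ∀ g : F[X],
    (starRingEnd ℂ) (eTheta θ g) = ω ^ g.natDegree := by
  set x : ℝ := -(Complex.arg ω) / (2 * Real.pi) with hx
  refine ⟨Int.fract x, ⟨Int.fract_nonneg _, Int.fract_lt_one _⟩, fun g => ?_⟩
  have hω' : ω = Complex.exp (Complex.arg ω * Complex.I) := by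
    have := Complex.norm_mul_exp_arg_mul_I ω
    rw [hω, Complex.ofReal_one, one_mul] at this
    exact this.symm
  rw [eTheta, ← Complex.exp_conj]
  have hpi : (Real.pi : ℂ) ≠ 0 := by exact_mod_cast Real.pi_ne_zero
  have hfr : ((Int.fract x : ℝ) : ℂ) = -(Complex.arg ω) / (2 * Real.pi) - (⌊x⌋ : ℤ) := by
    rw [Int.fract]; push_cast; rw [hx]; push_cast; ring
  have hpow : ω ^ g.natDegree = Complex.exp (g.natDegree * (Complex.arg ω * Complex.I)) := by
    rw [Complex.exp_nat_mul, ← hω']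
  rw [hpow, Complex.exp_eq_exp_iff_exists_int]
  refine ⟨⌊x⌋ * g.natDegree, ?_⟩
  simp only [map_mul, Complex.conj_ofReal, Complex.conj_I, map_natCast, map_ofNat]
  rw [hfr]
  push_cast
  field_simp
  ring

lemma exists_lt_sum_of_pretDist {ν : F[X] → ℂ}
    (hpret : ∀ χ ξ : Polynomial F → ℂ, ∀ θ : ℝ,
      IsDirichletChar χ → IsShortIntervalChar ξ → θ ∈ Set.Ico (0 : ℝ) 1 →
      Tendsto (fun N : ℕ => pretDist ν (fun g => χ g * ξ g * eTheta θ g) N) atTop atTop)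
    {χ : F[X] → ℂ} (hχ : IsDirichletChar χ) {ω : ℂ} (hω : ‖ω‖ = 1) (B : ℝ) :
    ∃ N : ℕ, B < ∑ k ∈ Finset.range N, ((Fintype.card F : ℝ) ^ (k + 1))⁻¹ *
      ∑ P ∈ irreds F (k + 1), (1 - (ν P * χ P * ω ^ (k + 1)).re) := by
  obtain ⟨θ, hθ, hθω⟩ := exists_theta (F := F) hω
  have hT := hpret _ _ θ hχ.conj isShortIntervalChar_one hθ
  obtain ⟨N, hN⟩ := (hT.eventually (eventually_gt_atTop (max 1 B))).exists
  refine ⟨N, ?_⟩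
  rw [pretDist_eq_sqrt] at hN
  have h1 : (1 : ℝ) < _ := (le_max_left _ _).trans_lt hN
  have h2 : B < _ := (le_max_right _ _).trans_lt hN
  set S := ∑ k ∈ Finset.range N, ((Fintype.card F : ℝ) ^ (k + 1))⁻¹ *
      ∑ P ∈ irreds F (k + 1), (1 - (ν P * χ P * ω ^ (k + 1)).re) with hS
  have hSeq : S = ∑ k ∈ Finset.range N, ((Fintype.card F : ℝ) ^ (k + 1))⁻¹ *
      ∑ P ∈ irreds F (k + 1), (1 - (ν P * (starRingEnd ℂ)
        ((starRingEnd ℂ) (χ P) * 1 * eTheta θ P)).re) := by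
    refine Finset.sum_congr rfl fun k _ => ?_
    congr 1
    refine Finset.sum_congr rfl fun P hP => ?_
    rw [map_mul, map_mul, hθω, (mem_irreds.1 hP).2.2, map_one, mul_one, Complex.conj_conj, mul_assoc]
  rw [← hSeq] at h1 h2
  have hS0 : 0 ≤ S := by
    by_contra hneg
    rw [Real.sqrt_eq_zero_of_nonpos (not_le.1 hneg).le] at h1
    linarith
  have : Real.sqrt S ≤ S := by
    have hsq := Real.sq_sqrt hS0
    nlinarith
  linarith

lemma sum_inv_pow_card_irreds_le (K N : ℕ) :
    ∑ k ∈ Finset.range N, ((Fintype.card F : ℝ) ^ (k + 1))⁻¹ *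
      ∑ _P ∈ irreds F (k + 1), (if K < k + 1 then (0 : ℝ) else 1) ≤ K := by
  have hq : (0 : ℝ) < Fintype.card F := by exact_mod_cast Fintype.card_pos
  have : ∀ k ∈ Finset.range N, ((Fintype.card F : ℝ) ^ (k + 1))⁻¹ *
      ∑ _P ∈ irreds F (k + 1), (if K < k + 1 then (0 : ℝ) else 1) ≤ if k < K then 1 else 0 := by
    intro k _
    by_cases h : k < K
    · rw [if_pos h, if_neg (by omega), Finset.sum_const, nsmul_eq_mul, mul_one, inv_mul_le_iff₀ (by positivity), mul_one]
      exact_mod_cast card_irreds_le (F := F) (k + 1)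
    · rw [if_neg h, if_pos (by omega)]; simp
  refine (Finset.sum_le_sum this).trans ?_
  rw [Finset.sum_boole]
  have hsub : (Finset.range N).filter (· < K) ⊆ Finset.range K := fun k hk =>
    Finset.mem_range.2 (Finset.mem_filter.1 hk).2
  have := Finset.card_le_card hsub
  rw [Finset.card_range] at this
  exact_mod_cast this

variable {ν : F[X] → ℂ}

theorem tendsto_sum_monics_rough (hν : IsMultFn ν) (hνb : ∀ g, ‖ν g‖ ≤ 1) (hν1 : ν 1 = 1)
    (hpret : ∀ χ ξ : Polynomial F → ℂ, ∀ θ : ℝ,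
      IsDirichletChar χ → IsShortIntervalChar ξ → θ ∈ Set.Ico (0 : ℝ) 1 →
      Tendsto (fun N : ℕ => pretDist ν (fun g => χ g * ξ g * eTheta θ g) N) atTop atTop)
    {χ : F[X] → ℂ} (hχ : IsDirichletChar χ) (hχ1 : ∀ g, ‖χ g‖ ≤ 1) (K : ℕ) :
    Tendsto (fun n : ℕ => (∑ g ∈ monics F n, if RoughOutside K ∅ g then ν g * χ g else 0) /
      (Fintype.card F : ℂ) ^ n) atTop (𝓝 0) := by
  have hχone : χ 1 = 1 := by
    obtain ⟨h1, s, hs, h2, h3⟩ := hχ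
    have hne := (h3 1).2 isCoprime_one_left
    have := h1 1 1
    rw [mul_one] at this
    exact mul_left_cancel₀ hne (by rw [← this, mul_one])
  refine tendsto_sum_monics_of_squarefree
    (w := fun P => if K < P.natDegree then ν P * χ P else 0) ?_ ?_ ?_ ?_
  · intro P h hP hPi hh
    simp only [roughOutside_empty_mul hP hPi]
    by_cases hdvd : P ∣ h
    · simp [hdvd]
    · by_cases hK : K < P.natDegree
      · by_cases hR : RoughOutside K ∅ h
        · simp only [hdvd, hK, hR, not_false_eq_true, and_self, if_true, if_false]
          rw [hν P h (hPi.coprime_iff_not_dvd.2 hdvd), hχ.1]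
          ring
        · simp [hR]
      · simp [hK]
  · have : RoughOutside K ∅ (1 : F[X]) := fun P hP hPi hdvd =>
      absurd (isUnit_of_dvd_one hdvd) hPi.not_isUnit
    simp only [this, if_true, hν1, hχone, mul_one]
  · intro P
    split_ifs
    · rw [norm_mul]; exact mul_le_one₀ (hνb _) (norm_nonneg _) (hχ1 _)
    · simp
  · intro ω hω B
    obtain ⟨N, hN⟩ := exists_lt_sum_of_pretDist hpret hχ hω (B + K)
    refine ⟨N, ?_⟩
    have hle := sum_inv_pow_card_irreds_le (F := F) K N
    have hcmp : ∑ k ∈ Finset.range N, ((Fintype.card F : ℝ) ^ (k + 1))⁻¹ *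
        ∑ P ∈ irreds F (k + 1), (1 - (ν P * χ P * ω ^ (k + 1)).re) ≤
        ∑ k ∈ Finset.range N, ((Fintype.card F : ℝ) ^ (k + 1))⁻¹ *
          ∑ P ∈ irreds F (k + 1), (1 - ((if K < P.natDegree then ν P * χ P else 0) * ω ^ (k + 1)).re) +
        ∑ k ∈ Finset.range N, ((Fintype.card F : ℝ) ^ (k + 1))⁻¹ *
          ∑ _P ∈ irreds F (k + 1), (if K < k + 1 then (0 : ℝ) else 1) := by
      rw [← Finset.sum_add_distrib]
      refine Finset.sum_le_sum fun k _ => ?_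
      rw [← mul_add, ← Finset.sum_add_distrib]
      gcongr with P hP
      rw [(mem_irreds.1 hP).2.2]
      split_ifs with h
      · simp
      · have h1 := Complex.abs_re_le_norm (ν P * χ P * ω ^ (k + 1))
        rw [norm_mul, norm_mul, norm_pow, hω, one_pow, mul_one] at h1
        have h2 : ‖ν P‖ * ‖χ P‖ ≤ 1 := mul_le_one₀ (hνb _) (norm_nonneg _) (hχ1 _)
        have h3 := (abs_le.1 (h1.trans h2)).1
        simp only [zero_mul, Complex.zero_re]
        linarith
    linarith

end Pretentious

section PeriodicMean
open scoped Classical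
open Topology
universe u

variable {F : Type u} [Field F] [Fintype F]

lemma isUnit_mk_iff_isCoprime {s g : F[X]} : IsUnit (AdjoinRoot.mk s g) ↔ IsCoprime g s := by
  constructor
  · intro h
    obtain ⟨b, hb⟩ := h.exists_right_inv
    obtain ⟨a, rfl⟩ := AdjoinRoot.mk_surjective b
    rw [← map_mul, ← sub_eq_zero, ← map_one (AdjoinRoot.mk s), ← map_sub, AdjoinRoot.mk_eq_zero] at hb
    obtain ⟨c, hc⟩ := hb
    exact ⟨a, -c, by linear_combination hc⟩
  · rintro ⟨a, b, hab⟩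
    refine IsUnit.of_mul_eq_one (AdjoinRoot.mk s a) ?_
    have := congrArg (AdjoinRoot.mk s) hab
    rw [map_add, map_mul, map_mul, AdjoinRoot.mk_self, mul_zero, add_zero, map_one] at this
    rw [mul_comm]; exact this

/-- The extension by zero to `F[X]` of a character of the units modulo `s`. -/
noncomputable def charOfUnits (s : F[X]) (ψ : AddChar (Additive (AdjoinRoot s)ˣ) ℂ) (g : F[X]) : ℂ :=
  if h : IsUnit (AdjoinRoot.mk s g) then ψ (Additive.ofMul h.unit) else 0

lemma isDirichletChar_charOfUnits {s : F[X]} (hs : s ≠ 0)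
    (ψ : AddChar (Additive (AdjoinRoot s)ˣ) ℂ) : IsDirichletChar (charOfUnits s ψ) := by
  refine ⟨fun g h => ?_, s, hs, fun g h hd => ?_, fun g => ?_⟩
  · unfold charOfUnits
    by_cases hg : IsUnit (AdjoinRoot.mk s g)
    · by_cases hh : IsUnit (AdjoinRoot.mk s h)
      · have hgh : IsUnit (AdjoinRoot.mk s (g * h)) := by rw [map_mul]; exact hg.mul hh
        rw [dif_pos hg, dif_pos hh, dif_pos hgh, ← AddChar.map_add_eq_mul, ← ofMul_mul]
        congr 2
        ext
        simp
      · have hgh : ¬ IsUnit (AdjoinRoot.mk s (g * h)) := by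
          rw [map_mul, IsUnit.mul_iff]; tauto
        rw [dif_neg hh, dif_neg hgh, mul_zero]
    · have hgh : ¬ IsUnit (AdjoinRoot.mk s (g * h)) := by
        rw [map_mul, IsUnit.mul_iff]; tauto
      rw [dif_neg hg, dif_neg hgh, zero_mul]
  · have : AdjoinRoot.mk s g = AdjoinRoot.mk s h := by
      rw [← sub_eq_zero, ← map_sub, AdjoinRoot.mk_eq_zero]; exact hd
    unfold charOfUnits
    simp only [this]
  · rw [← isUnit_mk_iff_isCoprime]
    unfold charOfUnits
    split_ifs with h
    · have h0 : ψ (Additive.ofMul h.unit) ≠ 0 := fun h0 => by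
        have h2 := AddChar.map_add_eq_mul ψ (Additive.ofMul h.unit) (-Additive.ofMul h.unit)
        rw [add_neg_cancel, AddChar.map_zero_eq_one, h0, zero_mul] at h2
        exact one_ne_zero h2
      exact iff_of_true h0 h
    · simp [h]

lemma finite_adjoinRoot {s : F[X]} (hs : s ≠ 0) : Finite (AdjoinRoot s) := by
  have : Module.Finite F (AdjoinRoot s) := (AdjoinRoot.powerBasis hs).finite
  exact Module.finite_of_finite F

lemma exists_char_expansion {s : F[X]} (hs : s ≠ 0) {φ : F[X] → ℂ}
    (hφ : ∀ g h, s ∣ g - h → φ g = φ h) :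
    ∃ (ι : Type u) (_ : Fintype ι) (c : ι → ℂ) (χ : ι → F[X] → ℂ),
      (∀ i, IsDirichletChar (χ i)) ∧ (∀ i g, ‖χ i g‖ ≤ 1) ∧
      ∀ g, IsCoprime g s → φ g = ∑ i, c i * χ i g := by
  have := finite_adjoinRoot hs
  have : Finite (Additive (AdjoinRoot s)ˣ) := inferInstanceAs (Finite (AdjoinRoot s)ˣ)
  have := Fintype.ofFinite (AddChar (Additive (AdjoinRoot s)ˣ) ℂ)
  set φ' : Additive (AdjoinRoot s)ˣ → ℂ := fun u =>
    φ (AdjoinRoot.mk_surjective (u.toMul : AdjoinRoot s)).choose with hφ'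
  refine ⟨AddChar (Additive (AdjoinRoot s)ˣ) ℂ, inferInstance,
    fun ψ => (AddChar.complexBasis _).repr φ' ψ, fun ψ => charOfUnits s ψ,
    fun ψ => isDirichletChar_charOfUnits hs ψ, fun ψ g => ?_, fun g hg => ?_⟩
  · simp only [charOfUnits]
    split_ifs
    · rw [AddChar.norm_apply]
    · simp
  · have hu := isUnit_mk_iff_isCoprime.2 hg
    have h1 := congrFun ((AddChar.complexBasis (Additive (AdjoinRoot s)ˣ)).sum_repr φ')
      (Additive.ofMul hu.unit)
    rw [Finset.sum_apply] at h1
    have h2 : φ' (Additive.ofMul hu.unit) = φ g := by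
      refine hφ _ _ ?_
      have := (AdjoinRoot.mk_surjective ((Additive.ofMul hu.unit).toMul : AdjoinRoot s)).choose_spec
      rw [← AdjoinRoot.mk_eq_zero, map_sub, this]
      simp
    rw [← h2, ← h1]
    refine Finset.sum_congr rfl fun ψ _ => ?_
    have h3 : charOfUnits s ψ g = ψ (Additive.ofMul hu.unit) := dif_pos hu
    simp only [h3, Pi.smul_apply, smul_eq_mul, AddChar.complexBasis_apply]

variable {ν : F[X] → ℂ}

lemma tendsto_sum_monics_roughOutside (hν : IsMultFn ν) (hνb : ∀ g, ‖ν g‖ ≤ 1) (hν1 : ν 1 = 1)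
    (hpret : ∀ χ ξ : Polynomial F → ℂ, ∀ θ : ℝ,
      IsDirichletChar χ → IsShortIntervalChar ξ → θ ∈ Set.Ico (0 : ℝ) 1 →
      Tendsto (fun N : ℕ => pretDist ν (fun g => χ g * ξ g * eTheta θ g) N) atTop atTop)
    {s : F[X]} (hs : s ≠ 0) {K : ℕ} (hK : s.natDegree ≤ K) (S : Finset F[X])
    (hS : ∀ Q ∈ S, Q.Monic ∧ Irreducible Q ∧ Q.natDegree ≤ K) (φ : F[X] → ℂ)
    (hφb : ∃ C, ∀ g, ‖φ g‖ ≤ C) (hφ : ∀ g h, s ∣ g - h → φ g = φ h) :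
    Tendsto (fun n : ℕ => (∑ g ∈ monics F n, if RoughOutside K S g then ν g * φ g else 0) /
      (Fintype.card F : ℂ) ^ n) atTop (𝓝 0) := by
  have hq : (1 : ℝ) < Fintype.card F := by exact_mod_cast Fintype.one_lt_card (α := F)
  have hqc : (Fintype.card F : ℂ) ≠ 0 := by exact_mod_cast Fintype.card_ne_zero
  induction S using Finset.induction_on generalizing φ with
  | empty =>
    obtain ⟨ι, _, c, χ, h1, h2, h3⟩ := exists_char_expansion hs hφ
    have hsum := tendsto_finsetSum (Finset.univ : Finset ι) fun i _ =>
      (tendsto_sum_monics_rough hν hνb hν1 hpret (h1 i) (h2 i) K).const_mul (c i)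
    simp only [mul_zero, Finset.sum_const_zero] at hsum
    refine hsum.congr fun n => ?_
    simp_rw [mul_div_assoc']
    rw [← Finset.sum_div]
    congr 1
    simp_rw [Finset.mul_sum]
    rw [Finset.sum_comm]
    refine Finset.sum_congr rfl fun g _ => ?_
    split_ifs with hR
    · rw [h3 g (hR.isCoprime hs hK), Finset.mul_sum]
      exact Finset.sum_congr rfl fun i _ => by ring
    · simp
  | insert Q S hQS ih =>
    obtain ⟨C, hC⟩ := hφb
    obtain ⟨hQ, hQi, hQK⟩ := hS Q (Finset.mem_insert_self _ _)
    have hS' : ∀ Q ∈ S, Q.Monic ∧ Irreducible Q ∧ Q.natDegree ≤ K :=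
      fun P hP => hS P (Finset.mem_insert_of_mem hP)
    have hd := hQi.natDegree_pos
    set d := Q.natDegree with hdd
    set r : ℝ := ((Fintype.card F : ℝ) ^ d)⁻¹ with hr
    have hr0 : 0 ≤ r := by positivity
    have hr1 : r < 1 := inv_lt_one_of_one_lt₀ (one_lt_pow₀ hq hd.ne')
    set a : ℕ → ℕ → ℂ := fun j n => ν (Q ^ j) *
      ((∑ h ∈ monics F n, if RoughOutside K S h then ν h * φ (Q ^ j * h) else 0) /
        (Fintype.card F : ℂ) ^ n) with ha
    have hat : ∀ j, Tendsto (a j) atTop (𝓝 0) := by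
      intro j
      have := (ih hS' (fun h => φ (Q ^ j * h)) ⟨C, fun g => hC _⟩
        (fun g h hgh => hφ _ _ (by rw [← mul_sub]; exact hgh.mul_left _))).const_mul (ν (Q ^ j))
      rwa [mul_zero] at this
    have hab : ∀ j n, ‖a j n‖ ≤ C := by
      intro j n
      have hC0 : 0 ≤ C := (norm_nonneg _).trans (hC 0)
      rw [ha, norm_mul, norm_div, norm_pow, Complex.norm_natCast]
      refine (mul_le_of_le_one_left (by positivity) (hνb _)).trans ?_
      rw [div_le_iff₀ (by positivity)]
      refine (norm_sum_le _ _).trans ?_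
      refine (Finset.sum_le_card_nsmul _ _ C fun h _ => ?_).trans ?_
      · split_ifs
        · rw [norm_mul]
          exact (mul_le_of_le_one_left (norm_nonneg _) (hνb _)).trans (hC _)
        · simpa using hC0
      · rw [card_monics, nsmul_eq_mul, mul_comm]
        push_cast
        rfl
    refine (tendsto_sum_geometric_shift (d := d) hr0 hr1 hab hat).congr fun N => ?_
    rw [sum_monics_eq_sum_pow hQ hd, Finset.sum_div]
    refine Finset.sum_congr rfl fun j _ => ?_
    rw [← hdd]
    split_ifs with hjd
    · have hsum : ∑ h ∈ (monics F (N - j * d)).filter (¬ Q ∣ ·),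
          (if RoughOutside K (insert Q S) (Q ^ j * h) then ν (Q ^ j * h) * φ (Q ^ j * h) else 0) =
          ν (Q ^ j) * ∑ h ∈ monics F (N - j * d),
            if RoughOutside K S h then ν h * φ (Q ^ j * h) else 0 := by
        rw [Finset.sum_filter, Finset.mul_sum]
        refine Finset.sum_congr rfl fun h _ => ?_
        by_cases hQh : Q ∣ h
        · rw [if_neg (not_not.2 hQh), if_neg (fun hR => hR.not_dvd hQ hQi hQK hQS hQh), mul_zero]
        · rw [if_pos hQh]
          simp only [roughOutside_insert hQ hQi hQh]
          split_ifs
          · rw [hν _ _ ((hQi.coprime_iff_not_dvd.2 hQh).pow_left)]; ring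
          · simp
      rw [hsum, ha]
      have hpow : (Fintype.card F : ℂ) ^ N = ((Fintype.card F : ℂ) ^ d) ^ j *
          (Fintype.card F : ℂ) ^ (N - j * d) := by
        rw [← pow_mul, ← pow_add]; congr 1; rw [mul_comm d j]; omega
      rw [hpow, hr]
      push_cast
      rw [inv_pow]
      field_simp
    · simp

end PeriodicMean

section PeriodicTotal
open scoped Classical
open Topology

variable {F : Type*} [Field F] [Fintype F]

/-- The monic irreducible polynomials of degree at most `K`. -/
noncomputable def irredsLE (F : Type*) [Field F] [Fintype F] (K : ℕ) : Finset F[X] :=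
  (Finset.range (K + 1)).biUnion (irreds F)

lemma mem_irredsLE {K : ℕ} {P : F[X]} :
    P ∈ irredsLE F K ↔ P.Monic ∧ Irreducible P ∧ P.natDegree ≤ K := by
  simp only [irredsLE, Finset.mem_biUnion, Finset.mem_range, mem_irreds]
  constructor
  · rintro ⟨d, hd, h1, h2, rfl⟩
    exact ⟨h1, h2, by omega⟩
  · rintro ⟨h1, h2, h3⟩
    exact ⟨_, by omega, h1, h2, rfl⟩

lemma card_not_roughOutside_le (K N : ℕ) :
    (((monics F N).filter fun g => ¬ RoughOutside K (irredsLE F K) g).card : ℝ) ≤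
      (Fintype.card F : ℝ) ^ N * (1 / 2) ^ K := by
  have hq : (2 : ℝ) ≤ Fintype.card F := by exact_mod_cast Fintype.one_lt_card (α := F)
  have hsub : ((monics F N).filter fun g => ¬ RoughOutside K (irredsLE F K) g) ⊆
      (Finset.range N).biUnion fun j => (irreds F (K + 1 + j)).biUnion fun P =>
        (monics F N).filter (P ^ 2 ∣ ·) := by
    intro g hg
    rw [Finset.mem_filter] at hg
    obtain ⟨hg1, hg2⟩ := hg
    simp only [RoughOutside, not_forall] at hg2
    obtain ⟨P, hP, hPi, hPg, hn⟩ := hg2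
    rw [not_or, mem_irredsLE] at hn
    have hK : K < P.natDegree := by
      by_contra h
      exact hn.1 ⟨hP, hPi, by omega⟩
    have hPP : P ^ 2 ∣ g := by
      by_contra h
      exact hn.2 ⟨hK, h⟩
    have hgm := mem_monics.1 hg1
    have hdeg := Polynomial.natDegree_le_of_dvd hPg hgm.1.ne_zero
    simp only [Finset.mem_biUnion, Finset.mem_range, mem_irreds, Finset.mem_filter]
    exact ⟨P.natDegree - (K + 1), by omega, P, ⟨hP, hPi, by omega⟩, hg1, hPP⟩
  have h1 : ∀ j P, P ∈ irreds F (K + 1 + j) →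
      (((monics F N).filter (P ^ 2 ∣ ·)).card : ℝ) * (Fintype.card F : ℝ) ^ (K + 1 + j) ≤
        (Fintype.card F : ℝ) ^ N * (1 / 2) ^ (K + 1 + j) := by
    intro j P hP
    obtain ⟨hPm, hPi, hPd⟩ := mem_irreds.1 hP
    have hd2 : (P ^ 2).natDegree = 2 * (K + 1 + j) := by rw [natDegree_pow, hPd]
    by_cases hN : 2 * (K + 1 + j) ≤ N
    · have := sum_monics_dvd (hPm.pow 2) (hd2.trans_le hN) (fun _ => (1 : ℝ))
      rw [Finset.sum_const, Finset.sum_const, card_monics, hd2, nsmul_eq_mul, nsmul_eq_mul,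
        mul_one, mul_one] at this
      rw [this]
      push_cast
      have e : (Fintype.card F : ℝ) ^ N = (Fintype.card F : ℝ) ^ (N - 2 * (K + 1 + j)) *
          ((Fintype.card F : ℝ) ^ (K + 1 + j) * (Fintype.card F : ℝ) ^ (K + 1 + j)) := by
        rw [← pow_add, ← pow_add]; congr 1; omega
      rw [e, mul_assoc, mul_assoc]
      gcongr
      refine le_mul_of_one_le_right (by positivity) ?_
      rw [← mul_pow]
      exact one_le_pow₀ (by linarith)
    · rw [filter_monics_dvd_of_lt]
      · simp
      · omega
  have h2 : ((((Finset.range N).biUnion fun j => (irreds F (K + 1 + j)).biUnion fun P =>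
        (monics F N).filter (P ^ 2 ∣ ·)).card : ℕ) : ℝ) ≤
      ∑ j ∈ Finset.range N, (Fintype.card F : ℝ) ^ N * (1 / 2) ^ (K + 1 + j) := by
    refine (Nat.cast_le.2 Finset.card_biUnion_le).trans ?_
    push_cast
    refine Finset.sum_le_sum fun j _ => ?_
    refine (Nat.cast_le.2 Finset.card_biUnion_le).trans ?_
    push_cast
    have hpos : (0 : ℝ) < (Fintype.card F : ℝ) ^ (K + 1 + j) := by positivity
    rw [← mul_le_mul_iff_left₀ hpos, Finset.sum_mul]
    refine (Finset.sum_le_card_nsmul _ _ _ fun P hP => h1 j P hP).trans ?_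
    rw [nsmul_eq_mul, mul_comm]
    gcongr
    exact_mod_cast card_irreds_le (F := F) (K + 1 + j)
  refine (Nat.cast_le.2 (Finset.card_le_card hsub)).trans (h2.trans ?_)
  rw [← Finset.mul_sum]
  gcongr
  simp_rw [pow_add, pow_one]
  rw [← Finset.mul_sum]
  have := sum_geometric_two_le N
  have h3 : (0 : ℝ) < (1 / 2) ^ K := by positivity
  nlinarith

lemma exists_norm_le_of_periodic {s : F[X]} (hs : s ≠ 0) {φ : F[X] → ℂ}
    (hφ : ∀ g h, s ∣ g - h → φ g = φ h) : ∃ C, ∀ g, ‖φ g‖ ≤ C := by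
  have := finite_adjoinRoot hs
  have := Fintype.ofFinite (AdjoinRoot s)
  refine ⟨∑ r : AdjoinRoot s, ‖φ (AdjoinRoot.mk_surjective r).choose‖, fun g => ?_⟩
  have h1 : φ g = φ (AdjoinRoot.mk_surjective (AdjoinRoot.mk s g)).choose := by
    refine hφ _ _ ?_
    rw [← AdjoinRoot.mk_eq_zero, map_sub,
      (AdjoinRoot.mk_surjective (AdjoinRoot.mk s g)).choose_spec, sub_self]
  rw [h1]
  exact Finset.single_le_sum (f := fun r : AdjoinRoot s => ‖φ (AdjoinRoot.mk_surjective r).choose‖)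
    (fun _ _ => norm_nonneg _) (Finset.mem_univ (AdjoinRoot.mk s g))

variable {ν : F[X] → ℂ}

theorem tendsto_sum_monics_periodic (hν : IsMultFn ν) (hνb : ∀ g, ‖ν g‖ ≤ 1) (hν1 : ν 1 = 1)
    (hpret : ∀ χ ξ : Polynomial F → ℂ, ∀ θ : ℝ,
      IsDirichletChar χ → IsShortIntervalChar ξ → θ ∈ Set.Ico (0 : ℝ) 1 →
      Tendsto (fun N : ℕ => pretDist ν (fun g => χ g * ξ g * eTheta θ g) N) atTop atTop)
    {s : F[X]} (hs : s ≠ 0) {φ : F[X] → ℂ} (hφ : ∀ g h, s ∣ g - h → φ g = φ h) :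
    Tendsto (fun n : ℕ => (∑ g ∈ monics F n, ν g * φ g) / (Fintype.card F : ℂ) ^ n)
      atTop (𝓝 0) := by
  have hq : (0 : ℝ) < Fintype.card F := by exact_mod_cast Fintype.card_pos
  obtain ⟨C, hC⟩ := exists_norm_le_of_periodic hs hφ
  have hC0 : 0 ≤ C := (norm_nonneg _).trans (hC 0)
  rw [Metric.tendsto_atTop]
  intro ε hε
  obtain ⟨k, hk⟩ := exists_pow_lt_of_lt_one (show 0 < ε / 2 / (C + 1) by positivity)
    (show (1 / 2 : ℝ) < 1 by norm_num)
  set K := max k s.natDegree with hK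
  have hK2 : (1 / 2 : ℝ) ^ K < ε / 2 / (C + 1) :=
    (pow_le_pow_of_le_one (by norm_num) (by norm_num) (le_max_left _ _)).trans_lt hk
  have ht := tendsto_sum_monics_roughOutside hν hνb hν1 hpret hs (le_max_right k s.natDegree)
    (irredsLE F K) (fun Q hQ => mem_irredsLE.1 hQ) φ ⟨C, hC⟩ hφ
  rw [Metric.tendsto_atTop] at ht
  obtain ⟨N, hN⟩ := ht (ε / 2) (by positivity)
  refine ⟨N, fun n hn => ?_⟩
  have h1 := hN n hn
  rw [dist_zero_right] at h1 ⊢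
  have hsplit : ∑ g ∈ monics F n, ν g * φ g =
      (∑ g ∈ monics F n, if RoughOutside K (irredsLE F K) g then ν g * φ g else 0) +
      ∑ g ∈ (monics F n).filter (fun g => ¬ RoughOutside K (irredsLE F K) g), ν g * φ g := by
    rw [← Finset.sum_filter, Finset.sum_filter_add_sum_filter_not]
  rw [hsplit, add_div]
  refine (norm_add_le _ _).trans_lt ?_
  have h2 : ‖(∑ g ∈ (monics F n).filter (fun g => ¬ RoughOutside K (irredsLE F K) g), ν g * φ g) /
      (Fintype.card F : ℂ) ^ n‖ ≤ C * (1 / 2) ^ K := by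
    rw [norm_div, norm_pow, Complex.norm_natCast, div_le_iff₀ (by positivity)]
    refine (norm_sum_le _ _).trans ?_
    refine (Finset.sum_le_card_nsmul _ _ C fun g _ => ?_).trans ?_
    · rw [norm_mul]
      exact (mul_le_of_le_one_left (norm_nonneg _) (hνb _)).trans (hC _)
    · rw [nsmul_eq_mul]
      have := card_not_roughOutside_le (F := F) K n
      nlinarith
  have h3 : C * (1 / 2) ^ K ≤ ε / 2 := by
    rw [lt_div_iff₀ (by positivity)] at hK2
    have : (0:ℝ) < (1 / 2) ^ K := by positivity
    nlinarith
  linarith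

lemma isCoprime_of_isUnit_left {u g : F[X]} (hu : IsUnit u) : IsCoprime u g := by
  obtain ⟨v, hv⟩ := hu.exists_left_inv
  exact ⟨v, 0, by rw [hv, zero_mul, add_zero]⟩

lemma tendsto_sum_polysLT_of_monics {f : F[X] → ℂ}
    (h : ∀ u : Fˣ, Tendsto (fun n : ℕ => (∑ g ∈ monics F n, f (C (u : F) * g)) /
      (Fintype.card F : ℂ) ^ n) atTop (𝓝 0)) :
    Tendsto (fun n : ℕ => (∑ g ∈ polysLT F n, f g) / (Fintype.card F : ℂ) ^ n) atTop (𝓝 0) := by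
  have hq : (1 : ℝ) < Fintype.card F := by exact_mod_cast Fintype.one_lt_card (α := F)
  have hqc : (Fintype.card F : ℂ) ≠ 0 := by exact_mod_cast Fintype.card_ne_zero
  set r : ℝ := (Fintype.card F : ℝ)⁻¹ with hr
  set b : ℕ → ℂ := fun n => ∑ u : Fˣ, (∑ g ∈ monics F n, f (C (u : F) * g)) /
      (Fintype.card F : ℂ) ^ n with hb
  have hbt : Tendsto b atTop (𝓝 0) := by
    have := tendsto_finsetSum (Finset.univ : Finset Fˣ) fun u _ => h u
    simpa using this
  obtain ⟨D, hD⟩ := hbt.norm.bddAbove_range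
  have ht := tendsto_sum_geometric_shift (d := 1) (r := r) (by positivity)
    (inv_lt_one_of_one_lt₀ hq) (a := fun _ => b) (C := D)
    (fun j n => hD (Set.mem_range_self n)) (fun _ => hbt)
  have hrec : ∀ N, (∑ g ∈ polysLT F (N + 1), f g) / (Fintype.card F : ℂ) ^ N =
      f 0 * (r : ℂ) ^ N + ∑ j ∈ Finset.range (N + 1),
        if j * 1 ≤ N then (r : ℂ) ^ j * b (N - j * 1) else 0 := by
    intro N
    induction N with
    | zero =>
      rw [sum_polysLT_succ, polysLT_zero]
      simp [hb]
    | succ N ih =>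
      rw [sum_polysLT_succ, add_div, pow_succ, ← div_div, ih, Finset.sum_range_succ' _ (N + 1)]
      have e1 : ((∑ u : Fˣ, ∑ h ∈ monics F (N + 1), f (C (u : F) * h)) /
          ((Fintype.card F : ℂ) ^ N * (Fintype.card F : ℂ))) = b (N + 1) := by
        rw [hb, ← pow_succ]; simp only [Finset.sum_div]
      have e2 : ∑ k ∈ Finset.range (N + 1), (if (k + 1) * 1 ≤ N + 1 then
          (r : ℂ) ^ (k + 1) * b (N + 1 - (k + 1) * 1) else 0) =
          r * ∑ j ∈ Finset.range (N + 1), if j * 1 ≤ N then (r : ℂ) ^ j * b (N - j * 1) else 0 := by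
        rw [Finset.mul_sum]
        refine Finset.sum_congr rfl fun k hk => ?_
        rw [Finset.mem_range] at hk
        rw [if_pos (by omega), if_pos (by omega), pow_succ',
          show N + 1 - (k + 1) * 1 = N - k * 1 by omega, mul_assoc]
      rw [e1, e2, if_pos (by omega)]
      have e3 : (r : ℂ) = (Fintype.card F : ℂ)⁻¹ := by rw [hr]; push_cast; rfl
      simp only [e3, zero_mul, Nat.sub_zero, pow_zero, one_mul, inv_pow]
      field_simp
      ring
  have hr0 : Tendsto (fun N : ℕ => f 0 * (r : ℂ) ^ N) atTop (𝓝 0) := by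
    have : Tendsto (fun N : ℕ => (r : ℂ) ^ N) atTop (𝓝 0) := by
      refine tendsto_pow_atTop_nhds_zero_of_norm_lt_one ?_
      rw [Complex.norm_real, Real.norm_of_nonneg (by positivity)]
      exact inv_lt_one_of_one_lt₀ hq
    simpa using this.const_mul (f 0)
  have hsum := ((hr0.add ht).congr fun N => (hrec N).symm).mul_const (Fintype.card F : ℂ)⁻¹
  rw [add_zero, zero_mul] at hsum
  refine (tendsto_add_atTop_iff_nat 1).1 (hsum.congr fun N => ?_)
  rw [pow_succ, ← div_div, div_eq_mul_inv _ (Fintype.card F : ℂ)]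

theorem tendsto_sum_polysLT_periodic (hν : IsMultFn ν) (hνb : ∀ g, ‖ν g‖ ≤ 1)
    (hpret : ∀ χ ξ : Polynomial F → ℂ, ∀ θ : ℝ,
      IsDirichletChar χ → IsShortIntervalChar ξ → θ ∈ Set.Ico (0 : ℝ) 1 →
      Tendsto (fun N : ℕ => pretDist ν (fun g => χ g * ξ g * eTheta θ g) N) atTop atTop)
    {s : F[X]} (hs : s ≠ 0) {φ : F[X] → ℂ} (hφ : ∀ g h, s ∣ g - h → φ g = φ h) :
    Tendsto (fun n : ℕ => (∑ g ∈ polysLT F n, ν g * φ g) / (Fintype.card F : ℂ) ^ n)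
      atTop (𝓝 0) := by
  by_cases hν1 : ν 1 = 1
  · refine tendsto_sum_polysLT_of_monics fun u => ?_
    · have := (tendsto_sum_monics_periodic hν hνb hν1 hpret hs
        (φ := fun g => φ (Polynomial.C (u : F) * g)) (fun g h hgh => hφ _ _
          (by rw [← mul_sub]; exact hgh.mul_left _))).const_mul (ν (Polynomial.C (u : F)))
      rw [mul_zero] at this
      refine this.congr fun n => ?_
      rw [mul_div_assoc', Finset.mul_sum]
      congr 1
      refine Finset.sum_congr rfl fun g _ => ?_
      rw [hν _ _ (isCoprime_of_isUnit_left (Polynomial.isUnit_C.2 u.isUnit))]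
      ring
  · have h0 : ∀ g, ν g = 0 := by
      have h1 : ν 1 = ν 1 * ν 1 := by
        have := hν 1 1 isCoprime_one_left
        rwa [mul_one] at this
      have h2 : ν 1 = 0 := by
        by_contra h
        exact hν1 (mul_left_cancel₀ h (by rw [mul_one]; exact h1.symm))
      intro g
      have := hν 1 g isCoprime_one_left
      rwa [one_mul, h2, zero_mul] at this
    simp [h0]

end PeriodicTotal

section Katai
open scoped Classical
open Topology ComplexConjugate

variable {F : Type*} [Field F] [Fintype F]

lemma card_filter_polysLT_dvd {P : F[X]} (hP : P ≠ 0) {n : ℕ} (hn : P.natDegree ≤ n) :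
    (((polysLT F n).filter (P ∣ ·)).card : ℝ) =
      (Fintype.card F : ℝ) ^ n * ((Fintype.card F : ℝ) ^ P.natDegree)⁻¹ := by
  have hq : (0 : ℝ) < Fintype.card F := by exact_mod_cast Fintype.card_pos
  have := sum_polysLT_dvd hP hn (fun _ => (1 : ℝ))
  rw [Finset.sum_const, Finset.sum_const, card_polysLT, nsmul_eq_mul, nsmul_eq_mul,
    mul_one, mul_one] at this
  rw [this, eq_mul_inv_iff_mul_eq₀ (by positivity)]
  push_cast
  rw [← pow_add]
  congr 1
  omega

/-- The Turán–Kubilius variance bound. -/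
lemma sum_sq_card_irreducible_divisors_sub_le {S : Finset F[X]} {D n : ℕ}
    (hS : ∀ P ∈ S, P.Monic ∧ Irreducible P ∧ P.natDegree ≤ D) (hn : 2 * D ≤ n) :
    ∑ g ∈ polysLT F n, ((∑ P ∈ S, if P ∣ g then (1 : ℝ) else 0) -
        ∑ P ∈ S, ((Fintype.card F : ℝ) ^ P.natDegree)⁻¹) ^ 2 ≤
      (Fintype.card F : ℝ) ^ n * ∑ P ∈ S, ((Fintype.card F : ℝ) ^ P.natDegree)⁻¹ := by
  have hq : (0 : ℝ) < Fintype.card F := by exact_mod_cast Fintype.card_pos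
  set W := ∑ P ∈ S, ((Fintype.card F : ℝ) ^ P.natDegree)⁻¹ with hW
  have h1 : ∑ g ∈ polysLT F n, (∑ P ∈ S, if P ∣ g then (1 : ℝ) else 0) =
      (Fintype.card F : ℝ) ^ n * W := by
    rw [Finset.sum_comm, hW, Finset.mul_sum]
    refine Finset.sum_congr rfl fun P hP => ?_
    obtain ⟨hm, -, hd⟩ := hS P hP
    rw [Finset.sum_boole, card_filter_polysLT_dvd hm.ne_zero (by omega)]
  have h2 : ∑ g ∈ polysLT F n, (∑ P ∈ S, if P ∣ g then (1 : ℝ) else 0) ^ 2 ≤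
      (Fintype.card F : ℝ) ^ n * (W ^ 2 + W) := by
    have e1 : ∀ g : F[X], (∑ P ∈ S, if P ∣ g then (1 : ℝ) else 0) ^ 2 =
        ∑ P ∈ S, ∑ Q ∈ S, if P ∣ g ∧ Q ∣ g then (1 : ℝ) else 0 := by
      intro g
      rw [sq, Finset.sum_mul_sum]
      refine Finset.sum_congr rfl fun P _ => Finset.sum_congr rfl fun Q _ => ?_
      by_cases h : P ∣ g <;> by_cases h' : Q ∣ g <;> simp [h, h']
    simp_rw [e1]
    rw [Finset.sum_comm]
    have e2 : ∀ P ∈ S, ∑ g ∈ polysLT F n, ∑ Q ∈ S, (if P ∣ g ∧ Q ∣ g then (1 : ℝ) else 0) ≤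
        (Fintype.card F : ℝ) ^ n * (((Fintype.card F : ℝ) ^ P.natDegree)⁻¹ * W +
          ((Fintype.card F : ℝ) ^ P.natDegree)⁻¹) := by
      intro P hP
      obtain ⟨hm, hi, hd⟩ := hS P hP
      rw [Finset.sum_comm]
      have e3 : ∀ Q ∈ S, ∑ g ∈ polysLT F n, (if P ∣ g ∧ Q ∣ g then (1 : ℝ) else 0) ≤
          (Fintype.card F : ℝ) ^ n * (((Fintype.card F : ℝ) ^ P.natDegree)⁻¹ *
            ((Fintype.card F : ℝ) ^ Q.natDegree)⁻¹) +
          if P = Q then (Fintype.card F : ℝ) ^ n * ((Fintype.card F : ℝ) ^ P.natDegree)⁻¹ else 0 := by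
        intro Q hQ
        obtain ⟨hm', hi', hd'⟩ := hS Q hQ
        rw [Finset.sum_boole]
        by_cases hPQ : P = Q
        · subst hPQ
          simp only [and_self]
          rw [card_filter_polysLT_dvd hm.ne_zero (by omega), if_pos trivial]
          exact le_add_of_nonneg_left (by positivity)
        · rw [if_neg hPQ, add_zero]
          have hc := isCoprime_of_irreducible_ne hm hi hm' hi' hPQ
          have : (polysLT F n).filter (fun g => P ∣ g ∧ Q ∣ g) = (polysLT F n).filter (P * Q ∣ ·) := by
            refine Finset.filter_congr fun g _ => ⟨fun h => hc.mul_dvd h.1 h.2, fun h =>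
              ⟨(dvd_mul_right _ _).trans h, (dvd_mul_left _ _).trans h⟩⟩
          have hdeg : (P * Q).natDegree = P.natDegree + Q.natDegree := hm.natDegree_mul hm'
          rw [this, card_filter_polysLT_dvd (hm.mul hm').ne_zero (by omega), hdeg, pow_add, mul_inv]
      refine (Finset.sum_le_sum e3).trans (le_of_eq ?_)
      rw [Finset.sum_add_distrib, Finset.sum_ite_eq, if_pos hP, ← Finset.mul_sum, ← Finset.mul_sum]
      ring
    refine (Finset.sum_le_sum e2).trans (le_of_eq ?_)
    rw [← Finset.mul_sum, Finset.sum_add_distrib, ← Finset.sum_mul]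
    ring
  have h3 : ∑ g ∈ polysLT F n, ((∑ P ∈ S, if P ∣ g then (1 : ℝ) else 0) - W) ^ 2 =
      ∑ g ∈ polysLT F n, (∑ P ∈ S, if P ∣ g then (1 : ℝ) else 0) ^ 2 -
      2 * W * ∑ g ∈ polysLT F n, (∑ P ∈ S, if P ∣ g then (1 : ℝ) else 0) +
      (Fintype.card F : ℝ) ^ n * W ^ 2 := by
    have : (Fintype.card F : ℝ) ^ n * W ^ 2 = ∑ g ∈ polysLT F n, W ^ 2 := by
      rw [Finset.sum_const, card_polysLT, nsmul_eq_mul]; push_cast; rfl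
    rw [this, Finset.mul_sum, ← Finset.sum_sub_distrib, ← Finset.sum_add_distrib]
    exact Finset.sum_congr rfl fun g _ => by ring
  rw [h3, h1]
  nlinarith

lemma sq_norm_sum_mul_le {ι : Type*} (s : Finset ι) (a b : ι → ℂ) (ha : ∀ i ∈ s, ‖a i‖ ≤ 1) :
    ‖∑ i ∈ s, a i * b i‖ ^ 2 ≤ s.card * ∑ i ∈ s, ‖b i‖ ^ 2 := by
  have h1 : ‖∑ i ∈ s, a i * b i‖ ≤ ∑ i ∈ s, ‖b i‖ := by
    refine (norm_sum_le _ _).trans (Finset.sum_le_sum fun i hi => ?_)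
    rw [norm_mul]
    exact mul_le_of_le_one_left (norm_nonneg _) (ha i hi)
  refine (pow_le_pow_left₀ (norm_nonneg _) h1 2).trans ?_
  exact sq_sum_le_card_mul_sum_sq

lemma sq_norm_bilinear_sum_le {ν f : F[X] → ℂ} (hνb : ∀ g, ‖ν g‖ ≤ 1) (S : Finset F[X]) (N : ℕ) :
    ‖∑ P ∈ S, ∑ h ∈ polysLT F N, ν P * ν h * f (P * h)‖ ^ 2 ≤
      (Fintype.card F : ℝ) ^ N * ∑ P ∈ S, ∑ Q ∈ S,
        ‖∑ h ∈ polysLT F N, f (P * h) * conj (f (Q * h))‖ := by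
  rw [Finset.sum_comm]
  have e1 : ∀ h : F[X], ∑ P ∈ S, ν P * ν h * f (P * h) = ν h * ∑ P ∈ S, ν P * f (P * h) := by
    intro h
    rw [Finset.mul_sum]
    exact Finset.sum_congr rfl fun P _ => by ring
  simp_rw [e1]
  refine (sq_norm_sum_mul_le _ _ _ fun h _ => hνb h).trans ?_
  rw [card_polysLT]
  push_cast
  gcongr
  have e2 : ((∑ h ∈ polysLT F N, ‖∑ P ∈ S, ν P * f (P * h)‖ ^ 2 : ℝ) : ℂ) =
      ∑ P ∈ S, ∑ Q ∈ S, ν P * conj (ν Q) * ∑ h ∈ polysLT F N, f (P * h) * conj (f (Q * h)) := by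
    push_cast
    simp_rw [← Complex.mul_conj', map_sum, Finset.sum_mul_sum, Finset.mul_sum]
    rw [Finset.sum_comm]
    refine Finset.sum_congr rfl fun P _ => ?_
    rw [Finset.sum_comm]
    refine Finset.sum_congr rfl fun Q _ => Finset.sum_congr rfl fun h _ => ?_
    rw [map_mul]; ring
  have e3 : ∑ h ∈ polysLT F N, ‖∑ P ∈ S, ν P * f (P * h)‖ ^ 2 =
      ‖((∑ h ∈ polysLT F N, ‖∑ P ∈ S, ν P * f (P * h)‖ ^ 2 : ℝ) : ℂ)‖ := by
    rw [Complex.norm_real, Real.norm_of_nonneg (by positivity)]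
  rw [e3, e2]
  refine (norm_sum_le _ _).trans (Finset.sum_le_sum fun P _ => ?_)
  refine (norm_sum_le _ _).trans (Finset.sum_le_sum fun Q _ => ?_)
  rw [norm_mul, norm_mul, RCLike.norm_conj]
  exact mul_le_of_le_one_left (norm_nonneg _) (mul_le_one₀ (hνb P) (norm_nonneg _) (hνb Q))

lemma eventually_sum_norm_correlation_le {f : F[X] → ℂ} (hf : ∀ g, ‖f g‖ ≤ 1) {M d : ℕ}
    (hM : ∀ P ∈ irreds F d, ((irreds F d).filter fun Q => ¬ Tendsto (fun n : ℕ =>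
      (∑ h ∈ polysLT F n, f (P * h) * conj (f (Q * h))) / (Fintype.card F : ℂ) ^ n)
      atTop (𝓝 0)).card ≤ M) :
    ∀ᶠ N : ℕ in atTop, ∑ P ∈ irreds F d, ∑ Q ∈ irreds F d,
      ‖∑ h ∈ polysLT F N, f (P * h) * conj (f (Q * h))‖ ≤
        (Fintype.card F : ℝ) ^ N * ((M + 1) * (Fintype.card F : ℝ) ^ d) := by
  have hq : (0 : ℝ) < Fintype.card F := by exact_mod_cast Fintype.card_pos
  have key : ∀ P ∈ irreds F d, ∀ᶠ N : ℕ in atTop, ∑ Q ∈ irreds F d,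
      ‖∑ h ∈ polysLT F N, f (P * h) * conj (f (Q * h))‖ ≤ (Fintype.card F : ℝ) ^ N * (M + 1) := by
    intro P hP
    set Bad := (irreds F d).filter fun Q => ¬ Tendsto (fun n : ℕ =>
      (∑ h ∈ polysLT F n, f (P * h) * conj (f (Q * h))) / (Fintype.card F : ℂ) ^ n)
      atTop (𝓝 0) with hBad
    set Good := (irreds F d).filter fun Q => Tendsto (fun n : ℕ =>
      (∑ h ∈ polysLT F n, f (P * h) * conj (f (Q * h))) / (Fintype.card F : ℂ) ^ n)
      atTop (𝓝 0) with hGood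
    have ht : Tendsto (fun n : ℕ => ∑ Q ∈ Good,
        ‖(∑ h ∈ polysLT F n, f (P * h) * conj (f (Q * h))) / (Fintype.card F : ℂ) ^ n‖)
        atTop (𝓝 0) := by
      have := tendsto_finsetSum Good fun Q hQ => (Finset.mem_filter.1 hQ).2.norm
      simpa using this
    filter_upwards [ht.eventually_le_const zero_lt_one] with N hN
    rw [← Finset.sum_filter_add_sum_filter_not _ (fun Q => Tendsto (fun n : ℕ =>
      (∑ h ∈ polysLT F n, f (P * h) * conj (f (Q * h))) / (Fintype.card F : ℂ) ^ n)
      atTop (𝓝 0)), ← hGood, ← hBad, mul_add, mul_one, add_comm]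
    refine add_le_add ?_ ?_
    · refine (Finset.sum_le_card_nsmul _ _ ((Fintype.card F : ℝ) ^ N) fun Q _ => ?_).trans ?_
      · refine (norm_sum_le _ _).trans ?_
        refine (Finset.sum_le_card_nsmul _ _ 1 fun h _ => ?_).trans (le_of_eq ?_)
        · rw [norm_mul, RCLike.norm_conj]
          exact mul_le_one₀ (hf _) (norm_nonneg _) (hf _)
        · rw [card_polysLT]; simp
      · rw [nsmul_eq_mul, mul_comm]
        gcongr
        exact Nat.cast_le.2 (hM P hP)
    · simp_rw [norm_div, norm_pow, Complex.norm_natCast] at hN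
      rw [← Finset.sum_div, div_le_iff₀ (by positivity), one_mul] at hN
      exact hN
  have := (Filter.eventually_all_finset (irreds F d)).2 key
  filter_upwards [this] with N hN
  refine (Finset.sum_le_card_nsmul _ _ _ hN).trans ?_
  rw [nsmul_eq_mul]
  have hc : ((irreds F d).card : ℝ) ≤ (Fintype.card F : ℝ) ^ d := by
    exact_mod_cast card_irreds_le (F := F) d
  calc _ ≤ (Fintype.card F : ℝ) ^ d * ((Fintype.card F : ℝ) ^ N * (M + 1)) := by gcongr
    _ = _ := by ring

end Katai

section KataiCriterion
open scoped Classical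
open Topology ComplexConjugate

variable {F : Type*} [Field F] [Fintype F]

lemma sum_irredsLE {M : Type*} [AddCommMonoid M] (D : ℕ) (f : F[X] → M) :
    ∑ P ∈ irredsLE F D, f P = ∑ d ∈ Finset.range (D + 1), ∑ P ∈ irreds F d, f P := by
  rw [irredsLE, Finset.sum_biUnion]
  intro d _ e _ hde
  refine Finset.disjoint_left.2 fun P h1 h2 => hde ?_
  rw [← (mem_irreds.1 h1).2.2, ← (mem_irreds.1 h2).2.2]

variable {ν f : F[X] → ℂ}

lemma norm_sum_sub_sum_divisor_weight_le (hνb : ∀ g, ‖ν g‖ ≤ 1) (hf : ∀ g, ‖f g‖ ≤ 1)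
    {D n : ℕ} (hn : 2 * D ≤ n) :
    ‖((∑ P ∈ irredsLE F D, ((Fintype.card F : ℝ) ^ P.natDegree)⁻¹ : ℝ) : ℂ) *
        (∑ g ∈ polysLT F n, ν g * f g) -
      ∑ P ∈ irredsLE F D, ∑ h ∈ polysLT F (n - P.natDegree), ν (P * h) * f (P * h)‖ ≤
      (Fintype.card F : ℝ) ^ n *
        √(∑ P ∈ irredsLE F D, ((Fintype.card F : ℝ) ^ P.natDegree)⁻¹) := by
  set W := ∑ P ∈ irredsLE F D, ((Fintype.card F : ℝ) ^ P.natDegree)⁻¹ with hW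
  have hW0 : 0 ≤ W := by positivity
  have e1 : ∑ P ∈ irredsLE F D, ∑ h ∈ polysLT F (n - P.natDegree), ν (P * h) * f (P * h) =
      ∑ g ∈ polysLT F n, (ν g * f g) *
        ((∑ P ∈ irredsLE F D, if P ∣ g then (1 : ℝ) else 0 : ℝ) : ℂ) := by
    push_cast
    simp_rw [Finset.mul_sum]
    rw [Finset.sum_comm]
    refine Finset.sum_congr rfl fun P hP => ?_
    obtain ⟨hm, hi, hd⟩ := mem_irredsLE.1 hP
    rw [← sum_polysLT_dvd hm.ne_zero (by omega) (fun g => ν g * f g), Finset.sum_filter]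
    refine Finset.sum_congr rfl fun g _ => ?_
    split_ifs <;> simp
  have e2 : (W : ℂ) * (∑ g ∈ polysLT F n, ν g * f g) -
      ∑ P ∈ irredsLE F D, ∑ h ∈ polysLT F (n - P.natDegree), ν (P * h) * f (P * h) =
      ∑ g ∈ polysLT F n, (ν g * f g) *
        ((W - (∑ P ∈ irredsLE F D, if P ∣ g then (1 : ℝ) else 0) : ℝ) : ℂ) := by
    rw [e1, Finset.mul_sum, ← Finset.sum_sub_distrib]
    refine Finset.sum_congr rfl fun g _ => ?_
    rw [Complex.ofReal_sub]; ring
  rw [e2, ← pow_le_pow_iff_left₀ (norm_nonneg _) (by positivity) two_ne_zero]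
  refine (sq_norm_sum_mul_le _ _ _ fun g _ => ?_).trans ?_
  · rw [norm_mul]; exact mul_le_one₀ (hνb g) (norm_nonneg _) (hf g)
  · have h1 := sum_sq_card_irreducible_divisors_sub_le (S := irredsLE F D) (D := D) (n := n)
      (fun P hP => mem_irredsLE.1 hP) hn
    rw [mul_pow, Real.sq_sqrt hW0, card_polysLT]
    rw [Nat.cast_pow, sq ((Fintype.card F : ℝ) ^ n), mul_assoc]
    gcongr
    refine le_trans (le_of_eq ?_) h1
    refine Finset.sum_congr rfl fun g _ => ?_
    rw [Complex.norm_real, Real.norm_eq_abs, sq_abs, ← neg_sq, neg_sub]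

lemma norm_sum_sub_bilinear_sum_le (hν : IsMultFn ν) (hνb : ∀ g, ‖ν g‖ ≤ 1) (hf : ∀ g, ‖f g‖ ≤ 1)
    {D n : ℕ} (hn : 2 * D ≤ n) :
    ‖∑ P ∈ irredsLE F D, ∑ h ∈ polysLT F (n - P.natDegree), ν (P * h) * f (P * h) -
      ∑ P ∈ irredsLE F D, ∑ h ∈ polysLT F (n - P.natDegree), ν P * ν h * f (P * h)‖ ≤
      4 * (Fintype.card F : ℝ) ^ n := by
  have hq : (2 : ℝ) ≤ Fintype.card F := by exact_mod_cast Fintype.one_lt_card (α := F)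
  rw [← Finset.sum_sub_distrib]
  refine (norm_sum_le _ _).trans ?_
  have h1 : ∀ P ∈ irredsLE F D,
      ‖∑ h ∈ polysLT F (n - P.natDegree), ν (P * h) * f (P * h) -
        ∑ h ∈ polysLT F (n - P.natDegree), ν P * ν h * f (P * h)‖ ≤
      2 * (Fintype.card F : ℝ) ^ n * (((Fintype.card F : ℝ) ^ P.natDegree)⁻¹ *
        (1 / 2) ^ P.natDegree) := by
    intro P hP
    obtain ⟨hm, hi, hd⟩ := mem_irredsLE.1 hP
    rw [← Finset.sum_sub_distrib]
    have h2 : ∀ h ∈ polysLT F (n - P.natDegree),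
        ‖ν (P * h) * f (P * h) - ν P * ν h * f (P * h)‖ ≤ if P ∣ h then 2 else 0 := by
      intro h _
      split_ifs with hdv
      · refine (norm_sub_le _ _).trans ?_
        have b1 : ‖ν (P * h) * f (P * h)‖ ≤ 1 := by
          rw [norm_mul]; exact mul_le_one₀ (hνb _) (norm_nonneg _) (hf _)
        have b2 : ‖ν P * ν h * f (P * h)‖ ≤ 1 := by
          rw [norm_mul, norm_mul]
          exact mul_le_one₀ (mul_le_one₀ (hνb _) (norm_nonneg _) (hνb _)) (norm_nonneg _) (hf _)
        linarith
      · rw [hν P h (hi.coprime_iff_not_dvd.2 hdv), sub_self, norm_zero]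
    refine (norm_sum_le _ _).trans ((Finset.sum_le_sum h2).trans ?_)
    rw [← Finset.sum_filter, Finset.sum_const, nsmul_eq_mul,
      card_filter_polysLT_dvd hm.ne_zero (by omega), mul_comm, mul_assoc]
    have e : (Fintype.card F : ℝ) ^ n = (Fintype.card F : ℝ) ^ (n - P.natDegree) *
        (Fintype.card F : ℝ) ^ P.natDegree := by
      rw [← pow_add]; congr 1; omega
    have hp : (0 : ℝ) < (Fintype.card F : ℝ) ^ P.natDegree := by positivity
    have e2 : (Fintype.card F : ℝ) ^ n * (((Fintype.card F : ℝ) ^ P.natDegree)⁻¹ *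
        (1 / 2) ^ P.natDegree) = (Fintype.card F : ℝ) ^ (n - P.natDegree) * (1 / 2) ^ P.natDegree := by
      rw [e]; field_simp
    rw [e2, ← inv_pow, one_div]
    gcongr
  refine (Finset.sum_le_sum h1).trans ?_
  rw [← Finset.mul_sum, sum_irredsLE]
  have h3 : ∑ d ∈ Finset.range (D + 1), ∑ P ∈ irreds F d,
      (((Fintype.card F : ℝ) ^ P.natDegree)⁻¹ * (1 / 2) ^ P.natDegree) ≤ 2 := by
    refine le_trans (Finset.sum_le_sum fun d _ => ?_) (sum_geometric_two_le (D + 1))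
    have : ∀ P ∈ irreds F d, (((Fintype.card F : ℝ) ^ P.natDegree)⁻¹ * (1 / 2) ^ P.natDegree) ≤
        ((Fintype.card F : ℝ) ^ d)⁻¹ * (1 / 2) ^ d := by
      intro P hP
      rw [(mem_irreds.1 hP).2.2]
    refine (Finset.sum_le_card_nsmul _ _ _ this).trans ?_
    have hc : ((irreds F d).card : ℝ) ≤ (Fintype.card F : ℝ) ^ d := by
      exact_mod_cast card_irreds_le (F := F) d
    rw [nsmul_eq_mul, ← mul_assoc]
    refine mul_le_of_le_one_left (by positivity) ?_
    rw [mul_inv_le_iff₀ (by positivity), one_mul]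
    exact hc
  have : (0 : ℝ) < (Fintype.card F : ℝ) ^ n := by positivity
  nlinarith

lemma eventually_norm_bilinear_sum_le (hνb : ∀ g, ‖ν g‖ ≤ 1) (hf : ∀ g, ‖f g‖ ≤ 1) {M : ℕ}
    (hM : ∀ d, ∀ P ∈ irreds F d, ((irreds F d).filter fun Q => ¬ Tendsto (fun n : ℕ =>
      (∑ h ∈ polysLT F n, f (P * h) * conj (f (Q * h))) / (Fintype.card F : ℂ) ^ n)
      atTop (𝓝 0)).card ≤ M) (D : ℕ) :
    ∀ᶠ n : ℕ in atTop,
      ‖∑ P ∈ irredsLE F D, ∑ h ∈ polysLT F (n - P.natDegree), ν P * ν h * f (P * h)‖ ≤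
        4 * (M + 1) * (Fintype.card F : ℝ) ^ n := by
  have hq : (2 : ℝ) ≤ Fintype.card F := by exact_mod_cast Fintype.one_lt_card (α := F)
  have hall : ∀ᶠ n : ℕ in atTop, ∀ d ∈ Finset.range (D + 1),
      ∑ P ∈ irreds F d, ∑ Q ∈ irreds F d,
      ‖∑ h ∈ polysLT F (n - d), f (P * h) * conj (f (Q * h))‖ ≤
        (Fintype.card F : ℝ) ^ (n - d) * ((M + 1) * (Fintype.card F : ℝ) ^ d) := by
    refine (Filter.eventually_all_finset _).2 fun d _ => ?_
    exact (tendsto_sub_atTop_nat d).eventually (eventually_sum_norm_correlation_le hf (hM d))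
  filter_upwards [hall, eventually_ge_atTop D] with n hn hnD
  rw [sum_irredsLE]
  refine (norm_sum_le _ _).trans ?_
  have h1 : ∀ d ∈ Finset.range (D + 1),
      ‖∑ P ∈ irreds F d, ∑ h ∈ polysLT F (n - P.natDegree), ν P * ν h * f (P * h)‖ ≤
        (M + 1) * (Fintype.card F : ℝ) ^ n * (3 / 4) ^ d := by
    intro d hd
    have hd' : d ≤ D := by rw [Finset.mem_range] at hd; omega
    have e : ∑ P ∈ irreds F d, ∑ h ∈ polysLT F (n - P.natDegree), ν P * ν h * f (P * h) =
        ∑ P ∈ irreds F d, ∑ h ∈ polysLT F (n - d), ν P * ν h * f (P * h) :=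
      Finset.sum_congr rfl fun P hP => by rw [(mem_irreds.1 hP).2.2]
    rw [e, ← pow_le_pow_iff_left₀ (norm_nonneg _) (by positivity) two_ne_zero]
    refine (sq_norm_bilinear_sum_le hνb _ _).trans ?_
    have h2 := hn d hd
    have e2 : (Fintype.card F : ℝ) ^ n = (Fintype.card F : ℝ) ^ (n - d) *
        (Fintype.card F : ℝ) ^ d := by
      rw [← pow_add]; congr 1; omega
    calc _ ≤ (Fintype.card F : ℝ) ^ (n - d) *
          ((Fintype.card F : ℝ) ^ (n - d) * ((M + 1) * (Fintype.card F : ℝ) ^ d)) := by gcongr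
      _ = ((Fintype.card F : ℝ) ^ (n - d)) ^ 2 * ((M + 1) * (Fintype.card F : ℝ) ^ d) * 1 := by ring
      _ ≤ ((Fintype.card F : ℝ) ^ (n - d)) ^ 2 * ((M + 1) * (Fintype.card F : ℝ) ^ d) *
          ((M + 1) * ((Fintype.card F : ℝ) * (9 / 16)) ^ d) := by
          gcongr
          refine one_le_mul_of_one_le_of_one_le (by linarith [M.cast_nonneg (α := ℝ)])
            (one_le_pow₀ (by linarith))
      _ = _ := by
          have e3 : (9 / 16 : ℝ) ^ d = ((3 / 4) ^ d) ^ 2 := by rw [← pow_mul', pow_mul]; norm_num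
          rw [e2, mul_pow, e3]; ring
  refine (Finset.sum_le_sum h1).trans ?_
  rw [← Finset.mul_sum]
  have h3 : ∑ d ∈ Finset.range (D + 1), (3 / 4 : ℝ) ^ d ≤ 4 := by
    refine (Summable.sum_le_tsum _ (fun _ _ => by positivity)
      (summable_geometric_of_lt_one (by norm_num) (by norm_num))).trans (le_of_eq ?_)
    rw [tsum_geometric_of_lt_one (by norm_num) (by norm_num)]; norm_num
  calc _ ≤ (M + 1) * (Fintype.card F : ℝ) ^ n * 4 := by gcongr
    _ = _ := by ring

/-- An orthogonality criterion of Kátai type. -/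
theorem tendsto_sum_mul_of_correlations (hν : IsMultFn ν) (hνb : ∀ g, ‖ν g‖ ≤ 1)
    (hpret : ∀ χ ξ : Polynomial F → ℂ, ∀ θ : ℝ,
      IsDirichletChar χ → IsShortIntervalChar ξ → θ ∈ Set.Ico (0 : ℝ) 1 →
      Tendsto (fun N : ℕ => pretDist ν (fun g => χ g * ξ g * eTheta θ g) N) atTop atTop)
    (hf : ∀ g, ‖f g‖ ≤ 1) {M : ℕ}
    (hM : ∀ d, ∀ P ∈ irreds F d, ((irreds F d).filter fun Q => ¬ Tendsto (fun n : ℕ =>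
      (∑ h ∈ polysLT F n, f (P * h) * conj (f (Q * h))) / (Fintype.card F : ℂ) ^ n)
      atTop (𝓝 0)).card ≤ M) :
    Tendsto (fun n : ℕ => (∑ g ∈ polysLT F n, ν g * f g) / (Fintype.card F : ℂ) ^ n)
      atTop (𝓝 0) := by
  have hq : (0 : ℝ) < Fintype.card F := by exact_mod_cast Fintype.card_pos
  have hW : ∀ B : ℝ, ∃ D, B < ∑ P ∈ irredsLE F D, ((Fintype.card F : ℝ) ^ P.natDegree)⁻¹ := by
    intro B
    have hχ : IsDirichletChar (fun _ : F[X] => (1 : ℂ)) :=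
      ⟨fun _ _ => by simp, 1, one_ne_zero, fun _ _ _ => rfl, fun g => by simp [isCoprime_one_right]⟩
    obtain ⟨D, hD⟩ := exists_lt_sum_of_pretDist hpret hχ (ω := 1) (by simp) (2 * B)
    refine ⟨D, ?_⟩
    rw [sum_irredsLE, Finset.sum_range_succ', irreds_zero, Finset.sum_empty, add_zero]
    have : ∑ k ∈ Finset.range D, ((Fintype.card F : ℝ) ^ (k + 1))⁻¹ *
        ∑ P ∈ irreds F (k + 1), (1 - (ν P * 1 * 1 ^ (k + 1)).re) ≤
        2 * ∑ k ∈ Finset.range D, ∑ P ∈ irreds F (k + 1),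
          ((Fintype.card F : ℝ) ^ P.natDegree)⁻¹ := by
      rw [Finset.mul_sum]
      refine Finset.sum_le_sum fun k _ => ?_
      rw [Finset.mul_sum, Finset.mul_sum]
      refine Finset.sum_le_sum fun P hP => ?_
      rw [(mem_irreds.1 hP).2.2, mul_comm, mul_one, one_pow, mul_one]
      gcongr
      have := (abs_le.1 ((Complex.abs_re_le_norm (ν P)).trans (hνb P))).1
      linarith
    linarith
  rw [Metric.tendsto_atTop]
  intro ε hε
  set K : ℝ := 4 + 4 * (M + 1) with hK
  have hK0 : 0 < K := by positivity
  obtain ⟨D, hD⟩ := hW (max 1 (((1 + K) / ε) ^ 2))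
  set W := ∑ P ∈ irredsLE F D, ((Fintype.card F : ℝ) ^ P.natDegree)⁻¹ with hWdef
  have hW1 : 1 < W := (le_max_left _ _).trans_lt hD
  have hW2 : (1 + K) / ε < √W := by
    rw [Real.lt_sqrt (by positivity)]
    exact (le_max_right _ _).trans_lt hD
  obtain ⟨N, hN⟩ := eventually_atTop.1 (eventually_norm_bilinear_sum_le hνb hf hM D)
  refine ⟨max N (2 * D), fun n hn => ?_⟩
  have h1 := norm_sum_sub_sum_divisor_weight_le (ν := ν) (f := f) hνb hf (D := D) (n := n)
    ((le_max_right _ _).trans hn)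
  have h2 := norm_sum_sub_bilinear_sum_le hν hνb hf (D := D) (n := n) ((le_max_right _ _).trans hn)
  have h3 := hN n ((le_max_left _ _).trans hn)
  rw [← hWdef] at h1
  set A := ∑ g ∈ polysLT F n, ν g * f g
  set B := ∑ P ∈ irredsLE F D, ∑ h ∈ polysLT F (n - P.natDegree), ν (P * h) * f (P * h)
  set E := ∑ P ∈ irredsLE F D, ∑ h ∈ polysLT F (n - P.natDegree), ν P * ν h * f (P * h)
  have hqn : (0 : ℝ) < (Fintype.card F : ℝ) ^ n := by positivity
  have h4 : W * ‖A‖ ≤ (Fintype.card F : ℝ) ^ n * (√W + K) := by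
    have e : (W : ℂ) * A = ((W : ℂ) * A - B) + (B - E) + E := by ring
    have : W * ‖A‖ = ‖(W : ℂ) * A‖ := by
      rw [norm_mul, Complex.norm_real, Real.norm_of_nonneg (by linarith)]
    rw [this, e]
    refine (norm_add₃_le).trans ?_
    rw [hK]
    linarith
  rw [dist_zero_right, norm_div, norm_pow, Complex.norm_natCast, div_lt_iff₀ hqn]
  have hs1 : 1 ≤ √W := by rw [Real.one_le_sqrt]; exact hW1.le
  have hss : √W * √W = W := Real.mul_self_sqrt (by linarith)
  rw [div_lt_iff₀ hε] at hW2
  have h5 : √W + K < √W * √W * ε := by nlinarith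
  rw [hss] at h5
  have h6 : W * ‖A‖ < W * (ε * (Fintype.card F : ℝ) ^ n) := by
    refine h4.trans_lt ?_
    calc _ < (Fintype.card F : ℝ) ^ n * (W * ε) := by gcongr
      _ = _ := by ring
  exact lt_of_mul_lt_mul_left h6 (by linarith)

end KataiCriterion

section ValuationArgument
open scoped Classical

variable {F : Type*} [Field F] [Fintype F] {K : Type*} [Field K]

lemma valuation_map_C_le_one {Γ : Type*} [LinearOrderedCommGroupWithZero Γ] (v : Valuation K Γ)
    (φ : F[X] →+* K) (a : F) : v (φ (C a)) ≤ 1 := by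
  by_cases ha : a = 0
  · simp [ha]
  · by_contra! h
    have h1 : v (φ (C a)) ^ (Fintype.card F - 1) = 1 := by
      rw [← map_pow, ← map_pow, ← C_pow, FiniteField.pow_card_sub_one_eq_one a ha, map_one, map_one,
        map_one]
    have h2 : Fintype.card F - 1 ≠ 0 := by
      have := Fintype.one_lt_card (α := F); omega
    exact (one_lt_pow₀ h h2).ne' h1

lemma valuation_map_le_one {Γ : Type*} [LinearOrderedCommGroupWithZero Γ] (v : Valuation K Γ)
    (φ : F[X] →+* K) (hX : v (φ X) ≤ 1) (g : F[X]) : v (φ g) ≤ 1 := by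
  induction g using Polynomial.induction_on' with
  | add p q hp hq =>
    rw [map_add]
    exact (v.map_add _ _).trans (max_le hp hq)
  | monomial n a =>
    rw [← C_mul_X_pow_eq_monomial, map_mul, map_mul, map_pow, map_pow]
    exact mul_le_one' (valuation_map_C_le_one v φ a) (pow_le_one' hX n)

lemma valuation_map_monic {Γ : Type*} [LinearOrderedCommGroupWithZero Γ] (v : Valuation K Γ)
    (φ : F[X] →+* K) (hX : 1 < v (φ X)) {P : F[X]} (hP : P.Monic) :
    v (φ P) = v (φ X) ^ P.natDegree := by
  have h0 : v (φ X) ^ P.natDegree ≠ 0 := pow_ne_zero _ (zero_lt_one.trans hX).ne'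
  have hlt : v (φ (∑ i ∈ Finset.range P.natDegree, C (P.coeff i) * X ^ i)) <
      v (φ (X ^ P.natDegree)) := by
    rw [map_sum, map_pow, map_pow]
    refine v.map_sum_lt h0 fun i hi => ?_
    rw [Finset.mem_range] at hi
    rw [map_mul, map_mul, map_pow, map_pow]
    exact (mul_le_of_le_one_left' (valuation_map_C_le_one v φ _)).trans_lt
      (pow_lt_pow_right₀ hX hi)
  conv_lhs => rw [hP.as_sum]
  rw [map_add, v.map_add_eq_of_lt_left hlt, map_pow, map_pow]

/-- Over a field, the products `∏ k, φ k (P i)` cannot be independent of `i` when the number of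
distinct irreducible polynomials `P i` exceeds the number of homomorphisms. -/
theorem not_forall_prod_map_irreducible_eq {m : ℕ} (φ : Fin m → F[X] →+* K) (k₀ : Fin m)
    (hinj : Function.Injective (φ k₀)) {d : ℕ} (P : Fin (m + 1) → F[X])
    (hP : ∀ i, P i ∈ irreds F d) (hPinj : Function.Injective P)
    (hprod : ∀ i, ∏ k, φ k (P i) = ∏ k, φ k (P 0)) : False := by
  have hP' := fun i => mem_irreds.1 (hP i)
  set e : F[X] ≃+* (φ k₀).range := RingEquiv.ofBijective (φ k₀).rangeRestrict
    ⟨fun a b h => hinj (congrArg Subtype.val h), (φ k₀).rangeRestrict_surjective⟩ with he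
  set I : Ideal (φ k₀).range := (Ideal.span {P 0}).comap (e.symm : (φ k₀).range →+* F[X]) with hI
  have hItop : I ≠ ⊤ := by
    rw [Ideal.ne_top_iff_one, hI, Ideal.mem_comap, map_one, ← Ideal.ne_top_iff_one, Ne,
      Ideal.span_singleton_eq_top]
    exact (hP' 0).2.1.not_isUnit
  obtain ⟨B, hB1, hB2⟩ := Ideal.image_subset_nonunits_valuationSubring I hItop
  set v := B.valuation
  have hk₀ : ∀ g, v (φ k₀ g) ≤ 1 := fun g => (B.valuation_le_one_iff _).2 (hB1 ⟨g, rfl⟩)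
  have hk₀P : v (φ k₀ (P 0)) < 1 := by
    rw [← ValuationSubring.mem_nonunits_iff]
    refine hB2 ⟨e (P 0), ?_, rfl⟩
    rw [hI]
    simp
  obtain ⟨i, hi⟩ : ∃ i, ∀ k, v (φ k X) ≤ 1 → v (φ k (P i)) = 1 := by
    by_contra! hcon
    choose κ hκ1 hκ2 using hcon
    obtain ⟨i, j, hij, hκ⟩ := Fintype.exists_ne_map_eq_of_card_lt κ (by simp)
    have hlt : ∀ i, v (φ (κ i) (P i)) < 1 := fun i =>
      lt_of_le_of_ne (valuation_map_le_one v _ (hκ1 i) _) (hκ2 i)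
    have hcop : IsCoprime (P i) (P j) := by
      rw [(hP' i).2.1.coprime_iff_not_dvd]
      intro hdvd
      exact hij (hPinj (eq_of_monic_of_associated (hP' i).1 (hP' j).1
        ((hP' i).2.1.associated_of_dvd (hP' j).2.1 hdvd)))
    obtain ⟨a, b, hab⟩ := hcop
    have h1 : v (φ (κ i) (a * P i + b * P j)) < 1 := by
      rw [map_add, map_mul, map_mul]
      refine v.map_add_lt ?_ ?_
      · rw [map_mul]
        exact (mul_le_of_le_one_left' (valuation_map_le_one v _ (hκ1 i) _)).trans_lt (hlt i)
      · rw [map_mul]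
        refine (mul_le_of_le_one_left' (valuation_map_le_one v _ (hκ1 i) _)).trans_lt ?_
        rw [hκ]; exact hlt j
    rw [hab, map_one, map_one] at h1
    exact h1.false
  have hle : ∀ k, v (φ k (P 0)) ≤ v (φ k (P i)) ∧ v (φ k (P i)) ≠ 0 := by
    intro k
    by_cases hX : v (φ k X) ≤ 1
    · rw [hi k hX]
      exact ⟨valuation_map_le_one v _ hX _, one_ne_zero⟩
    · push Not at hX
      rw [valuation_map_monic v _ hX (hP' i).1, valuation_map_monic v _ hX (hP' 0).1,
        (hP' i).2.2, (hP' 0).2.2]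
      exact ⟨le_rfl, pow_ne_zero _ (zero_lt_one.trans hX).ne'⟩
  have heq := congrArg v (hprod i)
  rw [map_prod, map_prod, ← Finset.mul_prod_erase _ _ (Finset.mem_univ k₀),
    ← Finset.mul_prod_erase _ _ (Finset.mem_univ k₀), hi k₀ (hk₀ X), one_mul] at heq
  have h1 : ∏ k ∈ Finset.univ.erase k₀, v (φ k (P 0)) ≤ ∏ k ∈ Finset.univ.erase k₀, v (φ k (P i)) :=
    Finset.prod_le_prod' fun k _ => (hle k).1
  have h2 : 0 < ∏ k ∈ Finset.univ.erase k₀, v (φ k (P i)) :=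
    zero_lt_iff.2 (Finset.prod_ne_zero_iff.2 fun k _ => (hle k).2)
  have h3 : v (φ k₀ (P 0)) * ∏ k ∈ Finset.univ.erase k₀, v (φ k (P 0)) <
      ∏ k ∈ Finset.univ.erase k₀, v (φ k (P i)) := by
    refine (mul_le_mul_right h1 _).trans_lt ?_
    calc _ < 1 * ∏ k ∈ Finset.univ.erase k₀, v (φ k (P i)) := mul_lt_mul_of_pos_right hk₀P h2
      _ = _ := one_mul _
  exact (heq ▸ h3).false

theorem not_forall_prod_map_irreducible_sub_mem {R : Type*} [CommRing R] (I : Ideal R) {m : ℕ}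
    (ι : Fin m → F[X] →+* R) (k₀ : Fin m) (hI : ∀ f, f ≠ 0 → ι k₀ f ∉ I) {d : ℕ}
    (P : Fin (m + 1) → F[X]) (hP : ∀ i, P i ∈ irreds F d) (hPinj : Function.Injective P)
    (hprod : ∀ i, ∏ k, ι k (P i) - ∏ k, ι k (P 0) ∈ I) : False := by
  set S : Submonoid R := (nonZeroDivisors F[X]).map (ι k₀ : F[X] →* R) with hS
  have hdisj : Disjoint (I : Set R) S := by
    refine Set.disjoint_left.2 ?_
    rintro r hr ⟨f, hf, rfl⟩
    exact hI f (nonZeroDivisors.ne_zero hf) hr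
  obtain ⟨𝔭, h𝔭, hI𝔭, hd𝔭⟩ := Ideal.exists_le_prime_disjoint I S hdisj
  set φ : Fin m → F[X] →+* FractionRing (R ⧸ 𝔭) := fun k =>
    ((algebraMap (R ⧸ 𝔭) (FractionRing (R ⧸ 𝔭))).comp (Ideal.Quotient.mk 𝔭)).comp (ι k) with hφ
  have hφprod : ∀ Q, ∏ k, φ k Q = algebraMap (R ⧸ 𝔭) (FractionRing (R ⧸ 𝔭))
      (Ideal.Quotient.mk 𝔭 (∏ k, ι k Q)) := by
    intro Q
    rw [map_prod, map_prod]
    rfl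
  have hinj : Function.Injective (φ k₀) := by
    rw [injective_iff_map_eq_zero]
    intro f hf
    by_contra hne
    have h1 : Ideal.Quotient.mk 𝔭 (ι k₀ f) = 0 :=
      (IsFractionRing.injective (R ⧸ 𝔭) (FractionRing (R ⧸ 𝔭))) (by rw [map_zero]; exact hf)
    rw [Ideal.Quotient.eq_zero_iff_mem] at h1
    exact Set.disjoint_left.1 hd𝔭 h1 ⟨f, mem_nonZeroDivisors_of_ne_zero hne, rfl⟩
  refine not_forall_prod_map_irreducible_eq φ k₀ hinj P hP hPinj fun i => ?_
  rw [hφprod, hφprod]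
  congr 1
  rw [Ideal.Quotient.eq]
  exact hI𝔭 (hprod i)

end ValuationArgument

section TensorAction
open scoped Classical TensorProduct

variable {F : Type*} [Field F] [Fintype F] {A : Type*} [AddCommGroup A] {m : ℕ}

/-- Multiplying the `i`-th argument of a multilinear map by `f i`. -/
noncomputable def slotMul (f : Fin m → F[X]) (T : MultilinearMap ℤ (fun _ : Fin m => F[X]) A) :
    MultilinearMap ℤ (fun _ : Fin m => F[X]) A :=
  T.compLinearMap fun i => LinearMap.mulLeft ℤ (f i)

lemma slotMul_apply (f : Fin m → F[X]) (T : MultilinearMap ℤ (fun _ : Fin m => F[X]) A)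
    (x : Fin m → F[X]) : slotMul f T x = T (fun i => f i * x i) := rfl

/-- The action of the tensor algebra on multilinear maps by multiplying the arguments. -/
noncomputable def tensorAct (T : MultilinearMap ℤ (fun _ : Fin m => F[X]) A)
    (r : ⨂[ℤ] _ : Fin m, F[X]) : MultilinearMap ℤ (fun _ : Fin m => F[X]) A :=
  (PiTensorProduct.lift T ∘ₗ LinearMap.mulLeft ℤ r).compMultilinearMap (PiTensorProduct.tprod ℤ)

lemma tensorAct_apply (T : MultilinearMap ℤ (fun _ : Fin m => F[X]) A)
    (r : ⨂[ℤ] _ : Fin m, F[X]) (x : Fin m → F[X]) :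
    tensorAct T r x = PiTensorProduct.lift T (r * PiTensorProduct.tprod ℤ x) := rfl

lemma tensorAct_add (T : MultilinearMap ℤ (fun _ : Fin m => F[X]) A)
    (r s : ⨂[ℤ] _ : Fin m, F[X]) : tensorAct T (r + s) = tensorAct T r + tensorAct T s := by
  ext x
  simp only [tensorAct_apply, add_apply, add_mul, map_add]

lemma tensorAct_tprod_mul (T : MultilinearMap ℤ (fun _ : Fin m => F[X]) A) (f : Fin m → F[X])
    (r : ⨂[ℤ] _ : Fin m, F[X]) :
    tensorAct T (PiTensorProduct.tprod ℤ f * r) = slotMul f (tensorAct T r) := by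
  ext x
  rw [slotMul_apply, tensorAct_apply, tensorAct_apply]
  congr 1
  have : PiTensorProduct.tprod ℤ (fun i => f i * x i) =
      PiTensorProduct.tprod ℤ f * PiTensorProduct.tprod ℤ x :=
    (PiTensorProduct.tprod_mul_tprod (R := ℤ) f x).symm
  rw [this]
  ring

lemma tensorAct_one (T : MultilinearMap ℤ (fun _ : Fin m => F[X]) A) : tensorAct T 1 = T := by
  ext x
  rw [tensorAct_apply, one_mul, PiTensorProduct.lift.tprod]

lemma tensorAct_tprod (T : MultilinearMap ℤ (fun _ : Fin m => F[X]) A) (f : Fin m → F[X]) :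
    tensorAct T (PiTensorProduct.tprod ℤ f) = slotMul f T := by
  rw [← mul_one (PiTensorProduct.tprod ℤ f), tensorAct_tprod_mul, tensorAct_one]

/-- For a subgroup of multilinear maps stable under slotwise multiplication and torsion-free in the
slot `k₀`, a map outside it takes few irreducible dilates into a given coset. -/
theorem card_irreds_slotMul_sub_mem_le
    (B : AddSubgroup (MultilinearMap ℤ (fun _ : Fin m => F[X]) A))
    (hB : ∀ T ∈ B, ∀ f, slotMul f T ∈ B) (k₀ : Fin m)
    (htf : ∀ T, ∀ f : F[X], f ≠ 0 → slotMul (Function.update 1 k₀ f) T ∈ B → T ∈ B)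
    {T : MultilinearMap ℤ (fun _ : Fin m => F[X]) A} (hT : T ∉ B) (d : ℕ) {P : F[X]} :
    ((irreds F d).filter fun Q =>
      slotMul (fun _ => P) T - slotMul (fun _ => Q) T ∈ B).card ≤ m := by
  by_contra! hcard
  set I : Ideal (⨂[ℤ] _ : Fin m, F[X]) :=
    { carrier := {r | tensorAct T r ∈ B}
      add_mem' := fun {a b} ha hb => by
        simp only [Set.mem_ofPred_eq] at ha hb ⊢
        rw [tensorAct_add]; exact B.add_mem ha hb
      zero_mem' := by
        have : tensorAct T 0 = 0 := by ext x; simp [tensorAct_apply]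
        simp only [Set.mem_ofPred_eq]
        rw [this]; exact B.zero_mem
      smul_mem' := fun s r hr => by
        simp only [Set.mem_ofPred_eq, smul_eq_mul] at hr ⊢
        induction s using PiTensorProduct.induction_on with
        | smul_tprod n f =>
          have : tensorAct T (n • PiTensorProduct.tprod ℤ f * r) = n • slotMul f (tensorAct T r) := by
            rw [← tensorAct_tprod_mul]
            ext x
            rw [smul_apply, tensorAct_apply, tensorAct_apply, smul_mul_assoc, smul_mul_assoc,
              map_zsmul]
          rw [this]
          exact B.zsmul_mem (hB _ hr f) n
        | add a b ha hb =>
          rw [add_mul, tensorAct_add]; exact B.add_mem ha hb } with hI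
  have hmem : ∀ r, r ∈ I ↔ tensorAct T r ∈ B := fun r => Iff.rfl
  set ι : Fin m → F[X] →+* (⨂[ℤ] _ : Fin m, F[X]) := fun k =>
    (PiTensorProduct.singleAlgHom (R := ℤ) (A := fun _ : Fin m => F[X]) k : F[X] →+* _) with hι
  have hιapp : ∀ k f, ι k f = PiTensorProduct.tprod ℤ (Function.update 1 k f) := by
    intro k f
    rfl
  have hprod : ∀ Q, ∏ k, ι k Q = PiTensorProduct.tprod ℤ fun _ : Fin m => Q := by
    intro Q
    simp_rw [hιapp]
    rw [← PiTensorProduct.tprod_prod]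
    congr 1
    exact Finset.univ_prod_mulSingle fun _ => Q
  obtain ⟨U, hU, hUc⟩ := Finset.exists_subset_card_eq (Nat.succ_le_of_lt hcard)
  set e := U.equivFinOfCardEq hUc
  have key : ∀ Q ∈ U, tensorAct T (PiTensorProduct.tprod ℤ (fun _ => Q)) -
      tensorAct T (PiTensorProduct.tprod ℤ (fun _ => P)) ∈ B := by
    intro Q hQ
    have h1 := (Finset.mem_filter.1 (hU hQ)).2
    rw [← neg_sub, tensorAct_tprod, tensorAct_tprod]
    exact B.neg_mem h1
  refine not_forall_prod_map_irreducible_sub_mem I ι k₀ ?_ (d := d) (fun i => (e.symm i : F[X]))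
    (fun i => (Finset.mem_filter.1 (hU (e.symm i).2)).1)
    (Subtype.val_injective.comp e.symm.injective) fun i => ?_
  · intro f hf hmf
    refine hT (htf T f hf ?_)
    rw [← tensorAct_tprod, ← hιapp]
    exact hmf
  · rw [hprod, hprod, hmem]
    have h2 : ∀ r s, tensorAct T (r - s) = tensorAct T r - tensorAct T s := fun r s => by
      rw [eq_sub_iff_add_eq, ← tensorAct_add, sub_add_cancel]
    rw [h2, ← sub_sub_sub_cancel_right _ _ (tensorAct T (PiTensorProduct.tprod ℤ (fun _ => P)))]
    exact B.sub_mem (key _ (e.symm i).2) (key _ (e.symm 0).2)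

end TensorAction

section LeadingForm

variable {V A : Type*} [AddCommGroup V] [AddCommGroup A]

/-- The map `Q` is polynomial of degree at most `m`, and its `m`-fold derivative is the multilinear
form `T`. -/
def Lead : ∀ m : ℕ, MultilinearMap ℤ (fun _ : Fin m => V) A → (V → A) → Prop
  | 0, T, Q => ∀ g, Q g = T Fin.elim0
  | m + 1, T, Q => ∀ h, Lead m (T.curryLeft h) (Δop h Q)

lemma Lead.add {m : ℕ} {T T' : MultilinearMap ℤ (fun _ : Fin m => V) A} {Q Q' : V → A}
    (h : Lead m T Q) (h' : Lead m T' Q') : Lead m (T + T') (Q + Q') := by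
  induction m generalizing Q Q' with
  | zero =>
    intro g
    rw [Pi.add_apply, h g, h' g]; rfl
  | succ m ih =>
    intro u
    have e : Δop u (Q + Q') = Δop u Q + Δop u Q' := by
      ext g; simp only [Δop, Pi.add_apply]; abel
    rw [e]
    exact ih (h u) (h' u)

lemma Lead.neg {m : ℕ} {T : MultilinearMap ℤ (fun _ : Fin m => V) A} {Q : V → A}
    (h : Lead m T Q) : Lead m (-T) (-Q) := by
  induction m generalizing Q with
  | zero =>
    intro g
    rw [Pi.neg_apply, h g]; rfl
  | succ m ih =>
    intro u
    have e : Δop u (-Q) = -Δop u Q := by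
      ext g; simp only [Δop, Pi.neg_apply]; abel
    rw [e]
    exact ih (h u)

lemma Lead.sub {m : ℕ} {T T' : MultilinearMap ℤ (fun _ : Fin m => V) A} {Q Q' : V → A}
    (h : Lead m T Q) (h' : Lead m T' Q') : Lead m (T - T') (Q - Q') := by
  rw [sub_eq_add_neg, sub_eq_add_neg]
  exact h.add h'.neg

lemma Lead.zero (m : ℕ) : Lead m (0 : MultilinearMap ℤ (fun _ : Fin m => V) A) 0 := by
  induction m with
  | zero => intro g; rfl
  | succ m ih =>
    intro u
    have e : Δop u (0 : V → A) = 0 := by ext g; simp [Δop]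
    rw [e]
    exact ih

lemma Lead.nsmul {m : ℕ} {T : MultilinearMap ℤ (fun _ : Fin m => V) A} {Q : V → A}
    (h : Lead m T Q) (k : ℕ) : Lead m (k • T) (k • Q) := by
  induction k with
  | zero => rw [zero_smul, zero_smul]; exact Lead.zero m
  | succ k ih => rw [succ_nsmul, succ_nsmul]; exact ih.add h

lemma Lead.sum {ι : Type*} {m : ℕ} (s : Finset ι)
    {T : ι → MultilinearMap ℤ (fun _ : Fin m => V) A} {Q : ι → V → A}
    (h : ∀ i ∈ s, Lead m (T i) (Q i)) : Lead m (∑ i ∈ s, T i) (∑ i ∈ s, Q i) := by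
  classical
  induction s using Finset.induction_on with
  | empty => simpa using Lead.zero m
  | insert a s ha ih =>
    rw [Finset.sum_insert ha, Finset.sum_insert ha]
    exact (h a (Finset.mem_insert_self _ _)).add
      (ih fun i hi => h i (Finset.mem_insert_of_mem hi))

lemma Lead.unique {m : ℕ} {T T' : MultilinearMap ℤ (fun _ : Fin m => V) A} {Q : V → A}
    (h : Lead m T Q) (h' : Lead m T' Q) : T = T' := by
  induction m generalizing Q with
  | zero =>
    ext x
    rw [Subsingleton.elim x Fin.elim0, ← h 0, ← h' 0]
  | succ m ih =>
    ext x
    have := congrArg (fun S => S (Fin.tail x)) (ih (h (x 0)) (h' (x 0)))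
    simpa [MultilinearMap.curryLeft_apply, Fin.cons_self_tail] using this

lemma Lead.comp {m : ℕ} {T : MultilinearMap ℤ (fun _ : Fin m => V) A} {Q : V → A}
    (h : Lead m T Q) (L : V →ₗ[ℤ] V) : Lead m (T.compLinearMap fun _ => L) (fun g => Q (L g)) := by
  induction m generalizing Q with
  | zero =>
    intro g
    exact (h (L g)).trans (congrArg T (Subsingleton.elim _ _))
  | succ m ih =>
    intro u
    have e : Δop u (fun g => Q (L g)) = fun g => Δop (L u) Q (L g) := by
      ext g; simp only [Δop, map_add]
    have e2 : (T.compLinearMap fun _ => L).curryLeft u =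
        (T.curryLeft (L u)).compLinearMap fun _ => L := by
      ext x
      simp only [MultilinearMap.curryLeft_apply, MultilinearMap.compLinearMap_apply]
      congr 1
      ext i
      refine Fin.cases ?_ (fun j => ?_) i <;> simp
    rw [e, e2]
    exact ih (h (L u))

lemma Lead.exists {m : ℕ} {Q : V → A} (h : Lead (m + 1) 0 Q) :
    ∃ T : MultilinearMap ℤ (fun _ : Fin m => V) A, Lead m T Q := by
  induction m generalizing Q with
  | zero =>
    refine ⟨MultilinearMap.constOfIsEmpty ℤ _ (Q 0), fun g => ?_⟩
    have := h g 0
    simp only [Δop, zero_add] at this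
    rw [MultilinearMap.constOfIsEmpty_apply]
    exact sub_eq_zero.1 this
  | succ m ih =>
    choose T hT using fun u => ih (h u)
    have hadd : ∀ u w, T (u + w) = T u + T w := by
      intro u w
      have h1 : Lead m 0 (Δop w (Δop u Q)) := h u w
      have h2 := ((hT u).add (hT w)).add h1
      rw [add_zero] at h2
      refine (hT (u + w)).unique ?_
      have e : Δop (u + w) Q = Δop u Q + Δop w Q + Δop w (Δop u Q) := by
        ext g
        simp only [Δop, Pi.add_apply]
        rw [show g + w + u = g + (u + w) by abel]
        abel
      rw [e]
      exact h2
    refine ⟨LinearMap.uncurryLeft (M := fun _ : Fin (m + 1) => V)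
      (AddMonoidHom.mk' T hadd).toIntLinearMap, fun u => ?_⟩
    rw [LinearMap.curry_uncurryLeft]
    exact hT u

lemma lead_of_foldr {k : ℕ} {Q : V → A}
    (h : ∀ u : Fin k → V, ∀ g, (List.ofFn u).foldr Δop Q g = 0) : Lead k 0 Q := by
  induction k generalizing Q with
  | zero => exact fun g => by simpa using h Fin.elim0 g
  | succ k ih =>
    intro w
    refine ih fun u g => ?_
    have := h (Fin.snoc u w) g
    rw [List.ofFn_succ', List.concat_eq_append, List.foldr_append] at this
    simpa using this

lemma DegLE.lead {m : ℕ} {Q : V → A} (h : DegLE Q m) : Lead (m + 1) 0 Q := lead_of_foldr h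

lemma Lead.cons_cons_comm {m : ℕ} {T : MultilinearMap ℤ (fun _ : Fin (m + 2) => V) A} {Q : V → A}
    (h : Lead (m + 2) T Q) (u w : V) (x : Fin m → V) :
    T (Fin.cons u (Fin.cons w x : Fin (m + 1) → V)) =
      T (Fin.cons w (Fin.cons u x : Fin (m + 1) → V)) := by
  have h1 : Lead m ((T.curryLeft u).curryLeft w) (Δop w (Δop u Q)) := h u w
  have h2 : Lead m ((T.curryLeft w).curryLeft u) (Δop u (Δop w Q)) := h w u
  have e : Δop w (Δop u Q) = Δop u (Δop w Q) := by
    ext g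
    simp only [Δop]
    rw [add_right_comm g w u]
    abel
  rw [e] at h1
  exact congrArg (fun S => S x) (h1.unique h2)

lemma Lead.insertNth_eq_cons {m : ℕ} {T : MultilinearMap ℤ (fun _ : Fin (m + 1) => V) A} {Q : V → A}
    (h : Lead (m + 1) T Q) (i : Fin (m + 1)) (u : V) (x : Fin m → V) :
    T (i.insertNth (α := fun _ => V) u x) = T (Fin.cons u x) := by
  induction m generalizing Q with
  | zero =>
    rw [Fin.fin_one_eq_zero i, Fin.insertNth_zero']
  | succ m ih =>
    refine Fin.cases ?_ (fun j => ?_) i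
    · rw [Fin.insertNth_zero']
    · have e : (Fin.insertNth (α := fun _ => V) j.succ u x : Fin (m + 2) → V) =
          Fin.cons (x 0) (Fin.insertNth (α := fun _ => V) j u (Fin.tail x) : Fin (m + 1) → V) := by
        conv_lhs => rw [← Fin.cons_self_tail x]
        exact Fin.insertNth_succ_cons _ _ _ _
      rw [e]
      have h1 := ih (h (x 0)) j (Fin.tail x)
      simp only [MultilinearMap.curryLeft_apply] at h1
      rw [h1, h.cons_cons_comm]
      congr 2
      exact Fin.cons_self_tail x

lemma Lead.affine_diagonal {m : ℕ} {T : MultilinearMap ℤ (fun _ : Fin m => V) A} {Q : V → A}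
    (h : Lead m T Q) (a : Fin m → V) :
    Lead m (m.factorial • T) (fun g => T (fun i => g + a i)) := by
  induction m generalizing Q with
  | zero =>
    intro g
    rw [Nat.factorial_zero, one_smul]
    exact congrArg T (Subsingleton.elim _ _)
  | succ m ih =>
    intro u
    set w : ℕ → V → Fin (m + 1) → V := fun k g j => if (j : ℕ) < k then g + a j + u else g + a j
      with hw
    set b : Fin (m + 1) → Fin m → V := fun k j =>
      if (k.succAbove j : ℕ) < k then a (k.succAbove j) + u else a (k.succAbove j) with hb
    have e1 : ∀ g, ∀ k : Fin (m + 1), T (w (k + 1) g) - T (w k g) =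
        T.curryLeft u (fun j => g + b k j) := by
      intro g k
      have h1 : w (k + 1) g = Function.update (w k g) k (g + a k + u) := by
        ext j
        by_cases hjk : j = k
        · subst hjk; simp [hw]
        · have : (j : ℕ) ≠ k := fun h => hjk (Fin.ext h)
          simp only [hw, Function.update_of_ne hjk]
          by_cases hlt : (j : ℕ) < k
          · rw [if_pos hlt, if_pos (by omega)]
          · rw [if_neg hlt, if_neg (by omega)]
      have h2 : w k g = Function.update (w k g) k (g + a k) := by
        ext j
        by_cases hjk : j = k
        · subst hjk; simp [hw]
        · simp only [Function.update_of_ne hjk]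
      have h3 : T (w (k + 1) g) - T (w k g) = T (Function.update (w k g) k u) := by
        rw [h1, T.map_update_add]
        conv_lhs => rw [h2]
        simp
      rw [h3, ← Fin.insertNth_removeNth, h.insertNth_eq_cons, MultilinearMap.curryLeft_apply]
      congr 2
      ext j
      simp only [Fin.removeNth, hw, hb]
      split_ifs <;> abel
    have e2 : Δop u (fun g => T (fun i => g + a i)) =
        ∑ k : Fin (m + 1), fun g => T.curryLeft u (fun j => g + b k j) := by
      ext g
      rw [Finset.sum_apply]
      simp_rw [← e1]
      have := Finset.sum_range_sub (fun k => T (w k g)) (m + 1)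
      rw [Finset.sum_range] at this
      rw [this, Δop]
      congr 2
      ext j; simp only [hw]; rw [if_pos j.2]; abel
    have e3 : ((m + 1).factorial • T).curryLeft u =
        ∑ k : Fin (m + 1), m.factorial • T.curryLeft u := by
      rw [Finset.sum_const, Finset.card_univ, Fintype.card_fin, smul_smul, ← Nat.factorial_succ]
      rfl
    rw [e2, e3]
    exact Lead.sum _ fun k _ => ih (h u) (b k)

end LeadingForm

section Bias

open scoped BigOperators Classical
open Finset (expect_congr expect_comm expect_const mul_expect expect_mul expect_le_expect)

variable {V A : Type*} [AddCommGroup V] [AddCommGroup A] [Finite A]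

/-- The finite set `U` is an additive subgroup. -/
structure IsFinSubgroup {V : Type*} [AddCommGroup V] (U : Finset V) : Prop where
  zero_mem : 0 ∈ U
  add_mem : ∀ {a b}, a ∈ U → b ∈ U → a + b ∈ U
  neg_mem : ∀ {a}, a ∈ U → -a ∈ U

lemma IsFinSubgroup.nonempty {U : Finset V} (hU : IsFinSubgroup U) : U.Nonempty := ⟨0, hU.zero_mem⟩

lemma IsFinSubgroup.piFinset {m : ℕ} {U : Fin m → Finset V} (hU : ∀ i, IsFinSubgroup (U i)) :
    IsFinSubgroup (Fintype.piFinset U) where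
  zero_mem := Fintype.mem_piFinset.2 fun i => (hU i).zero_mem
  add_mem ha hb := Fintype.mem_piFinset.2 fun i =>
    (hU i).add_mem (Fintype.mem_piFinset.1 ha i) (Fintype.mem_piFinset.1 hb i)
  neg_mem ha := Fintype.mem_piFinset.2 fun i => (hU i).neg_mem (Fintype.mem_piFinset.1 ha i)

lemma IsFinSubgroup.expect_add_right {U : Finset V} (hU : IsFinSubgroup U) (f : V → ℂ) {a : V}
    (ha : a ∈ U) : U.expect (fun x => f (x + a)) = U.expect f :=
  Finset.expect_nbij' (· + a) (· + -a) (fun x hx => hU.add_mem hx ha)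
    (fun x hx => hU.add_mem hx (hU.neg_mem ha)) (fun x _ => by simp) (fun x _ => by simp)
    (fun x _ => rfl)

lemma IsFinSubgroup.expect_expect_add {U W : Finset V} (hU : U.Nonempty) (hW : IsFinSubgroup W)
    (hUW : U ⊆ W) (f : V → ℂ) :
    W.expect (fun z => U.expect fun x => f (x + z)) = W.expect f := by
  rw [expect_comm]
  have : ∀ x ∈ U, W.expect (fun z => f (x + z)) = W.expect f := by
    intro x hx
    rw [← hW.expect_add_right f (hUW hx)]
    exact expect_congr rfl fun z _ => by rw [add_comm]
  rw [expect_congr rfl this, expect_const hU]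

lemma IsFinSubgroup.expect_addChar {U : Finset V} (hU : IsFinSubgroup U) (α : AddChar A ℂ)
    (L : V →+ A) :
    U.expect (fun u => α (L u)) = if ∀ u ∈ U, α (L u) = 1 then 1 else 0 := by
  split_ifs with h
  · rw [expect_congr rfl h, expect_const hU.nonempty]
  · push Not at h
    obtain ⟨a, ha, h1⟩ := h
    have := hU.expect_add_right (fun u => α (L u)) ha
    simp only [map_add, AddChar.map_add_eq_mul, ← expect_mul] at this
    by_contra h0
    exact h1 (mul_left_cancel₀ h0 (by rw [this, mul_one]))

lemma expect_piFinset_succ {m : ℕ} (U : Fin (m + 1) → Finset V) (f : (Fin (m + 1) → V) → ℂ) :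
    (Fintype.piFinset U).expect f =
      (U 0).expect fun u => (Fintype.piFinset (Fin.tail U)).expect fun x => f (Fin.cons u x) := by
  rw [← Finset.expect_product' (U 0) (Fintype.piFinset (Fin.tail U)) fun u x => f (Fin.cons u x)]
  refine Finset.expect_nbij' (fun x => (x 0, Fin.tail x)) (fun p => Fin.cons p.1 p.2) ?_ ?_ ?_ ?_ ?_
  · intro x hx
    rw [Fintype.mem_piFinset] at hx
    exact Finset.mem_product.2 ⟨hx 0, Fintype.mem_piFinset.2 fun i => hx i.succ⟩
  · intro p hp
    obtain ⟨h0, h1⟩ := Finset.mem_product.1 hp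
    refine Fintype.mem_piFinset.2 fun i => Fin.cases ?_ (fun j => ?_) i
    · simpa using h0
    · simpa [Fin.tail] using Fintype.mem_piFinset.1 h1 j
  · intro x _; exact Fin.cons_self_tail x
  · intro p _; simp
  · intro x _; simp

/-- The average of `α ∘ T` over a box. -/
noncomputable def cbias (α : AddChar A ℂ) {m : ℕ} (U : Fin m → Finset V)
    (T : MultilinearMap ℤ (fun _ : Fin m => V) A) : ℂ :=
  (Fintype.piFinset U).expect fun x => α (T x)

lemma cbias_succ (α : AddChar A ℂ) {m : ℕ} (U : Fin (m + 1) → Finset V)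
    (T : MultilinearMap ℤ (fun _ : Fin (m + 1) => V) A) :
    cbias α U T = (U 0).expect fun u => cbias α (Fin.tail U) (T.curryLeft u) :=
  expect_piFinset_succ U _

variable {α : AddChar A ℂ}

lemma multilinear_cons_add {m : ℕ} (T : MultilinearMap ℤ (fun _ : Fin (m + 1) => V) A)
    (x : Fin m → V) (u v : V) :
    T (Fin.cons (u + v) x) = T (Fin.cons u x) + T (Fin.cons v x) := by
  simpa using T.cons_add x u v

/-- The additive map `u ↦ T (u, x)`. -/
def headHom {m : ℕ} (T : MultilinearMap ℤ (fun _ : Fin (m + 1) => V) A) (x : Fin m → V) : V →+ A :=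
  AddMonoidHom.mk' (fun u => T (Fin.cons u x)) (multilinear_cons_add T x)

/-- The event that all `α (T (u, x))` equal `1`. -/
noncomputable def headInd (α : AddChar A ℂ) {m : ℕ} (U : Finset V)
    (T : MultilinearMap ℤ (fun _ : Fin (m + 1) => V) A) (x : Fin m → V) : ℝ :=
  if ∀ u ∈ U, α (T (Fin.cons u x)) = 1 then 1 else 0

lemma headInd_nonneg {m : ℕ} (U : Finset V)
    (T : MultilinearMap ℤ (fun _ : Fin (m + 1) => V) A) (x : Fin m → V) : 0 ≤ headInd α U T x := by
  rw [headInd]; split_ifs <;> norm_num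

lemma headInd_antitone {m : ℕ} {U W : Finset V} (h : U ⊆ W)
    (T : MultilinearMap ℤ (fun _ : Fin (m + 1) => V) A) (x : Fin m → V) :
    headInd α W T x ≤ headInd α U T x := by
  rw [headInd, headInd]
  split_ifs with h1 h2
  · exact le_rfl
  · exact absurd (fun u hu => h1 u (h hu)) h2
  · exact zero_le_one
  · exact le_rfl

lemma expect_cons_eq_headInd {m : ℕ} {U : Finset V} (hU : IsFinSubgroup U)
    (T : MultilinearMap ℤ (fun _ : Fin (m + 1) => V) A) (x : Fin m → V) :
    U.expect (fun u => α (T (Fin.cons u x))) = (headInd α U T x : ℂ) := by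
  have := hU.expect_addChar α (headHom T x)
  rw [headInd]
  split_ifs with h
  · rw [Complex.ofReal_one]
    exact this.trans (if_pos h)
  · rw [Complex.ofReal_zero]
    exact this.trans (if_neg h)

lemma cbias_eq_expect_headInd {m : ℕ} {U : Fin (m + 1) → Finset V} (hU : ∀ i, IsFinSubgroup (U i))
    (T : MultilinearMap ℤ (fun _ : Fin (m + 1) => V) A) :
    cbias α U T = ((Fintype.piFinset (Fin.tail U)).expect fun x => headInd α (U 0) T x : ℝ) := by
  rw [cbias, expect_piFinset_succ, expect_comm, Complex.ofReal_expect]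
  exact expect_congr rfl fun x _ => expect_cons_eq_headInd (hU 0) T x

/-- The real part of the bias. -/
noncomputable def bias (α : AddChar A ℂ) {m : ℕ} (U : Fin m → Finset V)
    (T : MultilinearMap ℤ (fun _ : Fin m => V) A) : ℝ := (cbias α U T).re

lemma bias_eq_expect_headInd {m : ℕ} {U : Fin (m + 1) → Finset V} (hU : ∀ i, IsFinSubgroup (U i))
    (T : MultilinearMap ℤ (fun _ : Fin (m + 1) => V) A) :
    bias α U T = (Fintype.piFinset (Fin.tail U)).expect fun x => headInd α (U 0) T x := by
  rw [bias, cbias_eq_expect_headInd hU, Complex.ofReal_re]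

lemma cbias_eq_bias {m : ℕ} {U : Fin (m + 1) → Finset V} (hU : ∀ i, IsFinSubgroup (U i))
    (T : MultilinearMap ℤ (fun _ : Fin (m + 1) => V) A) : cbias α U T = (bias α U T : ℂ) := by
  rw [bias_eq_expect_headInd hU, cbias_eq_expect_headInd hU]

lemma bias_nonneg {m : ℕ} {U : Fin (m + 1) → Finset V} (hU : ∀ i, IsFinSubgroup (U i))
    (T : MultilinearMap ℤ (fun _ : Fin (m + 1) => V) A) : 0 ≤ bias α U T := by
  rw [bias_eq_expect_headInd hU]
  exact Finset.expect_nonneg fun x _ => headInd_nonneg _ T x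

lemma norm_cbias {m : ℕ} {U : Fin (m + 1) → Finset V} (hU : ∀ i, IsFinSubgroup (U i))
    (T : MultilinearMap ℤ (fun _ : Fin (m + 1) => V) A) : ‖cbias α U T‖ = bias α U T := by
  rw [cbias_eq_bias hU, Complex.norm_real, Real.norm_of_nonneg (bias_nonneg hU T)]

lemma norm_expect_mul_tail_le {m : ℕ} {U : Fin (m + 1) → Finset V} (hU : ∀ i, IsFinSubgroup (U i))
    (T : MultilinearMap ℤ (fun _ : Fin (m + 1) => V) A) {ψ : (Fin m → V) → ℂ} (hψ : ∀ x, ‖ψ x‖ ≤ 1) :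
    ‖(Fintype.piFinset U).expect fun x => α (T x) * ψ (Fin.tail x)‖ ≤ bias α U T := by
  rw [expect_piFinset_succ, expect_comm, bias_eq_expect_headInd hU]
  refine (RCLike.norm_expect_le (K := ℂ)).trans (expect_le_expect fun x _ => ?_)
  simp only [Fin.tail_cons, ← expect_mul]
  rw [expect_cons_eq_headInd (hU 0), norm_mul, Complex.norm_real,
    Real.norm_of_nonneg (headInd_nonneg _ _ _)]
  exact mul_le_of_le_one_right (headInd_nonneg _ _ _) (hψ x)

lemma isFinSubgroup_tail {m : ℕ} {U : Fin (m + 1) → Finset V} (hU : ∀ i, IsFinSubgroup (U i)) :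
    ∀ i, IsFinSubgroup (Fin.tail U i) := fun i => hU i.succ

lemma norm_expect_add_shift_le {m : ℕ} {U : Fin (m + 1) → Finset V} (hU : ∀ i, IsFinSubgroup (U i))
    (T T' : MultilinearMap ℤ (fun _ : Fin (m + 1) => V) A) (z : Fin (m + 1) → V) :
    ‖(Fintype.piFinset U).expect fun x => α (T x + T' (x + z))‖ ≤ bias α U (T + T') := by
  induction m with
  | zero =>
    have e : ∀ x : Fin (0 + 1) → V, α (T x + T' (x + z)) = α ((T + T') x) * α (T' z) := by
      intro x
      have h1 : x + z = Fin.cons (x 0 + z 0) Fin.elim0 := by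
        ext i; rw [Fin.fin_one_eq_zero i]; rfl
      have h2 : (Fin.cons (x 0) Fin.elim0 : Fin (0 + 1) → V) = x := by
        ext i; rw [Fin.fin_one_eq_zero i]; rfl
      have h3 : (Fin.cons (z 0) Fin.elim0 : Fin (0 + 1) → V) = z := by
        ext i; rw [Fin.fin_one_eq_zero i]; rfl
      rw [h1, multilinear_cons_add, h2, h3, ← AddChar.map_add_eq_mul, ← add_assoc]
      rfl
    rw [expect_congr rfl fun x _ => e x]
    exact norm_expect_mul_tail_le hU (T + T') (ψ := fun _ => α (T' z))
      fun _ => (AddChar.norm_apply α _).le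
  | succ m ih =>
    have h1 : ‖(Fintype.piFinset U).expect fun x => α (T x + T' (x + z))‖ ≤
        (U 0).expect fun u => bias α (Fin.tail U) (T.curryLeft u + T'.curryLeft (u + z 0)) := by
      rw [expect_piFinset_succ]
      refine (RCLike.norm_expect_le (K := ℂ)).trans (expect_le_expect fun u _ => ?_)
      refine le_trans (le_of_eq ?_)
        (ih (isFinSubgroup_tail hU) (T.curryLeft u) (T'.curryLeft (u + z 0)) (Fin.tail z))
      congr 1
      refine expect_congr rfl fun x _ => ?_
      rw [MultilinearMap.curryLeft_apply, MultilinearMap.curryLeft_apply]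
      congr 3
      ext i
      refine Fin.cases ?_ (fun j => ?_) i <;> simp [Fin.tail]
    refine h1.trans ?_
    have h2 : (((U 0).expect fun u =>
        bias α (Fin.tail U) (T.curryLeft u + T'.curryLeft (u + z 0)) : ℝ) : ℂ) =
        (Fintype.piFinset U).expect fun x => α ((T + T') x) * α (T' (Fin.cons (z 0) (Fin.tail x))) := by
      rw [Complex.ofReal_expect, expect_piFinset_succ]
      refine expect_congr rfl fun u _ => ?_
      rw [← cbias_eq_bias (isFinSubgroup_tail hU), cbias]
      refine expect_congr rfl fun x _ => ?_
      rw [← AddChar.map_add_eq_mul]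
      congr 1
      simp only [add_apply, MultilinearMap.curryLeft_apply, Fin.tail_cons, multilinear_cons_add]
      abel
    have h3 := norm_expect_mul_tail_le (α := α) hU (T + T')
      (ψ := fun x => α (T' (Fin.cons (z 0) x))) fun x => (AddChar.norm_apply α _).le
    rw [← h2, Complex.norm_real] at h3
    exact (le_abs_self _).trans h3

lemma norm_expect_shift_le {m : ℕ} {U : Fin (m + 1) → Finset V} (hU : ∀ i, IsFinSubgroup (U i))
    (T : MultilinearMap ℤ (fun _ : Fin (m + 1) => V) A) (z : Fin (m + 1) → V) :
    ‖(Fintype.piFinset U).expect fun x => α (T (x + z))‖ ≤ bias α U T := by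
  simpa using norm_expect_add_shift_le (α := α) hU 0 T z

lemma bias_antitone {m : ℕ} {U W : Fin (m + 1) → Finset V} (hU : ∀ i, IsFinSubgroup (U i))
    (hW : ∀ i, IsFinSubgroup (W i)) (hUW : ∀ i, U i ⊆ W i)
    (T : MultilinearMap ℤ (fun _ : Fin (m + 1) => V) A) : bias α W T ≤ bias α U T := by
  rw [← norm_cbias hW, cbias, ← (IsFinSubgroup.piFinset hW).expect_expect_add
    (IsFinSubgroup.piFinset hU).nonempty (Fintype.piFinset_subset _ _ hUW)]
  refine (RCLike.norm_expect_le (K := ℂ)).trans ?_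
  exact Finset.expect_le (IsFinSubgroup.piFinset hW).nonempty fun z _ => norm_expect_shift_le hU T z

lemma bias_mul_bias_le {m : ℕ} {U : Fin (m + 1) → Finset V} (hU : ∀ i, IsFinSubgroup (U i))
    (T T' : MultilinearMap ℤ (fun _ : Fin (m + 1) => V) A) :
    bias α U T * bias α U T' ≤ bias α U (T + T') := by
  have hP := IsFinSubgroup.piFinset hU
  rw [← norm_cbias hU T, ← norm_cbias hU T', ← norm_mul]
  have e : cbias α U T * cbias α U T' = (Fintype.piFinset U).expect fun z =>
      (Fintype.piFinset U).expect fun x => α (T x + T' (x + z)) := by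
    rw [cbias, expect_mul, expect_comm]
    refine expect_congr rfl fun x hx => ?_
    simp only [AddChar.map_add_eq_mul, ← mul_expect]
    congr 1
    rw [cbias, ← hP.expect_add_right _ hx]
    exact expect_congr rfl fun z _ => by rw [add_comm z x]
  rw [e]
  exact (RCLike.norm_expect_le (K := ℂ)).trans
    (Finset.expect_le hP.nonempty fun z _ => norm_expect_add_shift_le hU T T' z)

lemma bias_neg {m : ℕ} {U : Fin m → Finset V}
    (T : MultilinearMap ℤ (fun _ : Fin m => V) A) : bias α U (-T) = bias α U T := by
  rw [bias, bias, cbias, cbias, Complex.re_expect, Complex.re_expect]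
  refine expect_congr rfl fun x _ => ?_
  rw [neg_apply, AddChar.map_neg_eq_conj, Complex.conj_re]

lemma bias_zero {m : ℕ} {U : Fin m → Finset V} (hU : ∀ i, IsFinSubgroup (U i)) :
    bias α U (0 : MultilinearMap ℤ (fun _ : Fin m => V) A) = 1 := by
  rw [bias, cbias]
  simp [expect_const (IsFinSubgroup.piFinset hU).nonempty]

end Bias

section Approximation

open scoped BigOperators Classical ComplexConjugate
open Finset (expect_congr expect_comm expect_const mul_expect expect_mul expect_le_expect)

variable {V A : Type*} [AddCommGroup V] [AddCommGroup A] [Finite A] {α : AddChar A ℂ}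

/-- The average of `α ∘ T` over the translate of the box `U ^ m` by the diagonal point `g`. -/
noncomputable def localAvg (α : AddChar A ℂ) {m : ℕ} (U : Finset V)
    (T : MultilinearMap ℤ (fun _ : Fin m => V) A) (g : V) : ℂ :=
  (Fintype.piFinset fun _ : Fin m => U).expect fun a => α (T fun i => g + a i)

/-- The constants in the approximation of a bias by local averages. -/
def approxConst : ℕ → ℝ
  | 0 => 0
  | m + 1 => 1 + 2 * approxConst m

lemma approxConst_nonneg (m : ℕ) : 0 ≤ approxConst m := by
  induction m with
  | zero => exact le_rfl
  | succ m ih => rw [approxConst]; positivity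

lemma expect_piFinset_const_succ {m : ℕ} (U : Finset V) (f : (Fin (m + 1) → V) → ℂ) :
    (Fintype.piFinset fun _ => U).expect f =
      (Fintype.piFinset fun _ : Fin m => U).expect fun x => U.expect fun u => f (Fin.cons u x) :=
  (expect_piFinset_succ (fun _ => U) f).trans (expect_comm _ _ _)

lemma cbias_const_succ {m : ℕ} (U : Finset V)
    (T : MultilinearMap ℤ (fun _ : Fin (m + 1) => V) A) :
    cbias α (fun _ => U) T = U.expect fun u => cbias α (fun _ => U) (T.curryLeft u) :=
  cbias_succ α _ T

lemma cons_add_diagonal {m : ℕ} (g u : V) (a : Fin m → V) :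
    (fun i : Fin (m + 1) => g + (Fin.cons u a : Fin (m + 1) → V) i) =
      Fin.cons (g + u) fun i => g + a i := by
  ext i
  refine Fin.cases ?_ (fun j => ?_) i <;> simp

lemma expect_localAvg_sub_le {U W : Finset V} (hU : IsFinSubgroup U) (hW : IsFinSubgroup W)
    (hUW : U ⊆ W) {m : ℕ} (T : MultilinearMap ℤ (fun _ : Fin m => V) A) :
    W.expect (fun g => ‖localAvg α U T g - cbias α (fun _ => W) T‖) ≤
      approxConst m * (bias α (fun _ => U) T - bias α (fun _ => W) T) := by
  induction m with
  | zero =>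
    have : ∀ g, ‖localAvg α U T g - cbias α (fun _ => W) T‖ = 0 := by
      intro g
      have h1 : ∀ x, T x = T Fin.elim0 := fun x => congrArg T (Subsingleton.elim _ _)
      rw [localAvg, cbias]
      simp only [h1 fun i => g + _, h1]
      rw [expect_const (IsFinSubgroup.piFinset fun _ => hU).nonempty,
        expect_const (IsFinSubgroup.piFinset fun _ => hW).nonempty, sub_self, norm_zero]
    simp [this, approxConst]
  | succ m ih =>
    set Pm := Fintype.piFinset fun _ : Fin m => U with hPm
    have hP : IsFinSubgroup Pm := IsFinSubgroup.piFinset fun _ => hU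
    set X : V → ℝ := fun g => Pm.expect fun a => headInd α U T fun i => g + a i with hX
    set Y : V → ℝ := fun g => Pm.expect fun a => headInd α W T fun i => g + a i with hY
    set bU := bias α (fun _ => U) T with hbU
    set bW := bias α (fun _ => W) T with hbW
    have h1 : ∀ g ∈ W, ‖localAvg α U T g - Y g‖ ≤ X g - Y g := by
      intro g hg
      have e1 : localAvg α U T g - Y g = Pm.expect fun a => α (T (Fin.cons g fun i => g + a i)) *
          ((headInd α U T (fun i => g + a i) : ℂ) - headInd α W T fun i => g + a i) := by
        rw [localAvg, expect_piFinset_const_succ, hY, Complex.ofReal_expect,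
          ← Finset.expect_sub_distrib]
        refine expect_congr rfl fun a _ => ?_
        simp only [cons_add_diagonal, multilinear_cons_add, AddChar.map_add_eq_mul, ← mul_expect]
        rw [expect_cons_eq_headInd hU, mul_sub]
        congr 1
        rw [headInd]
        split_ifs with h
        · rw [h g hg, one_mul]
        · rw [Complex.ofReal_zero, mul_zero]
      rw [e1, hX, hY, ← Finset.expect_sub_distrib]
      refine (RCLike.norm_expect_le (K := ℂ)).trans (expect_le_expect fun a _ => ?_)
      rw [norm_mul, AddChar.norm_apply, one_mul, ← Complex.ofReal_sub, Complex.norm_real,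
        Real.norm_of_nonneg (sub_nonneg.2 (headInd_antitone hUW _ _))]
    have h2 : ∀ g, X g ≤ bU := by
      intro g
      refine le_trans ?_ (norm_expect_shift_le (fun _ => hU) T (Fin.cons 0 fun _ => g))
      have e1 : ((X g : ℝ) : ℂ) = (Fintype.piFinset fun _ : Fin (m + 1) => U).expect fun x =>
          α (T (x + Fin.cons 0 fun _ => g)) := by
        rw [expect_piFinset_const_succ, hX, Complex.ofReal_expect]
        refine expect_congr rfl fun a _ => ?_
        rw [← expect_cons_eq_headInd hU]
        refine expect_congr rfl fun u _ => ?_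
        congr 2
        ext i
        refine Fin.cases ?_ (fun j => ?_) i <;> simp [add_comm]
      rw [← e1, Complex.norm_real]
      exact le_abs_self _
    have h3 : ∀ g, ((Y g : ℝ) : ℂ) = W.expect fun c => localAvg α U (T.curryLeft c) g := by
      intro g
      simp only [localAvg]
      rw [expect_comm, hY, Complex.ofReal_expect]
      exact expect_congr rfl fun a _ => (expect_cons_eq_headInd hW _ _).symm
    have h4 : W.expect (fun g => |Y g - bW|) ≤ approxConst m * (bU - bW) := by
      have e1 : ∀ g, |Y g - bW| ≤ W.expect fun c =>
          ‖localAvg α U (T.curryLeft c) g - cbias α (fun _ => W) (T.curryLeft c)‖ := by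
        intro g
        refine le_trans (le_of_eq ?_) (RCLike.norm_expect_le (K := ℂ))
        rw [Finset.expect_sub_distrib, ← h3, ← cbias_const_succ W T,
          cbias_eq_bias fun _ => hW, ← Complex.ofReal_sub, Complex.norm_real, Real.norm_eq_abs]
      refine (expect_le_expect fun g _ => e1 g).trans ?_
      rw [expect_comm]
      refine (expect_le_expect fun c _ => ih (T.curryLeft c)).trans ?_
      rw [← mul_expect, Finset.expect_sub_distrib]
      refine mul_le_mul_of_nonneg_left ?_ (approxConst_nonneg m)
      have e2 : W.expect (fun c => bias α (fun _ => W) (T.curryLeft c)) = bW := by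
        rw [hbW, bias, cbias_succ, Complex.re_expect]; rfl
      have e3 : W.expect (fun c => bias α (fun _ => U) (T.curryLeft c)) =
          bias α (Fin.cons W fun _ => U) T := by
        rw [bias, cbias_succ, Complex.re_expect]; rfl
      rw [e2, e3]
      refine sub_le_sub_right (bias_antitone (fun _ => hU) ?_ ?_ T) _
      · refine fun i => Fin.cases ?_ (fun j => ?_) i
        · simpa using hW
        · simpa using hU
      · refine fun i => Fin.cases ?_ (fun j => ?_) i
        · simpa using hUW
        · simp
    have h5 : ∀ g ∈ W, ‖localAvg α U T g - cbias α (fun _ => W) T‖ ≤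
        (bU - bW) + 2 * |Y g - bW| := by
      intro g hg
      have e1 : localAvg α U T g - cbias α (fun _ => W) T =
          (localAvg α U T g - Y g) + ((Y g - bW : ℝ) : ℂ) := by
        rw [cbias_eq_bias fun _ => hW]; push_cast; ring
      rw [e1]
      refine (norm_add_le _ _).trans ?_
      rw [Complex.norm_real, Real.norm_eq_abs]
      have := h1 g hg
      have := h2 g
      have := neg_abs_le (Y g - bW)
      linarith
    refine (expect_le_expect h5).trans ?_
    rw [Finset.expect_add_distrib, expect_const hW.nonempty, ← mul_expect, approxConst]
    linarith

lemma expect_pow_le {ι : Type*} {s : Finset ι} (hs : s.Nonempty) {z : ι → ℝ} (hz : ∀ i ∈ s, 0 ≤ z i)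
    (n : ℕ) : (s.expect z) ^ n ≤ s.expect fun i => z i ^ n := by
  have hc : (s.card : ℝ) ≠ 0 := by exact_mod_cast hs.card_pos.ne'
  have := Real.pow_arith_mean_le_arith_mean_pow s (fun _ => (s.card : ℝ)⁻¹) z
    (fun _ _ => by positivity) (by simp [hc]) hz n
  simpa [Finset.expect_eq_sum_div_card, ← Finset.mul_sum, div_eq_inv_mul] using this

lemma conj_expect_complex {ι : Type*} (s : Finset ι) (f : ι → ℂ) :
    conj (s.expect f) = s.expect fun i => conj (f i) := by
  rw [Finset.expect_eq_sum_div_card, Finset.expect_eq_sum_div_card, map_div₀, map_sum, map_natCast]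

/-- Repeated Cauchy–Schwarz: a phase polynomial is controlled by the bias of its leading form. -/
lemma Lead.norm_expect_pow_le {U : Finset V} (hU : IsFinSubgroup U) {m : ℕ}
    {T : MultilinearMap ℤ (fun _ : Fin (m + 1) => V) A} {Q : V → A} (h : Lead (m + 1) T Q) :
    ‖U.expect fun g => α (Q g)‖ ^ 2 ^ m ≤ bias α (fun _ => U) T := by
  induction m generalizing Q with
  | zero =>
    have e1 : ∀ g, α (Q g) = α (Q 0) * α (T.curryLeft g Fin.elim0) := by
      intro g
      have := h g 0
      rw [Δop, zero_add] at this
      rw [← this, ← AddChar.map_add_eq_mul]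
      congr 1; abel
    rw [pow_zero, pow_one, ← norm_cbias fun _ => hU, cbias_succ, expect_congr rfl fun g _ => e1 g,
      ← mul_expect, norm_mul, AddChar.norm_apply, one_mul]
    refine le_of_eq (congrArg _ (expect_congr rfl fun g _ => ?_))
    rw [cbias]
    have h1 : ∀ x, T.curryLeft g x = T.curryLeft g Fin.elim0 :=
      fun x => congrArg _ (Subsingleton.elim _ _)
    simp only [h1]
    rw [expect_const]
    exact (IsFinSubgroup.piFinset fun i => hU).nonempty
  | succ m ih =>
    have e1 : ‖U.expect fun g => α (Q g)‖ ^ 2 ≤ U.expect fun u => ‖U.expect fun g => α (Δop u Q g)‖ := by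
      refine le_trans (le_of_eq ?_) (RCLike.norm_expect_le (K := ℂ))
      have e2 : (U.expect fun u => U.expect fun g => α (Δop u Q g)) =
          (U.expect fun g => α (Q g)) * conj (U.expect fun g => α (Q g)) := by
        rw [expect_comm, conj_expect_complex, mul_expect]
        refine expect_congr rfl fun g hg => ?_
        rw [← hU.expect_add_right (fun g => α (Q g)) hg, expect_mul]
        refine expect_congr rfl fun u _ => ?_
        rw [Δop, sub_eq_add_neg, AddChar.map_add_eq_mul, AddChar.map_neg_eq_conj, add_comm g u]
      rw [e2, norm_mul, RCLike.norm_conj, sq]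
    calc ‖U.expect fun g => α (Q g)‖ ^ 2 ^ (m + 1)
        = (‖U.expect fun g => α (Q g)‖ ^ 2) ^ 2 ^ m := by rw [← pow_mul, pow_succ' 2 m]
      _ ≤ (U.expect fun u => ‖U.expect fun g => α (Δop u Q g)‖) ^ 2 ^ m := by gcongr
      _ ≤ U.expect fun u => ‖U.expect fun g => α (Δop u Q g)‖ ^ 2 ^ m :=
          expect_pow_le hU.nonempty (fun _ _ => norm_nonneg _) _
      _ ≤ U.expect fun u => bias α (fun _ => U) (T.curryLeft u) :=
          expect_le_expect fun u _ => ih (h u)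
      _ = bias α (fun _ => U) T := by rw [bias, cbias_succ, Complex.re_expect]; rfl

end Approximation

section BiasedForms

open scoped BigOperators Classical
open Topology
open Finset (expect_congr expect_comm expect_const mul_expect expect_mul expect_le_expect)

variable {F : Type*} [Field F] [Fintype F] {A : Type*} [AddCommGroup A] [Finite A]
  {α : AddChar A ℂ}

lemma isFinSubgroup_polysLT (n : ℕ) : IsFinSubgroup (polysLT F n) where
  zero_mem := mem_polysLT.2 (by rw [degree_zero]; exact WithBot.bot_lt_coe n)
  add_mem ha hb := mem_polysLT.2
    ((degree_add_le _ _).trans_lt (max_lt (mem_polysLT.1 ha) (mem_polysLT.1 hb)))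
  neg_mem ha := mem_polysLT.2 (by rw [degree_neg]; exact mem_polysLT.1 ha)

lemma polysLT_mono {n k : ℕ} (h : n ≤ k) : polysLT F n ⊆ polysLT F k := fun g hg =>
  mem_polysLT.2 ((mem_polysLT.1 hg).trans_le (by exact_mod_cast h))

lemma image_mul_polysLT_subset {f : F[X]} {d : ℕ} (hd : f.natDegree ≤ d) (n : ℕ) :
    (polysLT F n).image (f * ·) ⊆ polysLT F (n + d) := by
  intro g hg
  obtain ⟨h, hh, rfl⟩ := Finset.mem_image.1 hg
  rw [mem_polysLT] at hh ⊢
  by_cases hf : f = 0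
  · simp only [hf, zero_mul, degree_zero]; exact WithBot.bot_lt_coe _
  by_cases h0 : h = 0
  · simp only [h0, mul_zero, degree_zero]; exact WithBot.bot_lt_coe _
  rw [← natDegree_lt_iff_degree_lt h0] at hh
  rw [← natDegree_lt_iff_degree_lt (mul_ne_zero hf h0), natDegree_mul hf h0]
  omega

lemma IsFinSubgroup.image_mul {U : Finset F[X]} (hU : IsFinSubgroup U) (f : F[X]) :
    IsFinSubgroup (U.image (f * ·)) where
  zero_mem := Finset.mem_image.2 ⟨0, hU.zero_mem, mul_zero f⟩
  add_mem ha hb := by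
    obtain ⟨a, ha', rfl⟩ := Finset.mem_image.1 ha
    obtain ⟨b, hb', rfl⟩ := Finset.mem_image.1 hb
    exact Finset.mem_image.2 ⟨a + b, hU.add_mem ha' hb', mul_add _ _ _⟩
  neg_mem ha := by
    obtain ⟨a, ha', rfl⟩ := Finset.mem_image.1 ha
    exact Finset.mem_image.2 ⟨-a, hU.neg_mem ha', mul_neg _ _⟩

lemma bias_slotMul {m : ℕ} {f : Fin m → F[X]} (hf : ∀ i, f i ≠ 0) (U : Fin m → Finset F[X])
    (T : MultilinearMap ℤ (fun _ : Fin m => F[X]) A) :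
    bias α U (slotMul f T) = bias α (fun i => (U i).image (f i * ·)) T := by
  rw [bias, bias, cbias, cbias]
  congr 1
  refine Finset.expect_nbij (fun x i => f i * x i) ?_ ?_ ?_ ?_
  · intro x hx
    exact Fintype.mem_piFinset.2 fun i =>
      Finset.mem_image.2 ⟨x i, Fintype.mem_piFinset.1 hx i, rfl⟩
  · intro x _; rfl
  · intro x _ y _ hxy
    ext1 i
    exact mul_left_cancel₀ (hf i) (congrFun hxy i)
  · intro y hy
    have hy' := fun i => Finset.mem_image.1 (Fintype.mem_piFinset.1 (Finset.mem_coe.1 hy) i)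
    choose x hx hxy using hy'
    exact ⟨x, Finset.mem_coe.2 (Fintype.mem_piFinset.2 hx), funext hxy⟩

variable (F α) in
/-- The forms whose bias on polynomials of bounded degree stays bounded below. -/
def biasedForms (m : ℕ) : AddSubgroup (MultilinearMap ℤ (fun _ : Fin (m + 1) => F[X]) A) where
  carrier := {T | ∃ c > 0, ∀ n, c ≤ bias α (fun _ => polysLT F n) T}
  zero_mem' := ⟨1, one_pos, fun n => (bias_zero fun _ => isFinSubgroup_polysLT n).ge⟩
  add_mem' := by
    rintro T T' ⟨c, hc, h⟩ ⟨c', hc', h'⟩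
    exact ⟨c * c', mul_pos hc hc', fun n => (mul_le_mul (h n) (h' n) hc'.le
      (hc.le.trans (h n))).trans (bias_mul_bias_le (fun _ => isFinSubgroup_polysLT n) T T')⟩
  neg_mem' := by
    rintro T ⟨c, hc, h⟩
    exact ⟨c, hc, fun n => (h n).trans (bias_neg T).ge⟩

lemma mem_biasedForms {m : ℕ} {T : MultilinearMap ℤ (fun _ : Fin (m + 1) => F[X]) A} :
    T ∈ biasedForms F α m ↔ ∃ c > 0, ∀ n, c ≤ bias α (fun _ => polysLT F n) T := Iff.rfl

lemma slotMul_mem_biasedForms {m : ℕ} {T : MultilinearMap ℤ (fun _ : Fin (m + 1) => F[X]) A}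
    (hT : T ∈ biasedForms F α m) (f : Fin (m + 1) → F[X]) : slotMul f T ∈ biasedForms F α m := by
  by_cases hf : ∀ i, f i ≠ 0
  · obtain ⟨c, hc, h⟩ := hT
    refine ⟨c, hc, fun n => ?_⟩
    rw [bias_slotMul hf]
    refine (h (n + ∑ i, (f i).natDegree)).trans (bias_antitone
      (fun i => (isFinSubgroup_polysLT n).image_mul (f i)) (fun _ => isFinSubgroup_polysLT _)
      (fun i => image_mul_polysLT_subset ?_ n) T)
    exact Finset.single_le_sum (f := fun i => (f i).natDegree) (fun _ _ => Nat.zero_le _)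
      (Finset.mem_univ i)
  · push Not at hf
    obtain ⟨i, hi⟩ := hf
    have : slotMul f T = 0 := by
      ext x
      rw [slotMul_apply]
      exact T.map_coord_zero i (by simp [hi])
    rw [this]
    exact zero_mem _

lemma expect_subset_le {ι : Type*} {s t : Finset ι} (hst : s ⊆ t) {z : ι → ℝ} (hz : ∀ i, 0 ≤ z i)
    {c : ℝ} (hc : c * t.card ≤ s.card) (ht : t.Nonempty) (hs : s.Nonempty) :
    c * s.expect z ≤ t.expect z := by
  have h1 : (0 : ℝ) < t.card := by exact_mod_cast ht.card_pos
  have h2 : (0 : ℝ) < s.card := by exact_mod_cast hs.card_pos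
  rw [Finset.expect_eq_sum_div_card, Finset.expect_eq_sum_div_card, le_div_iff₀ h1]
  have h3 : 0 ≤ ∑ i ∈ s, z i := Finset.sum_nonneg fun i _ => hz i
  calc c * ((∑ i ∈ s, z i) / s.card) * t.card = (∑ i ∈ s, z i) * (c * t.card / s.card) := by ring
    _ ≤ (∑ i ∈ s, z i) * 1 := mul_le_mul_of_nonneg_left ((div_le_one h2).2 hc) h3
    _ ≤ ∑ i ∈ t, z i := by
      rw [mul_one]; exact Finset.sum_le_sum_of_subset_of_nonneg hst fun i _ _ => hz i

lemma mem_biasedForms_of_slotMul_mem {m : ℕ}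
    {T : MultilinearMap ℤ (fun _ : Fin (m + 2) => F[X]) A} {f : F[X]} (hf : f ≠ 0)
    (hT : slotMul (Function.update 1 0 f) T ∈ biasedForms F α (m + 1)) :
    T ∈ biasedForms F α (m + 1) := by
  obtain ⟨c, hc, h⟩ := hT
  have hq : (0 : ℝ) < Fintype.card F := by exact_mod_cast Fintype.card_pos
  set d := f.natDegree
  refine ⟨((Fintype.card F : ℝ) ^ d)⁻¹ * c, by positivity, fun n => ?_⟩
  refine le_trans ?_ (bias_antitone (fun _ => isFinSubgroup_polysLT n)
    (fun _ => isFinSubgroup_polysLT (n + d)) (fun _ => polysLT_mono (Nat.le_add_right n d)) T)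
  have hne : ∀ i, (Function.update 1 0 f : Fin (m + 2) → F[X]) i ≠ 0 := by
    intro i
    refine Fin.cases ?_ (fun j => ?_) i
    · simpa using hf
    · simp
  set W : Fin (m + 1) → Finset F[X] := fun _ => polysLT F (n + d) with hW
  have hWs : ∀ i, IsFinSubgroup (W i) := fun _ => isFinSubgroup_polysLT _
  have h1 : bias α (fun _ => polysLT F (n + d)) T =
      (polysLT F (n + d)).expect fun u => bias α W (T.curryLeft u) := by
    rw [bias, cbias_succ, Complex.re_expect]; rfl
  have h2 : c ≤ ((polysLT F n).image (f * ·)).expect fun u => bias α W (T.curryLeft u) := by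
    have e1 : bias α (Fin.cons (polysLT F n) W) (slotMul (Function.update 1 0 f) T) =
        ((polysLT F n).image (f * ·)).expect fun u => bias α W (T.curryLeft u) := by
      rw [bias_slotMul hne, bias, cbias_succ, Complex.re_expect]
      refine expect_congr (by simp) fun u _ => ?_
      rw [bias]
      congr 2
      ext i : 1
      simp [Fin.tail, hW]
    rw [← e1]
    refine (h (n + d)).trans (bias_antitone ?_ (fun _ => isFinSubgroup_polysLT _) ?_ _)
    · refine fun i => Fin.cases ?_ (fun j => ?_) i
      · simpa using isFinSubgroup_polysLT n
      · simpa using hWs j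
    · refine fun i => Fin.cases ?_ (fun j => ?_) i
      · simpa using polysLT_mono (Nat.le_add_right n d)
      · simp [hW]
  rw [h1]
  refine (mul_le_mul_of_nonneg_left h2 (by positivity)).trans
    (expect_subset_le (image_mul_polysLT_subset le_rfl n) (fun u => bias_nonneg hWs _) ?_
      (isFinSubgroup_polysLT _).nonempty ((isFinSubgroup_polysLT n).image_mul f).nonempty)
  rw [Finset.card_image_of_injective _ (mul_right_injective₀ hf), card_polysLT, card_polysLT]
  push_cast
  rw [pow_add]
  apply le_of_eq
  field_simp
  rfl

lemma bias_polysLT_antitone {m : ℕ} (T : MultilinearMap ℤ (fun _ : Fin (m + 1) => F[X]) A) :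
    Antitone fun n => bias α (fun _ => polysLT F n) T := fun n k h =>
  bias_antitone (fun _ => isFinSubgroup_polysLT n) (fun _ => isFinSubgroup_polysLT k)
    (fun _ => polysLT_mono h) T

lemma tendsto_bias_of_notMem {m : ℕ} {T : MultilinearMap ℤ (fun _ : Fin (m + 1) => F[X]) A}
    (hT : T ∉ biasedForms F α m) :
    Tendsto (fun n => bias α (fun _ => polysLT F n) T) atTop (𝓝 0) := by
  rw [Metric.tendsto_atTop]
  intro ε hε
  rw [mem_biasedForms] at hT
  push Not at hT
  obtain ⟨n, hn⟩ := hT ε hε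
  refine ⟨n, fun k hk => ?_⟩
  rw [Real.dist_eq, sub_zero, abs_of_nonneg (bias_nonneg (fun _ => isFinSubgroup_polysLT k) T)]
  exact (bias_polysLT_antitone T hk).trans_lt hn

lemma Lead.tendsto_expect_of_notMem {m : ℕ}
    {T : MultilinearMap ℤ (fun _ : Fin (m + 1) => F[X]) A} {Q : F[X] → A}
    (h : Lead (m + 1) T Q) (hT : T ∉ biasedForms F α m) :
    Tendsto (fun n => (polysLT F n).expect fun g => α (Q g)) atTop (𝓝 0) := by
  rw [tendsto_zero_iff_norm_tendsto_zero]
  have h1 : Tendsto (fun n => ‖(polysLT F n).expect fun g => α (Q g)‖ ^ 2 ^ m) atTop (𝓝 0) :=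
    squeeze_zero (fun n => by positivity)
      (fun n => h.norm_expect_pow_le (isFinSubgroup_polysLT n)) (tendsto_bias_of_notMem hT)
  rw [Metric.tendsto_atTop] at h1 ⊢
  intro ε hε
  obtain ⟨N, hN⟩ := h1 (ε ^ 2 ^ m) (by positivity)
  refine ⟨N, fun n hn => ?_⟩
  have := hN n hn
  rw [Real.dist_eq, sub_zero, abs_of_nonneg (by positivity)] at this ⊢
  exact lt_of_pow_lt_pow_left₀ _ hε.le this

end BiasedForms

section PolynomialPhases

open scoped BigOperators Classical
open Topology ComplexConjugate
open Finset (expect_congr expect_comm expect_const mul_expect expect_mul expect_le_expect)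

variable {F : Type*} [Field F] [Fintype F] {α : AddChar F ℂ} {ν : F[X] → ℂ}

lemma expect_polysLT (n : ℕ) (f : F[X] → ℂ) :
    (polysLT F n).expect f = (∑ g ∈ polysLT F n, f g) / (Fintype.card F : ℂ) ^ n := by
  rw [Finset.expect_eq_sum_div_card, card_polysLT]
  push_cast
  rfl

lemma Lead.tendsto_of_correlations {m : ℕ}
    {T : MultilinearMap ℤ (fun _ : Fin (m + 1) => F[X]) F} {Q : F[X] → F}
    (h : Lead (m + 1) T Q) (hν : IsMultFn ν) (hνb : ∀ g, ‖ν g‖ ≤ 1)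
    (hpret : ∀ χ ξ : Polynomial F → ℂ, ∀ θ : ℝ,
      IsDirichletChar χ → IsShortIntervalChar ξ → θ ∈ Set.Ico (0 : ℝ) 1 →
      Tendsto (fun N : ℕ => pretDist ν (fun g => χ g * ξ g * eTheta θ g) N) atTop atTop)
    {M : ℕ}
    (hM : ∀ d, ∀ P ∈ irreds F d, ((irreds F d).filter fun P' =>
      slotMul (fun _ => P) T - slotMul (fun _ => P') T ∈ biasedForms F α m).card ≤ M) :
    Tendsto (fun n : ℕ => (∑ g ∈ polysLT F n, ν g * α (Q g)) / (Fintype.card F : ℂ) ^ n)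
      atTop (𝓝 0) := by
  refine tendsto_sum_mul_of_correlations hν hνb hpret (fun g => (AddChar.norm_apply α _).le) (M := M)
    fun d P hP => (Finset.card_le_card fun P' hP' => ?_).trans (hM d P hP)
  rw [Finset.mem_filter] at hP' ⊢
  refine ⟨hP'.1, ?_⟩
  by_contra hB
  refine hP'.2 ?_
  have h1 := ((h.comp (LinearMap.mulLeft ℤ P)).sub
    (h.comp (LinearMap.mulLeft ℤ P'))).tendsto_expect_of_notMem (α := α) hB
  simp only [expect_polysLT] at h1
  refine h1.congr fun n => ?_
  congr 1
  refine Finset.sum_congr rfl fun g _ => ?_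
  rw [Pi.sub_apply, sub_eq_add_neg, AddChar.map_add_eq_mul, AddChar.map_neg_eq_conj]
  rfl

lemma addChar_eq_one_of_mem_biasedForms_zero
    {T : MultilinearMap ℤ (fun _ : Fin (0 + 1) => F[X]) F} (hT : T ∈ biasedForms F α 0)
    (u : F[X]) : α (T.curryLeft u Fin.elim0) = 1 := by
  obtain ⟨c, hc, h⟩ := hT
  by_contra hu
  have hun : u ∈ polysLT F (u.natDegree + 1) := by
    rw [mem_polysLT]
    exact (degree_le_natDegree).trans_lt (by exact_mod_cast Nat.lt_succ_self _)
  have h1 := h (u.natDegree + 1)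
  rw [bias_eq_expect_headInd fun _ => isFinSubgroup_polysLT _] at h1
  refine absurd h1 (not_le.2 ?_)
  refine lt_of_eq_of_lt (Finset.expect_eq_zero fun x _ => ?_) hc
  rw [headInd, if_neg]
  intro h2
  refine hu ?_
  have := h2 u hun
  rwa [Subsingleton.elim x Fin.elim0] at this

lemma Lead.tendsto_of_mem_biasedForms {m : ℕ}
    {T : MultilinearMap ℤ (fun _ : Fin (m + 1) => F[X]) F} {Q : F[X] → F}
    (h : Lead (m + 1) T Q) (hνb : ∀ g, ‖ν g‖ ≤ 1) (hm : m + 1 < ringChar F)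
    (hT : T ∈ biasedForms F α m)
    (ih : ∀ R : F[X] → F, Lead (m + 1) 0 R →
      Tendsto (fun n : ℕ => (polysLT F n).expect fun g => ν g * α (R g)) atTop (𝓝 0)) :
    Tendsto (fun n : ℕ => (polysLT F n).expect fun g => ν g * α (Q g)) atTop (𝓝 0) := by
  obtain ⟨k, hk⟩ : ∃ k : ℕ, (m + 1).factorial • (k • T) = T := by
    have hp : (ringChar F).Prime := CharP.char_is_prime F _
    have hcop : Nat.Coprime (m + 1).factorial (ringChar F) := by
      rw [Nat.coprime_comm, hp.coprime_iff_not_dvd, hp.dvd_factorial]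
      omega
    obtain ⟨k, -, hk⟩ := Nat.exists_mul_mod_eq_one_of_coprime hcop hp.one_lt
    refine ⟨k, ?_⟩
    ext x
    rw [smul_smul, smul_apply, nsmul_eq_mul]
    have : (((m + 1).factorial * k : ℕ) : F) = ((1 : ℕ) : F) := by
      rw [CharP.cast_eq_mod F (ringChar F), hk]
    rw [this, Nat.cast_one, one_mul]
  have hT' : k • T ∈ biasedForms F α m := nsmul_mem hT k
  have hlead : ∀ a : Fin (m + 1) → F[X], Lead (m + 1) 0
      (Q - fun g => (k • T) fun i => g + a i) := by
    intro a
    have := h.sub ((h.nsmul k).affine_diagonal a)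
    rwa [hk, sub_self] at this
  clear hk
  generalize k • T = S at hT' hlead
  obtain ⟨c, hc, hcb⟩ := hT'
  set b : ℕ → ℝ := fun n => bias α (fun _ => polysLT F n) S with hb
  have hanti : Antitone b := bias_polysLT_antitone S
  obtain ⟨β, hβ⟩ : ∃ β, Tendsto b atTop (𝓝 β) :=
    ⟨_, tendsto_atTop_ciInf hanti ⟨c, by rintro _ ⟨n, rfl⟩; exact hcb n⟩⟩
  have hβle : ∀ n, β ≤ b n := hanti.le_of_tendsto hβ
  set E : ℕ → ℂ := fun n => (polysLT F n).expect fun g => ν g * α (Q g) with hE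
  set R : ℕ → ℕ → ℂ := fun k n => (polysLT F n).expect fun g =>
    ν g * α (Q g) * conj (localAvg α (polysLT F k) S g) with hR
  have hRt : ∀ k, Tendsto (R k) atTop (𝓝 0) := by
    intro k
    set I := Fintype.piFinset fun _ : Fin (m + 1) => polysLT F k
    have e1 : ∀ n, R k n = (∑ a ∈ I, (polysLT F n).expect fun g =>
        ν g * α ((Q - fun g => S fun i => g + a i) g)) / (I.card : ℂ) := by
      intro n
      rw [← Finset.expect_eq_sum_div_card, expect_comm]
      refine expect_congr rfl fun g _ => ?_
      rw [localAvg, conj_expect_complex, mul_expect]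
      refine expect_congr rfl fun a _ => ?_
      rw [Pi.sub_apply, sub_eq_add_neg, AddChar.map_add_eq_mul, AddChar.map_neg_eq_conj, mul_assoc]
    rw [funext e1]
    have := (tendsto_finsetSum I fun a _ => ih _ (hlead a)).div_const (I.card : ℂ)
    simpa using this
  have hkey : ∀ k n, k ≤ n → c * ‖E n‖ ≤ approxConst (m + 1) * (b k - b n) + ‖R k n‖ := by
    intro k n hkn
    have h1 := expect_localAvg_sub_le (α := α) (isFinSubgroup_polysLT k) (isFinSubgroup_polysLT n)
      (polysLT_mono hkn) S
    set B := cbias α (fun _ => polysLT F n) S with hB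
    have hBn : ‖B‖ = b n := norm_cbias (fun _ => isFinSubgroup_polysLT n) S
    have e2 : E n * conj B = R k n - (polysLT F n).expect fun g =>
        ν g * α (Q g) * conj (localAvg α (polysLT F k) S g - B) := by
      rw [hE, hR, expect_mul, ← Finset.expect_sub_distrib]
      refine expect_congr rfl fun g _ => ?_
      rw [map_sub]; ring
    calc c * ‖E n‖ ≤ b n * ‖E n‖ := mul_le_mul_of_nonneg_right (hcb n) (norm_nonneg _)
      _ = ‖E n * conj B‖ := by rw [norm_mul, RCLike.norm_conj, hBn, mul_comm]
      _ ≤ ‖R k n‖ + ‖(polysLT F n).expect fun g =>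
          ν g * α (Q g) * conj (localAvg α (polysLT F k) S g - B)‖ := by
        rw [e2]; exact norm_sub_le _ _
      _ ≤ ‖R k n‖ + (polysLT F n).expect fun g => ‖localAvg α (polysLT F k) S g - B‖ := by
        gcongr
        refine (RCLike.norm_expect_le (K := ℂ)).trans (expect_le_expect fun g _ => ?_)
        rw [norm_mul, norm_mul, AddChar.norm_apply, mul_one, RCLike.norm_conj]
        exact mul_le_of_le_one_left (norm_nonneg _) (hνb g)
      _ ≤ approxConst (m + 1) * (b k - b n) + ‖R k n‖ := by linarith
  rw [Metric.tendsto_atTop]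
  intro ε hε
  have hC := approxConst_nonneg (m + 1)
  set C := approxConst (m + 1)
  obtain ⟨k, hk⟩ : ∃ k, b k < β + c * ε / (2 * (C + 1)) :=
    ((tendsto_order.1 hβ).2 _ (by linarith [show 0 < c * ε / (2 * (C + 1)) by positivity])).exists
  obtain ⟨N, hN⟩ := Metric.tendsto_atTop.1 (hRt k) (c * ε / 2) (by positivity)
  refine ⟨max k N, fun n hn => ?_⟩
  have h1 := hkey k n ((le_max_left _ _).trans hn)
  have h2 := hN n ((le_max_right _ _).trans hn)
  rw [dist_zero_right] at h2 ⊢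
  have h3 : C * (b k - b n) ≤ c * ε / 2 := by
    calc C * (b k - b n) ≤ (C + 1) * (c * ε / (2 * (C + 1))) := by
          refine mul_le_mul (by linarith) (by linarith [hβle n]) ?_ (by linarith)
          exact sub_nonneg.2 (hanti ((le_max_left _ _).trans hn))
      _ = c * ε / 2 := by field_simp
  have h4 : c * ‖E n‖ < c * ε := by linarith
  exact lt_of_mul_lt_mul_left h4 hc.le

theorem Lead.tendsto_sum_polysLT (hν : IsMultFn ν) (hνb : ∀ g, ‖ν g‖ ≤ 1)
    (hpret : ∀ χ ξ : Polynomial F → ℂ, ∀ θ : ℝ,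
      IsDirichletChar χ → IsShortIntervalChar ξ → θ ∈ Set.Ico (0 : ℝ) 1 →
      Tendsto (fun N : ℕ => pretDist ν (fun g => χ g * ξ g * eTheta θ g) N) atTop atTop)
    (m : ℕ) (hm : m ≤ ringChar F) {Q : F[X] → F} (h : Lead m 0 Q) :
    Tendsto (fun n : ℕ => (∑ g ∈ polysLT F n, ν g * α (Q g)) / (Fintype.card F : ℂ) ^ n)
      atTop (𝓝 0) := by
  induction m generalizing Q with
  | zero =>
    refine tendsto_sum_polysLT_periodic hν hνb hpret one_ne_zero fun g g' _ => ?_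
    rw [h g, h g']
  | succ m ih =>
    obtain ⟨T, hT⟩ := h.exists
    match m, ih, T, hT with
    | 0, _, T, hT =>
      refine tendsto_sum_polysLT_periodic hν hνb hpret one_ne_zero fun g g' _ => ?_
      rw [hT g, hT g']
    | 1, _, T, hT =>
      by_cases hex : ∃ d, ∃ P ∈ irreds F d, ∃ P' ∈ irreds F d, P ≠ P' ∧
          slotMul (fun _ => P) T - slotMul (fun _ => P') T ∈ biasedForms F α 0
      · obtain ⟨d, P, -, P', -, hne, hB⟩ := hex
        refine tendsto_sum_polysLT_periodic hν hνb hpret (sub_ne_zero.2 hne) fun g g' hd => ?_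
        obtain ⟨t, ht⟩ := hd
        have h1 := addChar_eq_one_of_mem_biasedForms_zero hB t
        have h2 := hT ((P - P') * t) g'
        have h3 : (slotMul (fun _ => P) T - slotMul (fun _ => P') T).curryLeft t Fin.elim0 =
            T.curryLeft ((P - P') * t) Fin.elim0 := by
          have e : ∀ R : F[X], slotMul (fun _ => R) T (Fin.cons t Fin.elim0) =
              T (Fin.cons (R * t) Fin.elim0) := by
            intro R
            rw [slotMul_apply]
            congr 1
            ext1 i
            rw [Fin.fin_one_eq_zero i]; rfl
          have e2 := multilinear_cons_add T Fin.elim0 ((P - P') * t) (P' * t)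
          rw [← add_mul, sub_add_cancel] at e2
          rw [MultilinearMap.curryLeft_apply, MultilinearMap.curryLeft_apply, sub_apply, e, e, e2,
            add_sub_cancel_right]
        rw [h3, ← h2, Δop, ← ht, add_sub_cancel, sub_eq_add_neg, AddChar.map_add_eq_mul,
          AddChar.map_neg_eq_inv, mul_inv_eq_one₀] at h1
        · exact h1
        · exact norm_ne_zero_iff.1 (by rw [AddChar.norm_apply]; exact one_ne_zero)
      · push Not at hex
        refine hT.tendsto_of_correlations hν hνb hpret (M := 1) fun d P hP => ?_
        refine Finset.card_le_one.2 fun P₁ h₁ P₂ h₂ => ?_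
        rw [Finset.mem_filter] at h₁ h₂
        by_contra hne
        have e1 : P = P₁ := by
          by_contra h'
          exact hex d P hP P₁ h₁.1 h' h₁.2
        have e2 : P = P₂ := by
          by_contra h'
          exact hex d P hP P₂ h₂.1 h' h₂.2
        exact hne (e1.symm.trans e2)
    | m + 2, ih, T, hT =>
      by_cases hB : T ∈ biasedForms F α (m + 1)
      · simp only [← expect_polysLT] at ih ⊢
        exact hT.tendsto_of_mem_biasedForms hνb (by omega) hB fun R hR => ih (by omega) hR
      · exact hT.tendsto_of_correlations hν hνb hpret fun d P _ =>
          card_irreds_slotMul_sub_mem_le (biasedForms F α (m + 1))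
            (fun _ hT f => slotMul_mem_biasedForms hT f) 0
            (fun _ _ hf h => mem_biasedForms_of_slotMul_mem hf h) hB d

end PolynomialPhases

theorem stmt1 {F : Type*} [Field F] [Fintype F]
    (ν : Polynomial F → ℂ) (hν : IsMultFn ν) (hνb : ∀ g, ‖ν g‖ ≤ 1)
    (hpret : ∀ χ ξ : Polynomial F → ℂ, ∀ θ : ℝ,
      IsDirichletChar χ → IsShortIntervalChar ξ → θ ∈ Set.Ico (0 : ℝ) 1 →
      Tendsto (fun N : ℕ => pretDist ν (fun g => χ g * ξ g * eTheta θ g) N) atTop atTop)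
    (m : ℕ) (hm : 0 < m) (hmp : m < ringChar F)
    (P : Polynomial F → F) (hP : DegLE P m)
    (α : F → ℂ) (hαadd : ∀ a b, α (a + b) = α a * α b)
    (hα1 : ∀ a, ‖α a‖ = 1) :
    Tendsto (fun n : ℕ => (1 / (Fintype.card F : ℂ) ^ n) *
        ∑ c : Fin n → F, ν (polyOf c) * α (P (polyOf c)))
      atTop (nhds 0) := by
  have h0 : α 0 = 1 := by
    have h1 := hαadd 0 0
    rw [add_zero] at h1
    have h2 : α 0 ≠ 0 := norm_ne_zero_iff.1 (by rw [hα1]; exact one_ne_zero)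
    exact mul_left_cancel₀ h2 (by rw [← h1, mul_one])
  let α' : AddChar F ℂ := ⟨α, h0, hαadd⟩
  refine (Lead.tendsto_sum_polysLT (α := α') hν hνb hpret (m + 1) hmp hP.lead).congr fun n => ?_
  rw [sum_polyOf n fun g => ν g * α (P g), one_div, div_eq_inv_mul]
  rfl
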